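/- Let rectangular Θ-diagrams (α, β, γ, δ) and (α′, β′, γ′, δ′) be Legendrian equivalent (connected by a finite sequence of permitted moves). Then: (i) tb(α ∪ β) = tb(α′ ∪ β′) (in particular, if (α, β) is a bypass of weight b for the diagram β ∪ γ ∪ δ, then (α′, β′) is a bypass of weight b for β′ ∪ γ′ ∪ δ′); and (ii) the rectangular diagrams α ∪ γ ∪ δ and α′ ∪ γ′ ∪ δ′ are Legendrian equivalent. -/

import Mathlib

noncomputable section
open scoped Classical

/-- A point of the plane. -/
abbrev Pt : Type := ℝ × ℝ

/-- A rectangular diagram: a finite set of points in the plane such that every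
vertical or horizontal straight line contains either no points or exactly two points of it. -/
def IsDiagram (R : Finset Pt) : Prop :=
  ∀ p ∈ R, (R.filter (fun q => q.1 = p.1)).card = 2 ∧
    (R.filter (fun q => q.2 = p.2)).card = 2

/-- The complexity of a rectangular diagram: the number of its vertical edges. -/
def complexity (R : Finset Pt) : ℕ := (R.image Prod.fst).card

/-- Moving the vertical line `x0` to position `x1` (all other points unchanged). -/
def vmap (x0 x1 : ℝ) : Pt → Pt := fun p => if p.1 = x0 then (x1, p.2) else p

/-- Moving the horizontal line `y0` to position `y1`. -/
def hmap (y0 y1 : ℝ) : Pt → Pt := fun p => if p.2 = y0 then (p.1, y1) else p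

/-- Exchanging the vertical lines `x1` and `x2`. -/
def swapv (x1 x2 : ℝ) : Pt → Pt := fun p =>
  if p.1 = x1 then (x2, p.2) else if p.1 = x2 then (x1, p.2) else p

/-- Exchanging the horizontal lines `y1` and `y2`. -/
def swaph (y1 y2 : ℝ) : Pt → Pt := fun p =>
  if p.2 = y1 then (p.1, y2) else if p.2 = y2 then (p.1, y1) else p

/-- `f` realizes a cyclic permutation on the finite set `R`:  an extreme (left/right/top/bottom)
edge is moved to the opposite side of the diagram. -/
def CyclicData (R : Finset Pt) (f : Pt → Pt) : Prop :=
  (∃ x0 x1 : ℝ, (∃ p ∈ R, p.1 = x0) ∧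
     (((∀ p ∈ R, x0 ≤ p.1) ∧ ∀ p ∈ R, p.1 ≠ x0 → p.1 < x1) ∨
      ((∀ p ∈ R, p.1 ≤ x0) ∧ ∀ p ∈ R, p.1 ≠ x0 → x1 < p.1)) ∧
     f = vmap x0 x1) ∨
  (∃ y0 y1 : ℝ, (∃ p ∈ R, p.2 = y0) ∧
     (((∀ p ∈ R, y0 ≤ p.2) ∧ ∀ p ∈ R, p.2 ≠ y0 → p.2 < y1) ∨
      ((∀ p ∈ R, p.2 ≤ y0) ∧ ∀ p ∈ R, p.2 ≠ y0 → y1 < p.2)) ∧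
     f = hmap y0 y1)

/-- The pairs of second coordinates of the points of `R` on the vertical lines `x1`, `x2`
do not interleave. -/
def NoInterleaveV (R : Finset Pt) (x1 x2 : ℝ) : Prop :=
  ∀ p ∈ R, ∀ p' ∈ R, ∀ q ∈ R, ∀ q' ∈ R,
    p.1 = x1 → p'.1 = x1 → q.1 = x2 → q'.1 = x2 →
    ¬ ((p.2 < q.2 ∧ q.2 < p'.2 ∧ p'.2 < q'.2) ∨
       (q.2 < p.2 ∧ p.2 < q'.2 ∧ q'.2 < p'.2))

/-- The pairs of first coordinates of the points of `R` on the horizontal lines `y1`, `y2`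
do not interleave. -/
def NoInterleaveH (R : Finset Pt) (y1 y2 : ℝ) : Prop :=
  ∀ p ∈ R, ∀ p' ∈ R, ∀ q ∈ R, ∀ q' ∈ R,
    p.2 = y1 → p'.2 = y1 → q.2 = y2 → q'.2 = y2 →
    ¬ ((p.1 < q.1 ∧ q.1 < p'.1 ∧ p'.1 < q'.1) ∨
       (q.1 < p.1 ∧ p.1 < q'.1 ∧ q'.1 < p'.1))

/-- `f` realizes a commutation on `R`: two neighboring parallel edges, whose pairs of endpoints
projected to the common axis are disjoint and do not interleave, are exchanged. -/
def CommData (R : Finset Pt) (f : Pt → Pt) : Prop :=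
  (∃ x1 x2 : ℝ, x1 ≠ x2 ∧ (∃ p ∈ R, p.1 = x1) ∧ (∃ p ∈ R, p.1 = x2) ∧
     (∀ p ∈ R, ¬ (min x1 x2 < p.1 ∧ p.1 < max x1 x2)) ∧
     (∀ p ∈ R, ∀ q ∈ R, p.1 = x1 → q.1 = x2 → p.2 ≠ q.2) ∧
     NoInterleaveV R x1 x2 ∧ f = swapv x1 x2) ∨
  (∃ y1 y2 : ℝ, y1 ≠ y2 ∧ (∃ p ∈ R, p.2 = y1) ∧ (∃ p ∈ R, p.2 = y2) ∧
     (∀ p ∈ R, ¬ (min y1 y2 < p.2 ∧ p.2 < max y1 y2)) ∧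
     (∀ p ∈ R, ∀ q ∈ R, p.2 = y1 → q.2 = y2 → p.1 ≠ q.1) ∧
     NoInterleaveH R y1 y2 ∧ f = swaph y1 y2)

/-- A cyclic permutation move of rectangular diagrams. -/
def CyclicMove (R R' : Finset Pt) : Prop :=
  IsDiagram R ∧ IsDiagram R' ∧ ∃ f, CyclicData R f ∧ R' = R.image f

/-- A commutation move of rectangular diagrams. -/
def CommMove (R R' : Finset Pt) : Prop :=
  IsDiagram R ∧ IsDiagram R' ∧ ∃ f, CommData R f ∧ R' = R.image f

/-- The type of a stabilization/destabilization. -/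
inductive StabType
  | I : StabType
  | II : StabType
deriving DecidableEq

/-- Result of replacing the vertex `(x, y)` by the three other vertices of the small square
with corners `(x, y)`, `(x', y)`, `(x, y')`, `(x', y')`. -/
def stabSet (x y x' y' : ℝ) (C : Finset Pt) : Finset Pt :=
  insert ((x', y) : Pt) (insert ((x, y') : Pt) (insert ((x', y') : Pt) (C.erase (x, y))))

/-- The data of a stabilization of `R` at the vertex `(x, y)`, yielding `R'`:  the vertex is
replaced by the three other corners of a small square (`x'`, `y'` are fresh coordinates,
and no coordinate of `R` lies strictly between `x, x'` nor between `y, y'`). -/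
def StabData (x y x' y' : ℝ) (R R' : Finset Pt) : Prop :=
  (x, y) ∈ R ∧ x ≠ x' ∧ y ≠ y' ∧
  (∀ p ∈ R, p.1 ≠ x') ∧ (∀ p ∈ R, p.2 ≠ y') ∧
  (∀ p ∈ R, ¬ (min x x' < p.1 ∧ p.1 < max x x')) ∧
  (∀ p ∈ R, ¬ (min y y' < p.2 ∧ p.2 < max y y')) ∧
  R' = stabSet x y x' y' R

/-- A stabilization of type `t` occurring at the vertex `v` of `R`.  The type is I when the two
new short edges point from their common vertex downward-and-leftward or upward-and-rightward. -/
def StabMoveAt (t : StabType) (v : Pt) (R R' : Finset Pt) : Prop :=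
  IsDiagram R ∧ IsDiagram R' ∧
  ∃ x' y' : ℝ, StabData v.1 v.2 x' y' R R' ∧
    (t = StabType.I ↔ 0 < (v.1 - x') * (v.2 - y'))

/-- A stabilization of type `t`. -/
def StabMove (t : StabType) (R R' : Finset Pt) : Prop :=
  ∃ v : Pt, StabMoveAt t v R R'

/-- A complexity-preserving elementary move: a cyclic permutation or a commutation. -/
def ExchangeMove (R R' : Finset Pt) : Prop := CyclicMove R R' ∨ CommMove R R'

/-- An elementary move of rectangular diagrams: a cyclic permutation, a commutation,
a stabilization or a destabilization. -/
def ElemMove (R R' : Finset Pt) : Prop :=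
  CyclicMove R R' ∨ CommMove R R' ∨ ∃ t, StabMove t R R' ∨ StabMove t R' R

/-- An elementary move involving no stabilization or destabilization of type other than `t`. -/
def LegMove (t : StabType) (R R' : Finset Pt) : Prop :=
  CyclicMove R R' ∨ CommMove R R' ∨ StabMove t R R' ∨ StabMove t R' R

/-- Legendrian equivalence: connected by a finite sequence of elementary moves containing
no type II stabilizations or destabilizations. -/
def LegEquiv : Finset Pt → Finset Pt → Prop :=
  Relation.ReflTransGen (LegMove StabType.I)

/-- Connected by a finite sequence of elementary moves containing
no type I stabilizations or destabilizations. -/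
def MirrorEquiv : Finset Pt → Finset Pt → Prop :=
  Relation.ReflTransGen (LegMove StabType.II)

/-- An elementary simplification of type `t` : a finite sequence of cyclic permutations and
commutations followed by one destabilization of type `t`. -/
def ElemSimp (t : StabType) (R R' : Finset Pt) : Prop :=
  ∃ S, Relation.ReflTransGen ExchangeMove R S ∧ StabMove t R' S
/-- An orientation of a rectangular diagram, given by a coloring of its vertices in black
(`true`) and white (`false`):  the two vertices on a common vertical or horizontal line get
opposite colors; vertical edges are directed from the black endpoint to the white one,
horizontal edges from the white endpoint to the black one. -/
def IsOrientation (R : Finset Pt) (o : Pt → Bool) : Prop :=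
  ∀ p ∈ R, ∀ q ∈ R, p ≠ q → (p.1 = q.1 ∨ p.2 = q.2) → o p ≠ o q

/-- The writhe of an oriented rectangular diagram: the algebraic number of crossings, where
at every crossing the vertical edge is the overpass. -/
def writhe (R : Finset Pt) (o : Pt → Bool) : ℤ :=
  ∑ a ∈ R, ∑ b ∈ R, ∑ c ∈ R, ∑ d ∈ R,
    if a.1 = b.1 ∧ o a = true ∧ o b = false ∧
       c.2 = d.2 ∧ o c = false ∧ o d = true ∧
       min c.1 d.1 < a.1 ∧ a.1 < max c.1 d.1 ∧
       min a.2 b.2 < c.2 ∧ c.2 < max a.2 b.2 then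
      -((if a.2 < b.2 then (1 : ℤ) else -1) * (if c.1 < d.1 then (1 : ℤ) else -1))
    else 0

/-- The number of cusps of the associated Legendrian front: the number of vertices of `R` at
which the incident vertical edge goes upward and the incident horizontal edge goes leftward,
or the vertical edge goes downward and the horizontal edge goes rightward. -/
def cusps (R : Finset Pt) : ℕ :=
  (R.filter (fun p => ∃ q ∈ R, ∃ r ∈ R, q ≠ p ∧ q.1 = p.1 ∧ r ≠ p ∧ r.2 = p.2 ∧
     ((p.2 < q.2 ∧ r.1 < p.1) ∨ (q.2 < p.2 ∧ p.1 < r.1)))).card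

/-- The Thurston–Bennequin number of an oriented rectangular diagram. -/
def tb (R : Finset Pt) (o : Pt → Bool) : ℚ :=
  (writhe R o : ℚ) - (cusps R : ℚ) / 2
/-- A rectangular diagram of a knot: a nonempty rectangular diagram none of whose nonempty
proper subsets is a rectangular diagram (i.e. it consists of a single closed broken line). -/
def IsKnotDiagram (R : Finset Pt) : Prop :=
  IsDiagram R ∧ R.Nonempty ∧ ∀ S ⊆ R, IsDiagram S → S.Nonempty → S = R

/-- A connected component of a rectangular diagram `R`: a subset of `R` that is itself a
rectangular diagram of a knot. -/
def IsComponent (R K : Finset Pt) : Prop := K ⊆ R ∧ IsKnotDiagram K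

/-- A rectangular path: a finite planar point set that becomes a rectangular diagram of a knot
after adding exactly one point, or exactly two points lying on one vertical or horizontal line;
a single point is also a rectangular path. -/
def IsPath (P : Finset Pt) : Prop :=
  (∃ p : Pt, P = {p}) ∨
  (∃ q : Pt, q ∉ P ∧ IsKnotDiagram (insert q P)) ∨
  (∃ q r : Pt, q ≠ r ∧ q ∉ P ∧ r ∉ P ∧ (q.1 = r.1 ∨ q.2 = r.2) ∧
     IsKnotDiagram (insert q (insert r P)))

/-- The ends of a rectangular path: the (vertical — `true`, or horizontal — `false`) straight
lines containing exactly one vertex of the path. -/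
def Ends (P : Finset Pt) : Set (Bool × ℝ) :=
  {l | (l.1 = true ∧ (P.filter (fun p => p.1 = l.2)).card = 1) ∨
       (l.1 = false ∧ (P.filter (fun p => p.2 = l.2)).card = 1)}
/-- Three-dimensional space. -/
abbrev R3 : Type := ℝ × ℝ × ℝ

/-- The spatial realization of a finite planar set: the union of the straight line segments
joining `(2i, 0, 1)` to `(0, 2j, -1)` over all `(i, j)` in the set. -/
def spatial (X : Finset Pt) : Set R3 :=
  ⋃ p ∈ X, segment ℝ ((2 * p.1, 0, 1) : R3) ((0, 2 * p.2, -1) : R3)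

/-- Shift of a planar set by the vector `(δ, δ)`. -/
def shiftD (δ : ℝ) (X : Finset Pt) : Finset Pt :=
  X.image (fun p => (p.1 + δ, p.2 + δ))

/-- Two subsets of space are unlinked: they are separated by an embedded two-sphere. -/
def SphereSeparated (A C : Set R3) : Prop :=
  ∃ S : Set R3,
    Nonempty (S ≃ₜ Metric.sphere (0 : EuclideanSpace ℝ (Fin 3)) 1) ∧
    S ∩ (A ∪ C) = ∅ ∧
    ∃ U V : Set R3, IsOpen U ∧ IsOpen V ∧ Disjoint U V ∧ U ∪ V = Sᶜ ∧ A ⊆ U ∧ C ⊆ V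

/-- A bypass `(α, β)` for the rectangular diagram `R`:  `α`, `β` are rectangular paths with
common ends, `β ⊆ R`, the pair is in general position with respect to `R`, there is an
embedded two-dimensional disc `D` in space with `∂D = α̃ ∪ β̃` and `D ∩ R̃ = β̃`, and in the link
given by `(R \ β) ∪ α ∪ (α∪β)↗ ∪ (α∪β)↙` the components presented by `(R \ β) ∪ α` are
unlinked with the two components presented by the shifted copies of `α ∪ β`. -/
def IsBypass (R α β : Finset Pt) : Prop :=
  IsPath α ∧ IsPath β ∧ β ⊆ R ∧ Ends α = Ends β ∧
  (∀ p ∈ α, ∀ q ∈ R,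
     (p.1 = q.1 → (true, p.1) ∈ Ends α) ∧ (p.2 = q.2 → (false, p.2) ∈ Ends α)) ∧
  (∃ f : (ℝ × ℝ) → R3,
     ContinuousOn f (Metric.closedBall (0 : ℝ × ℝ) 1) ∧
     Set.InjOn f (Metric.closedBall (0 : ℝ × ℝ) 1) ∧
     f '' (Metric.sphere (0 : ℝ × ℝ) 1) = spatial α ∪ spatial β ∧
     (f '' (Metric.closedBall (0 : ℝ × ℝ) 1)) ∩ spatial R = spatial β) ∧
  (∃ ε : ℝ, 0 < ε ∧ ∀ δ : ℝ, 0 < δ → δ ≤ ε →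
     SphereSeparated (spatial ((R \ β) ∪ α))
       (spatial (shiftD δ (α ∪ β) ∪ shiftD (-δ) (α ∪ β))))

/-- The bypass `(α, β)` has weight `b`, i.e. the Thurston–Bennequin number of the knot diagram
`α ∪ β` equals `-b` (for an orientation of it; a knot's `tb` does not depend on this choice). -/
def BypassWeight (α β : Finset Pt) (b : ℕ) : Prop :=
  ∃ o : Pt → Bool, IsOrientation (α ∪ β) o ∧ tb (α ∪ β) o = -(b : ℚ)
/-- A rectangular Θ-diagram: three rectangular paths `a`, `b`, `c` with common pairs of ends
and a rectangular diagram `d`. -/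
structure Theta where
  a : Finset Pt
  b : Finset Pt
  c : Finset Pt
  d : Finset Pt

/-- The set of all vertices of a Θ-diagram. -/
def Theta.U (T : Theta) : Finset Pt := T.a ∪ T.b ∪ T.c ∪ T.d

/-- General position of two vertex sets: distinct vertices may share a (vertical or
horizontal) line only if the line belongs to `E` (the ends). -/
def CrossGP (A C : Finset Pt) (E : Set (Bool × ℝ)) : Prop :=
  ∀ p ∈ A, ∀ q ∈ C,
    (p.1 = q.1 → (true, p.1) ∈ E) ∧ (p.2 = q.2 → (false, p.2) ∈ E)

/-- Validity of a rectangular Θ-diagram: `a`, `b`, `c` are rectangular paths sharing both of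
their ends, `d` is a rectangular diagram, and all are in general position (no two vertices on
a common line except as forced by the construction, i.e. on the two common end lines). -/
def ThetaOK (T : Theta) : Prop :=
  IsPath T.a ∧ IsPath T.b ∧ IsPath T.c ∧ IsDiagram T.d ∧
  Ends T.a = Ends T.b ∧ Ends T.a = Ends T.c ∧
  Disjoint T.a T.b ∧ Disjoint T.a T.c ∧ Disjoint T.b T.c ∧
  Disjoint T.a T.d ∧ Disjoint T.b T.d ∧ Disjoint T.c T.d ∧
  CrossGP T.a T.b (Ends T.a) ∧ CrossGP T.a T.c (Ends T.a) ∧ CrossGP T.b T.c (Ends T.a) ∧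
  CrossGP T.a T.d ∅ ∧ CrossGP T.b T.d ∅ ∧ CrossGP T.c T.d ∅

/-- Applying a planar map to all constituents of a Θ-diagram. -/
def mapTheta (f : Pt → Pt) (T : Theta) : Theta :=
  ⟨T.a.image f, T.b.image f, T.c.image f, T.d.image f⟩

/-- A cyclic permutation of a rectangular Θ-diagram (an extreme edge, or an extreme common
end of the three paths, is moved to the opposite side). -/
def ThCyclic (T T' : Theta) : Prop :=
  ThetaOK T ∧ ThetaOK T' ∧ ∃ f, CyclicData T.U f ∧ T' = mapTheta f T

/-- A commutation of a rectangular Θ-diagram (two neighboring parallel edges, or an edge and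
a common end, or the two common ends, are exchanged, provided no endpoint pairs interleave). -/
def ThComm (T T' : Theta) : Prop :=
  ThetaOK T ∧ ThetaOK T' ∧ ∃ f, CommData T.U f ∧ T' = mapTheta f T

/-- A type I stabilization of a Θ-diagram at any vertex (including endpoints of the paths). -/
def ThStabI (T T' : Theta) : Prop :=
  ThetaOK T ∧ ThetaOK T' ∧
  ∃ x y x' y' : ℝ, (x, y) ∈ T.U ∧ x ≠ x' ∧ y ≠ y' ∧
    (∀ p ∈ T.U, p.1 ≠ x') ∧ (∀ p ∈ T.U, p.2 ≠ y') ∧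
    (∀ p ∈ T.U, ¬ (min x x' < p.1 ∧ p.1 < max x x')) ∧
    (∀ p ∈ T.U, ¬ (min y y' < p.2 ∧ p.2 < max y y')) ∧
    0 < (x - x') * (y - y') ∧
    (((x, y) ∈ T.a ∧ T' = ⟨stabSet x y x' y' T.a, T.b, T.c, T.d⟩) ∨
     ((x, y) ∈ T.b ∧ T' = ⟨T.a, stabSet x y x' y' T.b, T.c, T.d⟩) ∨
     ((x, y) ∈ T.c ∧ T' = ⟨T.a, T.b, stabSet x y x' y' T.c, T.d⟩) ∨
     ((x, y) ∈ T.d ∧ T' = ⟨T.a, T.b, T.c, stabSet x y x' y' T.d⟩))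

/-- Shift of a point upward by `ε`. -/
def ptUp (ε : ℝ) (P : Pt) : Pt := (P.1, P.2 + ε)

/-- Shift of a point downward by `ε`. -/
def ptDn (ε : ℝ) (P : Pt) : Pt := (P.1, P.2 - ε)

/-- The path of the Θ-diagram `T` containing the point `P`. -/
def pathOf (T : Theta) (P : Pt) : Finset Pt :=
  if P ∈ T.a then T.a else if P ∈ T.b then T.b else T.c

/-- Replacement of the endpoint `P1`, `P2` or `P3` of a path by the prescribed set. -/
def updPath (C : Finset Pt) (P1 P2 P3 : Pt) (r1 r2 r3 : Finset Pt) : Finset Pt :=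
  if P1 ∈ C then (C.erase P1) ∪ r1
  else if P2 ∈ C then (C.erase P2) ∪ r2
  else (C.erase P3) ∪ r3

/-- An end shift at a horizontal common end of the three paths of a Θ-diagram: one of the three
endpoints `P1`, `P2`, `P3` (listed from left to right) on the common horizontal end line is
deleted, and two new vertices close to the remaining ones are added instead, in one of the six
combinatorially allowed ways. -/
def ThEndShiftH (T T' : Theta) : Prop :=
  ThetaOK T ∧ ThetaOK T' ∧
  ∃ (y0 : ℝ) (P1 P2 P3 : Pt) (ε : ℝ), 0 < ε ∧
    (∀ p ∈ T.U, ∀ q ∈ T.U, p.2 ≠ q.2 → ε < |p.2 - q.2|) ∧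
    P1.2 = y0 ∧ P2.2 = y0 ∧ P3.2 = y0 ∧ P1.1 < P2.1 ∧ P2.1 < P3.1 ∧
    (T.a ∪ T.b ∪ T.c).filter (fun p => p.2 = y0) = {P1, P2, P3} ∧
    T'.d = T.d ∧
    ∃ r1 r2 r3 : Finset Pt,
      ((r1 = {ptUp ε P1, ptUp ε P2} ∧ r2 = ∅ ∧ r3 = {P2, P3} ∧ pathOf T P2 ≠ {P2}) ∨
       (r1 = {ptDn ε P1, ptDn ε P3} ∧ r2 = {P2, P3} ∧ r3 = ∅ ∧ pathOf T P3 ≠ {P3}) ∨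
       (r1 = {P1, P3} ∧ r2 = {ptUp ε P2, ptUp ε P3} ∧ r3 = ∅ ∧ pathOf T P3 ≠ {P3}) ∨
       (r1 = ∅ ∧ r2 = {ptDn ε P2, ptDn ε P1} ∧ r3 = {P1, P3} ∧ pathOf T P1 ≠ {P1}) ∨
       (r1 = ∅ ∧ r2 = {P1, P2} ∧ r3 = {ptUp ε P3, ptUp ε P1} ∧ pathOf T P1 ≠ {P1}) ∨
       (r1 = {P1, P2} ∧ r2 = ∅ ∧ r3 = {ptDn ε P3, ptDn ε P2} ∧ pathOf T P2 ≠ {P2})) ∧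
      T'.a = updPath T.a P1 P2 P3 r1 r2 r3 ∧
      T'.b = updPath T.b P1 P2 P3 r1 r2 r3 ∧
      T'.c = updPath T.c P1 P2 P3 r1 r2 r3

/-- Transposition (mirror image in a diagonal) of a Θ-diagram. -/
def Theta.tr (T : Theta) : Theta := mapTheta (fun p => (p.2, p.1)) T

/-- An end shift (at a horizontal or at a vertical common end). -/
def ThEndShift (T T' : Theta) : Prop :=
  ThEndShiftH T T' ∨ ThEndShiftH T.tr T'.tr

/-- A permitted move of rectangular Θ-diagrams: a cyclic permutation, a commutation,
a type I stabilization or destabilization, or an end shift. -/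
def ThMove (T T' : Theta) : Prop :=
  ThCyclic T T' ∨ ThComm T T' ∨ ThStabI T T' ∨ ThStabI T' T ∨ ThEndShift T T'

/-- Legendrian equivalence of rectangular Θ-diagrams: connected by a finite sequence of
permitted moves. -/
def ThetaEquiv : Theta → Theta → Prop := Relation.ReflTransGen ThMove
section
open Set Filter Topology

lemma cont_aux {X : Type*} [TopologicalSpace X] (F G E : X → ℝ) (hG : Continuous G)
    (hE : Continuous E) (h : ∀ x, |F x - G x| ≤ E x)
    (h2 : ∀ x, E x = 0 ∨ ContinuousAt F x) : Continuous F := by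
  rw [continuous_iff_continuousAt]
  intro x
  rcases h2 x with h0 | h0
  · have hx : F x = G x := by
      have := h x
      rw [h0] at this
      exact sub_eq_zero.1 (abs_nonpos_iff.1 this)
    have hd : Tendsto (fun y => F y - G y) (𝓝 x) (𝓝 0) := by
      refine squeeze_zero_norm (fun y => h y) ?_
      have := hE.tendsto x
      rwa [h0] at this
    have := hd.add (hG.tendsto x)
    simp only [sub_add_cancel, zero_add] at this
    rwa [ContinuousAt, hx]
  · exact h0

lemma exists_dist {M : Type*} [MetricSpace M] (K : Set M) (hK : IsClosed K) :
    ∃ D : M → ℝ, Continuous D ∧ (∀ m, 0 ≤ D m) ∧ (∀ m, D m = 0 → m ∈ K) ∧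
      ∀ m, ∀ k ∈ K, D m ≤ dist m k := by
  rcases K.eq_empty_or_nonempty with h | h
  · subst h
    exact ⟨fun _ => 1, continuous_const, fun _ => zero_le_one, by simp, by simp⟩
  · exact ⟨fun m => Metric.infDist m K, Metric.continuous_infDist_pt K,
      fun m => Metric.infDist_nonneg, fun m hm => (hK.mem_iff_infDist_zero h).2 hm,
      fun m k hk => Metric.infDist_le_dist_of_mem hk⟩

lemma Fplus {B : Type*} [MetricSpace B] (f0 g : B → ℝ) (hf0 : Continuous f0) (hg : Continuous g)
    (hg0 : ∀ b, 0 ≤ g b) (K : Set (ℝ × B)) (hKc : IsClosed K) (Z : Set B) (hZc : IsClosed Z)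
    (hK : ∀ b ∈ Z, ∀ v ∈ Icc (0 : ℝ) 1, (f0 b + v * g b, b) ∈ K → g b = 0) :
    ∃ h : (ℝ × B) ≃ₜ (ℝ × B), (∀ k ∈ K, h k = k) ∧ ∀ b ∈ Z, h (f0 b, b) = (f0 b + g b, b) := by
  obtain ⟨D, Dc, D0, DK, Dle⟩ := exists_dist K hKc
  obtain ⟨d, dc, d0, dZ, dle⟩ := exists_dist Z hZc
  have hdZ : ∀ b ∈ Z, d b = 0 := fun b hb => le_antisymm (by simpa using dle b b hb) (d0 b)
  set φ : B → ℝ → ℝ := fun b v => D (f0 b + v * g b, b) with hφ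
  have hφc : Continuous (Function.uncurry φ) := by
    have : Function.uncurry φ = fun q : B × ℝ => D (f0 q.1 + q.2 * g q.1, q.1) := by
      ext ⟨b, v⟩; rfl
    rw [this]; fun_prop
  set ρ : B → ℝ := fun b => sInf (φ b '' Icc 0 1) with hρ
  have ρc : Continuous ρ := isCompact_Icc.continuous_sInf hφc
  have ne : (Icc (0:ℝ) 1).Nonempty := ⟨0, by simp⟩
  have ρ0 : ∀ b, 0 ≤ ρ b := fun b => Real.sInf_nonneg (by rintro _ ⟨v, -, rfl⟩; exact D0 _)
  have ρle : ∀ b, ∀ v ∈ Icc (0:ℝ) 1, ρ b ≤ φ b v := fun b v hv =>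
    csInf_le ⟨0, by rintro _ ⟨v, -, rfl⟩; exact D0 _⟩ ⟨v, hv, rfl⟩
  have hφb : ∀ b, Continuous (φ b) := fun b => hφc.comp (by fun_prop : Continuous fun v : ℝ => (b, v))
  have ρz : ∀ b ∈ Z, ρ b = 0 → g b = 0 := by
    intro b hb h0
    obtain ⟨v, hv, hv'⟩ := isCompact_Icc.exists_sInf_image_eq ne (hφb b).continuousOn
    exact hK b hb v hv (DK _ (hv'.symm.trans h0))
  have zer : ∀ b, ρ b + d b = 0 → g b = 0 := fun b hb =>
    ρz b (dZ b (by linarith [ρ0 b, d0 b])) (by linarith [ρ0 b, d0 b])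
  set a : B → ℝ := fun b => 1 + g b / (ρ b + d b) with ha
  set e : B → ℝ := fun b => g b * (ρ b / (ρ b + d b)) with he
  have a1 : ∀ b, 1 ≤ a b := fun b => by
    have : 0 ≤ g b / (ρ b + d b) := div_nonneg (hg0 b) (add_nonneg (ρ0 b) (d0 b))
    simp only [ha]; linarith
  have e0 : ∀ b, 0 ≤ e b := fun b =>
    mul_nonneg (hg0 b) (div_nonneg (ρ0 b) (add_nonneg (ρ0 b) (d0 b)))
  have eg : ∀ b, e b ≤ g b := fun b =>
    mul_le_of_le_one_right (hg0 b) (div_le_one_of_le₀ (by linarith [d0 b])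
      (add_nonneg (ρ0 b) (d0 b)))
  have ea : ∀ b, e b = ρ b * (a b - 1) := fun b => by simp only [ha, he]; ring
  have ac : ∀ b, ρ b + d b ≠ 0 → ContinuousAt a b := fun b hb =>
    continuousAt_const.add (hg.continuousAt.div (ρc.add dc).continuousAt hb)
  have ec : Continuous e := by
    refine cont_aux e (fun _ => 0) g continuous_const hg
      (fun b => by rw [sub_zero, abs_of_nonneg (e0 b)]; exact eg b) (fun b => ?_)
    by_cases hb : ρ b + d b = 0
    · exact .inl (zer b hb)
    · exact .inr (hg.continuousAt.mul (ρc.continuousAt.div (ρc.add dc).continuousAt hb))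
  have ez : ∀ b, ρ b + d b = 0 → e b = 0 := fun b hb => by simp [he, zer b hb]
  set Φ : B → ℝ → ℝ := fun b r => max r (min (e b + a b * r) (e b + r / a b)) with hΦ
  set Ψ : B → ℝ → ℝ := fun b w => min w (max ((w - e b) / a b) ((w - e b) * a b)) with hΨ
  have apos : ∀ b, 0 < a b := fun b => by linarith [a1 b]
  have divle : ∀ b r, 0 ≤ r → r / a b ≤ r := fun b r hr => div_le_self hr (a1 b)
  have divge : ∀ b r, r ≤ 0 → r ≤ r / a b := fun b r hr => by
    have := divle b (-r) (by linarith); rw [neg_div] at this; linarith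
  have mulge : ∀ b r, 0 ≤ r → r ≤ a b * r := fun b r hr => by nlinarith [a1 b]
  have mulle : ∀ b r, r ≤ 0 → a b * r ≤ r := fun b r hr => by nlinarith [a1 b]
  have inv1 : ∀ b r, Ψ b (Φ b r) = r := by
    intro b r
    have key : ∀ w, max ((w - e b) / a b) ((w - e b) * a b) = if w ≤ e b then (w - e b)/a b else (w - e b) * a b := by
      intro w
      split_ifs with h
      · exact max_eq_left (by rw [mul_comm]; exact (mulle b _ (by linarith)).trans (divge b _ (by linarith)))
      · exact max_eq_right (by rw [mul_comm]; exact (divle b _ (by linarith)).trans (mulge b _ (by linarith)))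
    have hA := a1 b
    have hE := e0 b
    have hp := apos b
    simp only [hΨ, key]
    rcases le_total 0 r with h | h
    · have h1 : min (e b + a b * r) (e b + r / a b) = e b + r / a b :=
        min_eq_right (by linarith [divle b r h, mulge b r h])
      simp only [hΦ, h1]
      rcases le_total r (e b + r / a b) with h2 | h2
      · rw [max_eq_right h2]
        have h3 : 0 ≤ r / a b := div_nonneg h hp.le
        split_ifs with h4
        · have : r / a b = 0 := by linarith
          have h5 : r = 0 := by rcases div_eq_zero_iff.1 this with h | h <;> linarith
          subst h5; simp [hE]
        · rw [add_sub_cancel_left, div_mul_cancel₀ _ hp.ne', min_eq_right h2]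
      · rw [max_eq_left h2]
        apply min_eq_left
        have h6 : r ≤ (r - e b) * a b := by
          have : r / a b ≤ r - e b := by linarith
          rwa [div_le_iff₀ hp] at this
        split_ifs with h4
        · have : r / a b ≤ 0 := by linarith
          have h7 : r ≤ 0 := by rw [div_le_iff₀ hp] at this; linarith
          have : r = 0 := le_antisymm h7 h
          subst this
          have : e b = 0 := by simp at h2; linarith
          simp [this]
        · exact h6
    · have h1 : min (e b + a b * r) (e b + r / a b) = e b + a b * r :=
        min_eq_left (by linarith [divge b r h, mulle b r h])
      simp only [hΦ, h1]
      rcases le_total r (e b + a b * r) with h2 | h2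
      · rw [max_eq_right h2, if_pos (by nlinarith), add_sub_cancel_left,
          mul_div_cancel_left₀ _ hp.ne', min_eq_right h2]
      · rw [max_eq_left h2, if_pos (by linarith)]
        apply min_eq_left
        rw [le_div_iff₀ hp]; linarith
  have inv2 : ∀ b r, Φ b (Ψ b r) = r := by
    intro b
    have mono : StrictMono (Ψ b) := by
      intro x y hxy
      have hp := apos b
      have h1 : (x - e b) / a b < (y - e b) / a b := by gcongr
      have h2 : (x - e b) * a b < (y - e b) * a b := by gcongr
      simp only [hΨ]
      exact min_lt_min hxy (max_lt_max h1 h2)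
    exact fun r => mono.injective (by rw [inv1])
  have bd1 : ∀ b r, |Φ b r - r| ≤ e b := by
    intro b r
    rw [abs_of_nonneg (sub_nonneg.2 (le_max_left _ _)), sub_le_iff_le_add]
    refine max_le (by linarith [e0 b]) ?_
    rcases le_total 0 r with h | h
    · exact (min_le_right _ _).trans (by linarith [divle b r h])
    · exact (min_le_left _ _).trans (by linarith [mulle b r h])
  have bd2 : ∀ b r, |Ψ b r - r| ≤ e b := by
    intro b r
    have := bd1 b (Ψ b r)
    rw [inv2, abs_sub_comm] at this
    exact this
  have cΦ : Continuous fun q : ℝ × B => Φ q.2 q.1 := by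
    refine cont_aux _ (fun q => q.1) (fun q => e q.2) (by fun_prop) (by fun_prop)
      (fun q => bd1 _ _) (fun q => ?_)
    by_cases hb : ρ q.2 + d q.2 = 0
    · exact .inl (ez _ hb)
    · right
      have h1 : ContinuousAt (fun q : ℝ × B => a q.2) q :=
        ContinuousAt.comp (f := Prod.snd) (ac _ hb) continuousAt_snd
      have h2 : ContinuousAt (fun q : ℝ × B => e q.2) q := (ec.comp continuous_snd).continuousAt
      exact continuousAt_fst.max ((h2.add (h1.mul continuousAt_fst)).min
        (h2.add (continuousAt_fst.div h1 (apos _).ne')))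
  have cΨ : Continuous fun q : ℝ × B => Ψ q.2 q.1 := by
    refine cont_aux _ (fun q => q.1) (fun q => e q.2) (by fun_prop) (by fun_prop)
      (fun q => bd2 _ _) (fun q => ?_)
    by_cases hb : ρ q.2 + d q.2 = 0
    · exact .inl (ez _ hb)
    · right
      have h1 : ContinuousAt (fun q : ℝ × B => a q.2) q :=
        ContinuousAt.comp (f := Prod.snd) (ac _ hb) continuousAt_snd
      have h2 : ContinuousAt (fun q : ℝ × B => e q.2) q := (ec.comp continuous_snd).continuousAt
      exact continuousAt_fst.min (((continuousAt_fst.sub h2).div h1 (apos _).ne').max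
        ((continuousAt_fst.sub h2).mul h1))
  have hfs : Continuous fun q : ℝ × B => f0 q.2 := by fun_prop
  have hsh : Continuous fun q : ℝ × B => ((q.1 - f0 q.2, q.2) : ℝ × B) := by fun_prop
  refine ⟨{ toFun := fun q => (f0 q.2 + Φ q.2 (q.1 - f0 q.2), q.2)
            invFun := fun q => (f0 q.2 + Ψ q.2 (q.1 - f0 q.2), q.2)
            left_inv := fun q => by ext <;> simp [inv1]
            right_inv := fun q => by ext <;> simp [inv2]
            continuous_toFun := (hfs.add (cΦ.comp hsh)).prodMk continuous_snd
            continuous_invFun := (hfs.add (cΨ.comp hsh)).prodMk continuous_snd }, ?_, ?_⟩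
  · rintro ⟨u, b⟩ hk
    obtain ⟨r, rfl⟩ : ∃ r, u = f0 b + r := ⟨u - f0 b, by ring⟩
    suffices Φ b r = r by simp [this]
    by_contra hne
    have hp := apos b
    have key : ∀ v ∈ Icc (0:ℝ) 1, ρ b ≤ |v * g b - r| := by
      intro v hv
      refine (ρle b v hv).trans ((Dle _ _ hk).trans (le_of_eq ?_))
      rw [Prod.dist_eq, dist_self, max_eq_left dist_nonneg, Real.dist_eq]
      congr 1; ring
    have hlt : r < min (e b + a b * r) (e b + r / a b) := by
      by_contra h
      exact hne (max_eq_left (not_lt.1 h))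
    have l1 : r < e b + a b * r := hlt.trans_le (min_le_left _ _)
    have l2 : r < e b + r / a b := hlt.trans_le (min_le_right _ _)
    rw [ea] at l1 l2
    have ha1 : 0 < a b - 1 := by
      rcases (a1 b).eq_or_lt with h | h
      · rw [← h] at l1; simp at l1
      · linarith
    have m1 : -ρ b < r := by nlinarith
    have m2 : r < ρ b * a b := by
      have : r * (a b - 1) < ρ b * a b * (a b - 1) := by
        have := mul_lt_mul_of_pos_right l2 hp
        rw [add_mul, div_mul_cancel₀ _ hp.ne'] at this
        nlinarith
      exact lt_of_mul_lt_mul_right this ha1.le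
    have m3 : r < ρ b + e b := by rw [ea]; linarith
    rcases le_or_gt r 0 with h | h
    · have := key 0 (by simp)
      rw [zero_mul, zero_sub, abs_neg, abs_of_nonpos h] at this
      linarith
    rcases le_or_gt r (e b) with h' | h'
    · have hgp : 0 < g b := by linarith [eg b]
      have := key (r / g b) ⟨by positivity, by rw [div_le_one hgp]; linarith [eg b]⟩
      rw [div_mul_cancel₀ _ hgp.ne', sub_self, abs_zero] at this
      have h5 := ea b
      rw [le_antisymm this (ρ0 b), zero_mul] at h5
      linarith
    · rcases (hg0 b).eq_or_lt with hgz | hgp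
      · have := key 0 (by simp)
        rw [zero_mul, zero_sub, abs_neg, abs_of_pos h] at this
        linarith [eg b]
      have := key (e b / g b) ⟨div_nonneg (e0 b) hgp.le, by rw [div_le_one hgp]; exact eg b⟩
      rw [div_mul_cancel₀ _ hgp.ne', abs_of_neg (by linarith)] at this
      linarith
  · intro b hb
    have : Φ b 0 = g b := by
      have : Φ b 0 = e b := by simp [hΦ, e0 b]
      rw [this]
      simp only [he, hdZ b hb, add_zero]
      by_cases h : ρ b = 0
      · rw [ρz b hb h, zero_mul]
      · rw [div_self h, mul_one]
    simp [this]

lemma Fstar {B : Type*} [MetricSpace B] (f0 f1 : B → ℝ) (hf0 : Continuous f0)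
    (hf1 : Continuous f1) (K : Set (ℝ × B)) (hKc : IsClosed K) (Z : Set B) (hZc : IsClosed Z)
    (hK : ∀ b ∈ Z, ∀ u ∈ uIcc (f0 b) (f1 b), (u, b) ∈ K → f0 b = f1 b) :
    ∃ h : (ℝ × B) ≃ₜ (ℝ × B), (∀ k ∈ K, h k = k) ∧ ∀ b ∈ Z, h (f0 b, b) = (f1 b, b) := by
  have hm : Continuous fun b => min (f0 b) (f1 b) := hf0.min hf1
  have mem : ∀ x y v : ℝ, x ≤ y → v ∈ Icc (0:ℝ) 1 → x + v * (y - x) ∈ Icc x y := by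
    intro x y v h hv
    constructor
    · nlinarith [hv.1]
    · nlinarith [hv.2]
  obtain ⟨h1, a1, b1⟩ := Fplus (fun b => min (f0 b) (f1 b)) (fun b => f0 b - min (f0 b) (f1 b))
    hm (hf0.sub hm) (fun b => sub_nonneg.2 (min_le_left _ _)) K hKc Z hZc (by
      intro b hb v hv hk
      rw [← hK b hb _ ?_ hk]; · simp
      have := mem _ _ v (min_le_left (f0 b) (f1 b)) hv
      exact ⟨this.1, this.2.trans (le_max_left _ _)⟩)
  obtain ⟨h2, a2, b2⟩ := Fplus (fun b => min (f0 b) (f1 b)) (fun b => f1 b - min (f0 b) (f1 b))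
    hm (hf1.sub hm) (fun b => sub_nonneg.2 (min_le_right _ _)) K hKc Z hZc (by
      intro b hb v hv hk
      rw [hK b hb _ ?_ hk]; · simp
      have := mem _ _ v (min_le_right (f0 b) (f1 b)) hv
      exact ⟨this.1, this.2.trans (le_max_right _ _)⟩)
  simp only [add_sub_cancel] at b1 b2
  refine ⟨h1.symm.trans h2, fun k hk => ?_, fun b hb => ?_⟩
  · rw [Homeomorph.trans_apply, h1.symm_apply_eq.2 (a1 k hk).symm, a2 k hk]
  · rw [Homeomorph.trans_apply, h1.symm_apply_eq.2 (b1 b hb).symm, b2 b hb]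

lemma graph_ext {B : Type*} [MetricSpace B] (X : Set (ℝ × B)) (hX : IsCompact X)
    (hi : InjOn Prod.snd X) : ∃ f : B → ℝ, Continuous f ∧ ∀ q ∈ X, f q.2 = q.1 := by
  haveI : CompactSpace X := isCompact_iff_compactSpace.1 hX
  have he : IsClosedEmbedding (fun q : X => q.1.2) :=
    Continuous.isClosedEmbedding (by fun_prop) (fun q q' h => Subtype.ext (hi q.2 q'.2 h))
  obtain ⟨g, hg⟩ := ContinuousMap.exists_extension he
    (⟨fun q : X => q.1.1, by fun_prop⟩ : C(X, ℝ))
  exact ⟨g, g.continuous, fun q hq => congrArg (fun f => f ⟨q, hq⟩) hg⟩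

lemma Glem {E : Type*} [NormedAddCommGroup E] [NormedSpace ℝ E] (e : E) (he : e ≠ 0)
    (X0 X1 K : Set E) (h0 : IsCompact X0) (h1 : IsCompact X1) (hKc : IsClosed K)
    (i0 : ∀ x ∈ X0, ∀ c : ℝ, x + c • e ∈ X0 → c = 0)
    (i1 : ∀ x ∈ X1, ∀ c : ℝ, x + c • e ∈ X1 → c = 0)
    (hm : ∀ x ∈ X0, ∃ c : ℝ, x + c • e ∈ X1)
    (hK : ∀ x ∈ X0, ∀ c : ℝ, x + c • e ∈ X1 → ∀ u ∈ Icc (0 : ℝ) 1, x + (u * c) • e ∈ K → c = 0) :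
    ∃ h : E ≃ₜ E, (∀ k ∈ K, h k = k) ∧ ∀ x ∈ X0, ∀ c : ℝ, x + c • e ∈ X1 → h x = x + c • e := by
  obtain ⟨l, hl⟩ : ∃ l : StrongDual ℝ E, l e = 1 := SeparatingDual.exists_eq_one he
  let B := LinearMap.ker (l : E →ₗ[ℝ] ℝ)
  let τ : E ≃ₜ ℝ × B :=
    { toFun := fun z => (l z, ⟨z - l z • e, by simp [B, hl]⟩)
      invFun := fun q => q.1 • e + q.2
      left_inv := fun z => by simp
      right_inv := fun q => by
        have : l (q.2 : E) = 0 := q.2.2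
        ext <;> simp [hl, this]
      continuous_toFun := by fun_prop
      continuous_invFun := by fun_prop }
  have τ1 : ∀ z, (τ z).1 = l z := fun z => rfl
  have τ2 : ∀ z w, (τ z).2 = (τ w).2 → w = z + (l w - l z) • e := fun z w h => by
    have := congrArg Subtype.val h
    simp only [τ, Homeomorph.homeomorph_mk_coe, Equiv.coe_fn_mk] at this
    rw [sub_smul, ← add_sub_assoc, eq_sub_iff_add_eq, ← sub_eq_sub_iff_add_eq_add]
    rw [this]
  have τ3 : ∀ z (c : ℝ), τ (z + c • e) = ((τ z).1 + c, (τ z).2) := fun z c => by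
    ext
    · simp [τ, hl]
    · simp [τ, hl, add_smul]
  obtain ⟨f0, c0, g0⟩ := graph_ext (τ '' X0) (h0.image τ.continuous) (by
    rintro _ ⟨z, hz, rfl⟩ _ ⟨w, hw, rfl⟩ h
    have := τ2 _ _ h
    have h3 := i0 z hz (l w - l z) (this ▸ hw)
    rw [h3, zero_smul, add_zero] at this
    rw [this])
  obtain ⟨f1, c1, g1⟩ := graph_ext (τ '' X1) (h1.image τ.continuous) (by
    rintro _ ⟨z, hz, rfl⟩ _ ⟨w, hw, rfl⟩ h
    have := τ2 _ _ h
    have h3 := i1 z hz (l w - l z) (this ▸ hw)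
    rw [h3, zero_smul, add_zero] at this
    rw [this])
  obtain ⟨h, a, b⟩ := Fstar f0 f1 c0 c1 (τ '' K) (τ.isClosedMap _ hKc)
    ((fun q => q.2) '' (τ '' X0)) ((h0.image τ.continuous).image continuous_snd).isClosed (by
      rintro _ ⟨_, ⟨x, hx, rfl⟩, rfl⟩ u hu ⟨k, hk, hk'⟩
      obtain ⟨c, hc⟩ := hm x hx
      have e0 := g0 _ ⟨x, hx, rfl⟩
      have e1 := g1 _ ⟨_, hc, rfl⟩
      rw [τ3] at e1
      dsimp only at e1 hu hk'
      rw [e0, e1] at hu ⊢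
      obtain ⟨w, hw, rfl⟩ : ∃ w ∈ Icc (0:ℝ) 1, u = (τ x).1 + w * c := by
        rw [← segment_eq_uIcc, segment_eq_image'] at hu
        obtain ⟨w, hw, rfl⟩ := hu
        exact ⟨w, hw, by simp⟩
      have : k = x + (w * c) • e := τ.injective (by rw [hk', τ3])
      rw [hK x hx c hc w hw (this ▸ hk), add_zero])
  refine ⟨(τ.trans h).trans τ.symm, fun k hk => ?_, fun x hx c hc => ?_⟩
  · simp [a (τ k) ⟨k, hk, rfl⟩]
  · have e0 := g0 _ ⟨x, hx, rfl⟩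
    have e1 := g1 _ ⟨_, hc, rfl⟩
    rw [τ3] at e1
    dsimp only at e1
    have := b _ ⟨_, ⟨x, hx, rfl⟩, rfl⟩
    dsimp only at this
    rw [e0, e1] at this
    simp only [Homeomorph.trans_apply]
    rw [τ.symm_apply_eq, τ3]
    exact this

def TopEq {ι : Type*} (X Y : ι → Set R3) : Prop := ∃ h : R3 ≃ₜ R3, ∀ i, h '' X i = Y i

lemma TopEq.refl {ι : Type*} (X : ι → Set R3) : TopEq X X :=
  ⟨Homeomorph.refl _, fun i => by simp⟩

lemma TopEq.symm {ι : Type*} {X Y : ι → Set R3} (h : TopEq X Y) : TopEq Y X := by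
  obtain ⟨h, hh⟩ := h
  exact ⟨h.symm, fun i => by rw [← hh i, ← image_comp]; simp⟩

lemma TopEq.trans {ι : Type*} {X Y Z : ι → Set R3} (h : TopEq X Y) (h' : TopEq Y Z) :
    TopEq X Z := by
  obtain ⟨h, hh⟩ := h
  obtain ⟨g, hg⟩ := h'
  exact ⟨h.trans g, fun i => by rw [← hg i, ← hh i, ← image_comp]; rfl⟩

def fan (p : R3) (J : Finset R3) : Set R3 := ⋃ j ∈ J, segment ℝ p j

lemma fan_compact (p : R3) (J : Finset R3) : IsCompact (fan p J) := by
  refine J.isCompact_biUnion fun j _ => ?_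
  rw [segment_eq_image']
  exact isCompact_Icc.image (by fun_prop)

lemma mem_fan {p : R3} {J : Finset R3} {x : R3} :
    x ∈ fan p J ↔ ∃ j ∈ J, ∃ s ∈ Icc (0:ℝ) 1, x = p + s • (j - p) := by
  simp only [fan, mem_iUnion, segment_eq_image', mem_image, exists_prop, eq_comm]

theorem VM {ι : Type*} [Finite ι] (L : ι → Set R3) (J : ι → Finset R3) (p p' : R3)
    (hL : ∀ i, IsClosed (L i))
    (nd : ∀ i, ∀ j ∈ J i, ∀ i', ∀ j' ∈ J i', ∀ s ∈ Icc (0:ℝ) 1, ∀ s' ∈ Icc (0:ℝ) 1, ∀ c : ℝ,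
      s • (j - p) - s' • (j' - p) = c • (p' - p) → c = 0 ∧ s = s')
    (av : ∀ i i', ∀ j ∈ J i', ∀ s, 0 ≤ s → s < 1 → ∀ u ∈ Icc (0:ℝ) 1,
      p + s • (j - p) + (u * (1 - s)) • (p' - p) ∉ L i) :
    TopEq (fun i => L i ∪ fan p (J i)) (fun i => L i ∪ fan p' (J i)) := by
  by_cases hp : p' = p
  · subst hp; exact TopEq.refl _
  have n1 : ∀ i, ∀ j ∈ J i, ∀ i', ∀ j' ∈ J i', ∀ s ∈ Icc (0:ℝ) 1, ∀ s' ∈ Icc (0:ℝ) 1, ∀ c : ℝ,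
      p' + s • (j - p') + c • (p' - p) = p' + s' • (j' - p') → c = 0 := by
    intro i j hj i' j' hj' s hs s' hs' c h
    have := nd i j hj i' j' hj' s hs s' hs' (s - s' - c) (by
      have e : p' = p + (p' - p) := by abel
      generalize p' - p = q at *
      subst e
      linear_combination (norm := module) h)
    linarith [this.1, this.2]
  have n2 : ∀ (j : R3) (s : ℝ), p' + s • (j - p') = p + s • (j - p) + (1 - s) • (p' - p) := by
    intro j s; module
  obtain ⟨h, a, b⟩ := Glem (p' - p) (sub_ne_zero.2 hp) (⋃ i, fan p (J i)) (⋃ i, fan p' (J i))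
    (⋃ i, L i) (isCompact_iUnion fun i => fan_compact _ _)
    (isCompact_iUnion fun i => fan_compact _ _) (isClosed_iUnion_of_finite hL)
    (by
      intro x hx c hc
      simp only [mem_iUnion, mem_fan] at hx hc
      obtain ⟨i, j, hj, s, hs, rfl⟩ := hx
      obtain ⟨i', j', hj', s', hs', h⟩ := hc
      have := nd i j hj i' j' hj' s hs s' hs' (-c) (by linear_combination (norm := module) h)
      linarith [this.1])
    (by
      intro x hx c hc
      simp only [mem_iUnion, mem_fan] at hx hc
      obtain ⟨i, j, hj, s, hs, rfl⟩ := hx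
      obtain ⟨i', j', hj', s', hs', h⟩ := hc
      exact n1 i j hj i' j' hj' s hs s' hs' c h)
    (by
      intro x hx
      simp only [mem_iUnion, mem_fan] at hx ⊢
      obtain ⟨i, j, hj, s, hs, rfl⟩ := hx
      exact ⟨1 - s, i, j, hj, s, hs, (n2 j s).symm⟩)
    (by
      intro x hx c hc u hu hk
      simp only [mem_iUnion, mem_fan] at hx hc hk
      obtain ⟨i, j, hj, s, hs, rfl⟩ := hx
      obtain ⟨i', j', hj', s', hs', h⟩ := hc
      obtain ⟨i'', hk⟩ := hk
      have hc : c - (1 - s) = 0 := n1 i j hj i' j' hj' s hs s' hs' _ (by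
        rw [n2, ← h]; module)
      have hc : c = 1 - s := by linarith
      subst hc
      rcases hs.2.eq_or_lt with h1 | h1
      · linarith
      · exact absurd hk (av i'' i j hj s hs.1 h1 u hu))
  refine ⟨h, fun i => ?_⟩
  have h1 : h '' L i = L i := by
    rw [← image_id (L i), ← image_comp]
    exact image_congr fun x hx => a x (mem_iUnion.2 ⟨i, hx⟩)
  have h2 : ∀ j ∈ J i, ∀ s ∈ Icc (0:ℝ) 1, h (p + s • (j - p)) = p' + s • (j - p') := by
    intro j hj s hs
    rw [n2]
    refine b _ ?_ _ ?_
    · exact mem_iUnion.2 ⟨i, mem_fan.2 ⟨j, hj, s, hs, rfl⟩⟩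
    · exact mem_iUnion.2 ⟨i, mem_fan.2 ⟨j, hj, s, hs, (n2 j s).symm⟩⟩
  rw [image_union, h1]
  congr 1
  ext x
  constructor
  · rintro ⟨y, hy, rfl⟩
    obtain ⟨j, hj, s, hs, rfl⟩ := mem_fan.1 hy
    exact mem_fan.2 ⟨j, hj, s, hs, h2 j hj s hs⟩
  · intro hx
    obtain ⟨j, hj, s, hs, rfl⟩ := mem_fan.1 hx
    exact ⟨_, mem_fan.2 ⟨j, hj, s, hs, rfl⟩, h2 j hj s hs⟩

def ap (x : ℝ) : R3 := (x, 0, 1)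
def ft (y : ℝ) : R3 := (0, y, 0)
def sp (X : Finset Pt) : Set R3 := ⋃ q ∈ X, segment ℝ (ap q.1) (ft q.2)
def ffan (p : R3) (Y : Finset ℝ) : Set R3 := fan p (Y.image ft)
def rowsAt (X : Finset Pt) (x : ℝ) : Finset ℝ := (X.filter (fun q => q.1 = x)).image Prod.snd
def offCol (X : Finset Pt) (x : ℝ) : Finset Pt := X.filter (fun q => q.1 ≠ x)

lemma mem_seg {p q z : R3} : z ∈ segment ℝ p q ↔ ∃ s ∈ Icc (0:ℝ) 1,
    z = (s * p.1 + (1 - s) * q.1, s * p.2.1 + (1 - s) * q.2.1, s * p.2.2 + (1 - s) * q.2.2) := by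
  rw [segment_symm, segment_eq_image]
  constructor
  · rintro ⟨s, hs, rfl⟩
    exact ⟨s, hs, by ext <;> simp <;> ring⟩
  · rintro ⟨s, hs, rfl⟩
    exact ⟨s, hs, by ext <;> simp <;> ring⟩

lemma mem_sp {X : Finset Pt} {z : R3} : z ∈ sp X ↔
    ∃ q ∈ X, ∃ s ∈ Icc (0:ℝ) 1, z = (s * q.1, (1 - s) * q.2, s) := by
  simp [sp, mem_seg, ap, ft]

lemma mem_ffan {p : R3} {Y : Finset ℝ} {z : R3} : z ∈ ffan p Y ↔
    ∃ j ∈ Y, ∃ s ∈ Icc (0:ℝ) 1, z = (s * p.1, s * p.2.1 + (1 - s) * j, s * p.2.2) := by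
  simp [ffan, fan, mem_seg, ft]

lemma seg_closed (p q : R3) : IsClosed (segment ℝ p q) := by
  rw [segment_eq_image']
  exact (isCompact_Icc.image (by fun_prop)).isClosed

lemma sp_closed (X : Finset Pt) : IsClosed (sp X) :=
  isClosed_biUnion_finset fun _ _ => seg_closed _ _

lemma ffan_closed (p : R3) (Y : Finset ℝ) : IsClosed (ffan p Y) := (fan_compact _ _).isClosed

lemma sp_split (X : Finset Pt) (x : ℝ) : sp X = sp (offCol X x) ∪ ffan (ap x) (rowsAt X x) := by
  ext z
  simp only [mem_union, mem_sp, mem_ffan, offCol, rowsAt, ap, Finset.mem_filter, Finset.mem_image]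
  constructor
  · rintro ⟨q, hq, s, hs, rfl⟩
    by_cases h : q.1 = x
    · exact .inr ⟨q.2, ⟨q, ⟨hq, h⟩, rfl⟩, s, hs, by simp [h]⟩
    · exact .inl ⟨q, ⟨hq, h⟩, s, hs, rfl⟩
  · rintro (⟨q, ⟨hq, -⟩, s, hs, rfl⟩ | ⟨_, ⟨q, ⟨hq, rfl⟩, rfl⟩, s, hs, rfl⟩)
    · exact ⟨q, hq, s, hs, rfl⟩
    · exact ⟨q, hq, s, hs, by simp⟩

lemma mem_rowsAt {X : Finset Pt} {x y : ℝ} : y ∈ rowsAt X x ↔ (x, y) ∈ X := by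
  simp only [rowsAt, Finset.mem_image, Finset.mem_filter]
  constructor
  · rintro ⟨q, ⟨hq, rfl⟩, rfl⟩; exact hq
  · exact fun h => ⟨_, ⟨h, rfl⟩, rfl⟩

lemma mem_vimg {X : Finset Pt} {x0 v : ℝ} {q : Pt} : q ∈ X.image (vmap x0 v) ↔
    (q ∈ X ∧ q.1 ≠ x0) ∨ (q.1 = v ∧ (x0, q.2) ∈ X) := by
  simp only [Finset.mem_image, vmap]
  constructor
  · rintro ⟨r, hr, rfl⟩
    split_ifs with h
    · exact .inr ⟨rfl, by rw [← h]; exact hr⟩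
    · exact .inl ⟨hr, h⟩
  · rintro (⟨h, h'⟩ | ⟨h, h'⟩)
    · exact ⟨q, h, if_neg h'⟩
    · exact ⟨_, h', by rw [if_pos rfl, ← h]⟩

lemma sp_vimg (X : Finset Pt) (x0 v : ℝ) :
    sp (X.image (vmap x0 v)) = sp (offCol X x0) ∪ ffan (ap v) (rowsAt X x0) := by
  ext z
  simp only [mem_union, mem_sp, mem_ffan, mem_vimg, offCol, mem_rowsAt, ap, Finset.mem_filter]
  constructor
  · rintro ⟨q, (⟨hq, h⟩ | ⟨h, hq⟩), s, hs, rfl⟩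
    · exact .inl ⟨q, ⟨hq, h⟩, s, hs, rfl⟩
    · exact .inr ⟨q.2, hq, s, hs, by simp [h]⟩
  · rintro (⟨q, ⟨hq, h⟩, s, hs, rfl⟩ | ⟨y, hy, s, hs, rfl⟩)
    · exact ⟨q, .inl ⟨hq, h⟩, s, hs, rfl⟩
    · exact ⟨(v, y), .inr ⟨rfl, hy⟩, s, hs, by simp⟩

theorem SL {ι : Type*} [Finite ι] (L : ι → Set R3) (Y : ι → Finset ℝ) (p p' : R3)
    (hL : ∀ i, IsClosed (L i)) (det : p.1 * p'.2.2 ≠ p'.1 * p.2.2)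
    (av : ∀ i i', ∀ j ∈ Y i', ∀ s, 0 < s → s ≤ 1 → ∀ u ∈ Icc (0:ℝ) 1,
      (s * (p.1 + u * (p'.1 - p.1)), s * (p.2.1 + u * (p'.2.1 - p.2.1)) + (1 - s) * j,
        s * (p.2.2 + u * (p'.2.2 - p.2.2))) ∉ L i) :
    TopEq (fun i => L i ∪ ffan p (Y i)) (fun i => L i ∪ ffan p' (Y i)) := by
  refine VM L (fun i => (Y i).image ft) p p' hL ?_ ?_
  · intro i j hj i' j' hj' s hs s' hs' c h
    simp only [Finset.mem_image, ft] at hj hj'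
    obtain ⟨y, -, rfl⟩ := hj
    obtain ⟨y', -, rfl⟩ := hj'
    obtain ⟨a, b, d⟩ := p
    obtain ⟨a', b', d'⟩ := p'
    simp only [Prod.mk_sub_mk, Prod.smul_mk, Prod.mk.injEq, smul_eq_mul] at h
    obtain ⟨h1, -, h3⟩ := h
    dsimp only at det
    have k : (s' - s) * a = c * (a' - a) := by linarith
    have k' : (s' - s) * d = c * (d' - d) := by linarith
    have h4 : c * (a' * d - a * d') = 0 := by linear_combination (-d) * k + a * k'
    have hc : c = 0 := (mul_eq_zero.1 h4).resolve_right fun h => det (by linarith)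
    subst hc
    refine ⟨rfl, ?_⟩
    by_contra hne
    have hne : s' - s ≠ 0 := fun h => hne (by linarith)
    have ha : a = 0 := by simpa [hne] using k
    have hd : d = 0 := by simpa [hne] using k'
    exact det (by simp [ha, hd])
  · intro i i' j hj s hs0 hs1 u hu
    simp only [Finset.mem_image] at hj
    obtain ⟨y, hy, rfl⟩ := hj
    have := av i i' y hy (1 - s) (by linarith) (by linarith) u hu
    convert this using 2
    ext <;> simp [ft] <;> ring

def RW {ι : Type*} (X : ι → Finset Pt) (x : ℝ) : Set ℝ := {y | ∃ i, (x, y) ∈ X i}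

def NI (A B : Set ℝ) : Prop := (∀ a ∈ A, ∀ b ∈ B, a ≠ b) ∧
  ∀ a ∈ A, ∀ a' ∈ A, ∀ b ∈ B, ∀ b' ∈ B, ¬ (a < b ∧ b < a' ∧ a' < b') ∧ ¬ (b < a ∧ a < b' ∧ b' < a')

def Hfree (A B : Set ℝ) : Prop := ∀ a ∈ A, ∀ a' ∈ A, ∀ b ∈ B, ¬ (a ≤ b ∧ b ≤ a')

lemma NI.hfree {A B : Set ℝ} (h : NI A B) : Hfree A B ∨ Hfree B A := by
  by_contra hc
  rw [not_or] at hc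
  obtain ⟨h1, h2⟩ := hc
  simp only [Hfree, not_forall, not_not] at h1 h2
  obtain ⟨b1, hb1, b2, hb2, c, hc, h3, h4⟩ := h2
  obtain ⟨a, ha, a', ha', b, hb, h1, h2⟩ := h1
  have d := h.1
  have q := h.2
  have k1 : a < b := lt_of_le_of_ne h1 (d a ha b hb)
  have k2 : b < a' := lt_of_le_of_ne h2 (d a' ha' b hb).symm
  have k3 : b1 < c := lt_of_le_of_ne h3 (d c hc b1 hb1).symm
  have k4 : c < b2 := lt_of_le_of_ne h4 (d c hc b2 hb2)
  have k5 : a < b1 := by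
    by_contra h
    have : b1 < a := lt_of_le_of_ne (not_lt.1 h) (d a ha b1 hb1).symm
    exact (q a ha a' ha' b1 hb1 b hb).2 ⟨this, k1, k2⟩
  exact (q a ha c hc b1 hb1 b2 hb2).1 ⟨k5, k3, k4⟩

/-- smallness -/
lemma exists_low {ι : Type*} [Finite ι] (P Q : ι → Finset ℝ)
    (h : Hfree {y | ∃ i, y ∈ P i} {y | ∃ i, y ∈ Q i}) :
    ∃ t : ℝ, 0 < t ∧ t < 1 ∧ ∀ i, ∀ a ∈ P i, ∀ i', ∀ a' ∈ P i', ∀ i'', ∀ b ∈ Q i'',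
      ∀ r s : ℝ, 0 ≤ r → r ≤ t → 0 ≤ s → s ≤ 1 → (1 - r) * b ≠ s * a + (1 - s) * a' := by
  have hf : ∀ F : ι → Finset ℝ, ({y | ∃ i, y ∈ F i} : Set ℝ).Finite := fun F => by
    have : {y | ∃ i, y ∈ F i} = ⋃ i, (F i : Set ℝ) := by ext; simp
    rw [this]; exact finite_iUnion fun i => (F i).finite_toSet
  have hfin : (({y | ∃ i, y ∈ P i} : Set ℝ) ×ˢ ({y | ∃ i, y ∈ Q i} : Set ℝ)).Finite :=
    (hf P).prod (hf Q)
  have key : ∀ᶠ t : ℝ in 𝓝[>] 0, ∀ q ∈ (({y | ∃ i, y ∈ P i} : Set ℝ) ×ˢ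
      ({y | ∃ i, y ∈ Q i} : Set ℝ)), t * |q.2| < |q.1 - q.2| := by
    rw [Filter.eventually_all_finite hfin]
    rintro ⟨a, b⟩ ⟨ha, hb⟩
    have h1 : a ≠ b := fun e => h a ha a ha b hb ⟨e.le, e.ge⟩
    have h2 : Tendsto (fun t : ℝ => t * |b|) (𝓝[>] 0) (𝓝 (0 * |b|)) :=
      ((continuous_id.mul continuous_const).tendsto 0).mono_left nhdsWithin_le_nhds
    rw [zero_mul] at h2
    exact h2.eventually (gt_mem_nhds (abs_pos.2 (sub_ne_zero.2 h1)))
  obtain ⟨t, h3, h1, h2⟩ := (key.and (Ioo_mem_nhdsGT (zero_lt_one' ℝ))).exists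
  refine ⟨t, h1, h2, ?_⟩
  intro i a ha i' a' ha' i'' b hb r s hr hrt hs hs1 he
  have ha : a ∈ {y | ∃ i, y ∈ P i} := ⟨i, ha⟩
  have ha' : a' ∈ {y | ∃ i, y ∈ P i} := ⟨i', ha'⟩
  have hb : b ∈ {y | ∃ i, y ∈ Q i} := ⟨i'', hb⟩
  have k1 := h3 (a, b) ⟨ha, hb⟩
  have k2 := h3 (a', b) ⟨ha', hb⟩
  dsimp only at k1 k2
  have k3 : r * |b| ≤ t * |b| := by gcongr
  have k4 : -(r * |b|) ≤ r * b := by nlinarith [neg_abs_le b]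
  have k5 : r * b ≤ r * |b| := by nlinarith [le_abs_self b]
  rcases lt_or_ge b a with c1 | c1
  · have c2 : b < a' := by
      by_contra h'; exact h a' ha' a ha b hb ⟨not_lt.1 h', c1.le⟩
    rw [abs_of_pos (sub_pos.2 c1)] at k1
    rw [abs_of_pos (sub_pos.2 c2)] at k2
    obtain ⟨w, w1, w2⟩ := exists_between (lt_min k1 k2)
    have w3 := w2.trans_le (min_le_left _ _)
    have w4 := w2.trans_le (min_le_right _ _)
    nlinarith [mul_nonneg hs (sub_nonneg.2 w3.le), mul_nonneg (sub_nonneg.2 hs1) (sub_nonneg.2 w4.le)]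
  · have c2 : a' < b := by
      by_contra h'; exact h a ha a' ha' b hb ⟨c1, not_lt.1 h'⟩
    have c3 : a < b := lt_of_le_of_ne c1 fun e => h a ha a ha b hb ⟨e.le, e.ge⟩
    rw [abs_of_neg (sub_neg.2 c3)] at k1
    rw [abs_of_neg (sub_neg.2 c2)] at k2
    obtain ⟨w, w1, w2⟩ := exists_between (lt_min k1 k2)
    have w3 := w2.trans_le (min_le_left _ _)
    have w4 := w2.trans_le (min_le_right _ _)
    nlinarith [mul_nonneg hs (sub_nonneg.2 w3.le), mul_nonneg (sub_nonneg.2 hs1) (sub_nonneg.2 w4.le)]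

def Off (L : Set R3) (c c' : ℝ) : Prop :=
  ∀ z ∈ L, 0 < z.2.2 → ∀ k ∈ uIcc c c', z.1 ≠ k * z.2.2

lemma Off.union {L M : Set R3} {c c' : ℝ} (h : Off L c c') (h' : Off M c c') :
    Off (L ∪ M) c c' := fun z hz => hz.elim (h z) (h' z)

lemma Off.symm {L : Set R3} {c c' : ℝ} (h : Off L c c') : Off L c' c := by
  unfold Off; rw [uIcc_comm]; exact h

lemma off_sp {Z : Finset Pt} {c c' : ℝ} (h : ∀ q ∈ Z, q.1 ∉ uIcc c c') : Off (sp Z) c c' := by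
  intro z hz ht k hk he
  obtain ⟨q, hq, s, hs, rfl⟩ := mem_sp.1 hz
  dsimp only at ht he
  rw [mul_comm] at he
  exact h q hq (mul_right_cancel₀ ht.ne' he ▸ hk)

lemma off_ffan {x y t : ℝ} {Y : Finset ℝ} {c c' : ℝ} (h : x ∉ uIcc c c') :
    Off (ffan (x * t, y, t) Y) c c' := by
  intro z hz ht k hk he
  obtain ⟨j, hj, s, hs, rfl⟩ := mem_ffan.1 hz
  dsimp only at ht he
  have : x * (s * t) = k * (s * t) := by linarith
  exact h (mul_right_cancel₀ ht.ne' this ▸ hk)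

lemma ap_eq (x : ℝ) : ap x = (x * 1, 0, 1) := by simp [ap]

lemma conv_mem {c c' a b : ℝ} (ha : 0 ≤ a) (hb : 0 ≤ b) (h : 0 < a + b) :
    ∃ k ∈ uIcc c c', a * c + b * c' = k * (a + b) := by
  refine ⟨(a * c + b * c') / (a + b), ?_, by field_simp⟩
  rcases le_total c c' with h' | h'
  · rw [uIcc_of_le h', mem_Icc, le_div_iff₀ h, div_le_iff₀ h]
    constructor <;> nlinarith
  · rw [uIcc_of_ge h', mem_Icc, le_div_iff₀ h, div_le_iff₀ h]
    constructor <;> nlinarith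

lemma lowmove {ι : Type*} [Finite ι] (L : ι → Set R3) (Y : ι → Finset ℝ) (c y t c' y' t' : ℝ)
    (hL : ∀ i, IsClosed (L i)) (hc : c ≠ c') (ht : 0 < t) (ht' : 0 < t')
    (ho : ∀ i, Off (L i) c c') :
    TopEq (fun i => L i ∪ ffan (c * t, y, t) (Y i)) (fun i => L i ∪ ffan (c' * t', y', t') (Y i)) := by
  refine SL L Y _ _ hL ?_ ?_
  · dsimp only
    intro h
    have : (c - c') * (t * t') = 0 := by linarith
    rcases mul_eq_zero.1 this with h | h
    · exact hc (by linarith)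
    · exact (mul_pos ht ht').ne' h
  · intro i i' j hj s hs hs1 u hu hz
    have hp : 0 < t + u * (t' - t) := by
      rcases hu.1.eq_or_lt with h | h
      · rw [← h]; linarith
      · nlinarith [hu.2]
    obtain ⟨k, hk, e⟩ := conv_mem (c := c) (c' := c') (a := s * ((1 - u) * t)) (b := s * (u * t'))
      (by have := hu.2; have : 0 ≤ 1 - u := by linarith
          positivity) (by have := hu.1; positivity) (by nlinarith)
    refine ho i _ hz (by dsimp only; positivity) k hk ?_
    dsimp only
    linear_combination e

def TE {ι : Type*} (X Y : ι → Finset Pt) : Prop := TopEq (fun i => sp (X i)) (fun i => sp (Y i))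

lemma exists_rep {ι : Type*} (Y : ι → Finset ℝ) :
    ∃ y : ℝ, ∀ i, ∀ j ∈ Y i, ∃ i', y ∈ Y i' := by
  by_cases h : ∃ i, (Y i).Nonempty
  · obtain ⟨i, y, hy⟩ := h
    exact ⟨y, fun _ _ _ => ⟨i, hy⟩⟩
  · exact ⟨0, fun i j hj => absurd ⟨i, j, hj⟩ h⟩

def Bet (a b c : ℝ) : Prop := (a < b ∧ b < c) ∨ (c < b ∧ b < a)

lemma Bet.mem {a b c : ℝ} (h : Bet a b c) : b ∈ uIcc a c := by
  rcases h with h | h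
  · exact mem_uIcc.2 (.inl ⟨h.1.le, h.2.le⟩)
  · exact mem_uIcc.2 (.inr ⟨h.1.le, h.2.le⟩)

lemma RW_rowsAt {ι : Type*} (X : ι → Finset Pt) (x : ℝ) :
    RW X x = {y | ∃ i, y ∈ rowsAt (X i) x} := by
  ext y; simp [RW, mem_rowsAt]

theorem TV {ι : Type*} [Finite ι] (X : ι → Finset Pt) (x0 v x2 : ℝ) (hx : Bet x0 x2 v)
    (hv : ∀ i, ∀ q ∈ X i, q.1 ∈ uIcc x0 v → q.1 = x0 ∨ q.1 = x2)
    (hN : NI (RW X x0) (RW X x2)) : TE X (fun i => (X i).image (vmap x0 v)) := by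
  have h02 : x0 ≠ x2 := by rcases hx with h | h <;> [exact h.1.ne; exact h.2.ne']
  have h2v : x2 ≠ v := by rcases hx with h | h <;> [exact h.2.ne; exact h.1.ne']
  unfold TE
  rw [RW_rowsAt, RW_rowsAt] at hN
  have m1 : uIcc x0 ((x0 + x2) / 2) ⊆ uIcc x0 v := uIcc_subset_uIcc_left (by
    rcases hx with h | h
    · exact mem_uIcc.2 (.inl ⟨by linarith, by linarith⟩)
    · exact mem_uIcc.2 (.inr ⟨by linarith, by linarith⟩))
  have m2 : uIcc ((x2 + v) / 2) v ⊆ uIcc x0 v := uIcc_subset_uIcc_right (by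
    rcases hx with h | h
    · exact mem_uIcc.2 (.inl ⟨by linarith, by linarith⟩)
    · exact mem_uIcc.2 (.inr ⟨by linarith, by linarith⟩))
  have m3 : x2 ∉ uIcc x0 ((x0 + x2) / 2) := by
    rcases hx with h | h
    · rw [uIcc_of_le (by linarith), mem_Icc]; intro h'; linarith
    · rw [uIcc_of_ge (by linarith), mem_Icc]; intro h'; linarith
  have m4 : x2 ∉ uIcc ((x2 + v) / 2) v := by
    rcases hx with h | h
    · rw [uIcc_of_le (by linarith), mem_Icc]; intro h'; linarith
    · rw [uIcc_of_ge (by linarith), mem_Icc]; intro h'; linarith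
  have m5 : uIcc x2 ((x2 + v) / 2) ⊆ uIcc x0 v := uIcc_subset_uIcc hx.mem (m2 left_mem_uIcc)
  have m6 : x0 ∉ uIcc x2 ((x2 + v) / 2) := by
    rcases hx with h | h
    · rw [uIcc_of_le (by linarith), mem_Icc]; intro h'; linarith
    · rw [uIcc_of_ge (by linarith), mem_Icc]; intro h'; linarith
  have m7 : v ∉ uIcc x2 ((x2 + v) / 2) := by
    rcases hx with h | h
    · rw [uIcc_of_le (by linarith), mem_Icc]; intro h'; linarith
    · rw [uIcc_of_ge (by linarith), mem_Icc]; intro h'; linarith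
  simp_rw [sp_vimg]
  rcases hN.hfree with hf | hf
  · obtain ⟨t, t0, t1, ht⟩ := exists_low _ _ hf
    obtain ⟨y, hy⟩ := exists_rep fun i => rowsAt (X i) x0
    have hs0 : ∀ i, sp (X i) = _ := fun i => sp_split (X i) x0
    simp_rw [hs0, ap_eq]
    have hof : ∀ c c', uIcc c c' ⊆ uIcc x0 v → x2 ∉ uIcc c c' →
        ∀ i, Off (sp (offCol (X i) x0)) c c' := by
      refine fun c c' h1 h2 i => off_sp fun q hq hm => ?_
      rw [offCol, Finset.mem_filter] at hq
      exact h2 (((hv i q hq.1 (h1 hm)).resolve_left hq.2) ▸ hm)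
    refine (lowmove _ _ x0 0 1 ((x0 + x2) / 2) y t (fun i => sp_closed _) (fun h => h02 (by linarith))
      one_pos t0 (hof _ _ m1 m3)).trans (TopEq.trans ?_
      (lowmove _ _ ((x2 + v) / 2) y t v 0 1 (fun i => sp_closed _) (fun h => h2v (by linarith))
      t0 one_pos (hof _ _ m2 m4)))
    refine SL _ _ _ _ (fun i => sp_closed _) ?_ ?_
    · dsimp only
      intro h
      have : (x0 - v) * (t * t) = 0 := by linarith
      rcases mul_eq_zero.1 this with h | h
      · rcases hx with h' | h' <;> linarith
      · exact (mul_pos t0 t0).ne' h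
    · intro i i' j hj s hs hs1 u hu hz
      obtain ⟨q, hq, r, hr, he⟩ := mem_sp.1 hz
      rw [offCol, Finset.mem_filter] at hq
      simp only [Prod.mk.injEq, sub_self, mul_zero, add_zero] at he
      obtain ⟨e1, e2, e3⟩ := he
      subst e3
      obtain ⟨k, hk, e⟩ := conv_mem (c := (x0 + x2) / 2) (c' := (x2 + v) / 2) (a := 1 - u) (b := u)
        (by linarith [hu.2]) hu.1 (by linarith)
      have hkq : k = q.1 := by
        have : (s * t) * k = (s * t) * q.1 := by linear_combination e1 - s * t * e
        exact mul_left_cancel₀ (mul_pos hs t0).ne' this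
      have hk' := uIcc_subset_uIcc (m1 right_mem_uIcc) (m2 left_mem_uIcc) hk
      have hq2 := (hv i q hq.1 (hkq ▸ hk')).resolve_left hq.2
      obtain ⟨i2, hy2⟩ := hy i' j hj
      refine ht i2 y hy2 i' j hj i q.2 ?_ (s * t) s (by positivity) (by nlinarith) hs.le hs1 e2.symm
      rw [mem_rowsAt, ← hq2]; exact hq.1
  · obtain ⟨t, t0, t1, ht⟩ := exists_low _ _ hf
    obtain ⟨y, hy⟩ := exists_rep fun i => rowsAt (X i) x2
    have hr : ∀ i, rowsAt (offCol (X i) x0) x2 = rowsAt (X i) x2 := by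
      intro i; ext; simp [mem_rowsAt, offCol, h02.symm]
    have hs0 : ∀ i, sp (X i) = _ := fun i => sp_split (X i) x0
    have hs1 : ∀ i, sp (offCol (X i) x0) = _ := fun i => sp_split (offCol (X i) x0) x2
    simp_rw [hs0, hs1, hr]
    set L0 : ι → Set R3 := fun i => sp (offCol (offCol (X i) x0) x2) with hL0
    have hL0' : ∀ i, sp (offCol (offCol (X i) x0) x2) = L0 i := fun i => rfl
    simp_rw [hL0']
    have c0 : ∀ i, IsClosed (L0 i) := fun i => sp_closed _
    have hof : ∀ i, Off (L0 i) x0 v := by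
      refine fun i => off_sp fun q hq hm => ?_
      simp only [offCol, Finset.mem_filter] at hq
      rcases hv i q hq.1.1 hm with h | h
      · exact hq.1.2 h
      · exact hq.2 h
    have hof2 : ∀ i, Off (L0 i) x2 ((x2 + v) / 2) := fun i z hz h k hk => hof i z hz h k (m5 hk)
    have hA := lowmove (fun i => L0 i ∪ ffan (ap x0) (rowsAt (X i) x0)) (fun i => rowsAt (X i) x2)
      x2 0 1 ((x2 + v) / 2) y t (fun i => (c0 i).union (ffan_closed _ _)) (fun h => h2v (by linarith))
      one_pos t0 (fun i => (hof2 i).union (by rw [ap_eq]; exact off_ffan m6))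
    have hC := lowmove (fun i => L0 i ∪ ffan (ap v) (rowsAt (X i) x0)) (fun i => rowsAt (X i) x2)
      x2 0 1 ((x2 + v) / 2) y t (fun i => (c0 i).union (ffan_closed _ _)) (fun h => h2v (by linarith))
      one_pos t0 (fun i => (hof2 i).union (by rw [ap_eq]; exact off_ffan m7))
    have hB := SL (fun i => L0 i ∪ ffan ((x2 + v) / 2 * t, y, t) (rowsAt (X i) x2))
      (fun i => rowsAt (X i) x0) (ap x0) (ap v) (fun i => (c0 i).union (ffan_closed _ _))
      (by simp only [ap, mul_one]; rcases hx with h | h <;> intro h' <;> linarith) (by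
        intro i i' j hj s hs hs1 u hu hz
        simp only [ap, sub_self, mul_zero, add_zero, mul_one, zero_add] at hz
        rcases hz with hz | hz
        · obtain ⟨k, hk, e⟩ := conv_mem (c := x0) (c' := v) (a := 1 - u) (b := u)
            (by linarith [hu.2]) hu.1 (by linarith)
          exact hof i _ hz hs k hk (by dsimp only; linear_combination s * e)
        · obtain ⟨b, hb, r, hr, he⟩ := mem_ffan.1 hz
          simp only [Prod.mk.injEq] at he
          obtain ⟨-, e2, e3⟩ := he
          obtain ⟨i2, hy2⟩ := hy i b hb
          exact ht i2 y hy2 i b hb i' j hj s r hs.le (by nlinarith [hr.2]) hr.1 hr.2 e2)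
    rw [← ap_eq] at hA hC
    simp only [union_right_comm] at hA hC hB ⊢
    exact hA.trans (hB.trans hC.symm)

def cols {ι : Type*} [Fintype ι] (X : ι → Finset Pt) : Finset ℝ :=
  Finset.univ.biUnion fun i => (X i).image Prod.fst

lemma mem_cols {ι : Type*} [Fintype ι] {X : ι → Finset Pt} {c : ℝ} :
    c ∈ cols X ↔ ∃ i, ∃ q ∈ X i, q.1 = c := by simp [cols]

lemma exists_fresh (S : Finset ℝ) {a b : ℝ} (h : a < b) : ∃ c, a < c ∧ c < b ∧ c ∉ S := by
  obtain ⟨c, hc, hc'⟩ := (Ioo_infinite h).exists_notMem_finset S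
  exact ⟨c, hc.1, hc.2, hc'⟩

lemma Bet.symm {a b c : ℝ} (h : Bet a b c) : Bet c b a := h.elim .inr .inl

def VM1 {ι : Type*} (x0 v : ℝ) (X : ι → Finset Pt) : ι → Finset Pt :=
  fun i => (X i).image (vmap x0 v)

lemma VM1_mem {ι : Type*} {x0 v : ℝ} {X : ι → Finset Pt} {i : ι} {q : Pt} : q ∈ VM1 x0 v X i ↔
    (q ∈ X i ∧ q.1 ≠ x0) ∨ (q.1 = v ∧ (x0, q.2) ∈ X i) := mem_vimg

lemma VM1_comp {ι : Type*} {x0 v w : ℝ} {X : ι → Finset Pt} (h : ∀ i, ∀ q ∈ X i, q.1 ≠ v) :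
    VM1 v w (VM1 x0 v X) = VM1 x0 w X := by
  ext i q
  simp only [VM1_mem]
  constructor
  · rintro (⟨⟨h1, h2⟩ | ⟨h1, h2⟩, h3⟩ | ⟨h1, ⟨h2, h3⟩ | ⟨-, h3⟩⟩)
    · exact .inl ⟨h1, h2⟩
    · exact absurd h1 h3
    · exact absurd rfl (h i _ h2)
    · exact .inr ⟨h1, h3⟩
  · rintro (⟨h1, h2⟩ | ⟨h1, h2⟩)
    · exact .inl ⟨.inl ⟨h1, h2⟩, h i q h1⟩
    · exact .inr ⟨h1, .inr ⟨trivial, h2⟩⟩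

lemma VM1_self {ι : Type*} {x0 : ℝ} {X : ι → Finset Pt} : VM1 x0 x0 X = X := by
  ext i q
  simp only [VM1_mem]
  constructor
  · rintro (⟨h1, h2⟩ | ⟨h1, h2⟩)
    · exact h1
    · rw [← h1] at h2; exact h2
  · intro h
    by_cases h' : q.1 = x0
    · exact .inr ⟨h', by rw [← h']; exact h⟩
    · exact .inl ⟨h, h'⟩

lemma RW_VM1_new {ι : Type*} {x0 v : ℝ} {X : ι → Finset Pt} (h : ∀ i, ∀ q ∈ X i, q.1 ≠ v) :
    RW (VM1 x0 v X) v = RW X x0 := by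
  ext y
  simp only [RW, VM1_mem, Set.mem_ofPred_eq]
  constructor
  · rintro ⟨i, ⟨h1, h2⟩ | ⟨-, h2⟩⟩
    · exact absurd rfl (h i _ h1)
    · exact ⟨i, h2⟩
  · rintro ⟨i, h1⟩
    exact ⟨i, .inr ⟨trivial, h1⟩⟩

lemma RW_VM1_old {ι : Type*} {x0 v c : ℝ} {X : ι → Finset Pt} (h : c ≠ x0) (h' : c ≠ v) :
    RW (VM1 x0 v X) c = RW X c := by
  ext y
  simp [RW, VM1_mem, h, h']

def SinglePass {ι : Type*} (E : (ι → Finset Pt) → (ι → Finset Pt) → Prop) : Prop :=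
  ∀ X x0 v x2, Bet x0 x2 v → (∀ i, ∀ q ∈ X i, q.1 ∈ uIcc x0 v → q.1 = x0 ∨ q.1 = x2) →
    NI (RW X x0) (RW X x2) → E X (VM1 x0 v X)

theorem MP {ι : Type*} [Fintype ι] (E : (ι → Finset Pt) → (ι → Finset Pt) → Prop)
    (tr : ∀ X Y Z, E X Y → E Y Z → E X Z) (sg : SinglePass E) :
    ∀ X x0 v, x0 ≠ v → (∀ i, ∀ q ∈ X i, q.1 ≠ v) →
      (∀ c, Bet x0 c v → NI (RW X x0) (RW X c)) → E X (VM1 x0 v X) := by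
  suffices H : ∀ n : ℕ, ∀ X x0 v, ((cols X).filter (Bet x0 · v)).card ≤ n → x0 ≠ v →
      (∀ i, ∀ q ∈ X i, q.1 ≠ v) → (∀ c, Bet x0 c v → NI (RW X x0) (RW X c)) → E X (VM1 x0 v X) from
    fun X x0 v => H _ X x0 v le_rfl
  intro n
  have inb : ∀ {x0 v c : ℝ}, c ∈ uIcc x0 v → c ≠ x0 → c ≠ v → Bet x0 c v := by
    intro x0 v c h h1 h2
    rcases mem_uIcc.1 h with h | h
    · exact .inl ⟨lt_of_le_of_ne h.1 h1.symm, lt_of_le_of_ne h.2 h2⟩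
    · exact .inr ⟨lt_of_le_of_ne h.1 h2.symm, lt_of_le_of_ne h.2 h1⟩
  induction n with
  | zero =>
    intro X x0 v hc h0 hv hn
    rw [Nat.le_zero, Finset.card_eq_zero, Finset.filter_eq_empty_iff] at hc
    have hb : Bet x0 ((x0 + v) / 2) v := by
      rcases lt_or_gt_of_ne h0 with h | h
      · exact .inl ⟨by linarith, by linarith⟩
      · exact .inr ⟨by linarith, by linarith⟩
    refine sg X x0 v _ hb (fun i q hq hm => .inl ?_) (hn _ hb)
    by_contra h
    exact hc (mem_cols.2 ⟨i, q, hq, rfl⟩) (inb hm h (hv i q hq))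
  | succ n ih =>
    intro X x0 v hc h0 hv hn
    by_cases h1 : ((cols X).filter (Bet x0 · v)).card ≤ 1
    · rcases Nat.le_one_iff_eq_zero_or_eq_one.1 h1 with h2 | h2
      · exact ih X x0 v (by omega) h0 hv hn
      · obtain ⟨x2, hx2⟩ := Finset.card_eq_one.1 h2
        have hb : Bet x0 x2 v := by
          have : x2 ∈ (cols X).filter (Bet x0 · v) := by simp [hx2]
          exact (Finset.mem_filter.1 this).2
        refine sg X x0 v _ hb (fun i q hq hm => ?_) (hn _ hb)
        by_cases h : q.1 = x0
        · exact .inl h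
        right
        have : q.1 ∈ (cols X).filter (Bet x0 · v) :=
          Finset.mem_filter.2 ⟨mem_cols.2 ⟨i, q, hq, rfl⟩, inb hm h (hv i q hq)⟩
        simpa [hx2] using this
    · obtain ⟨c1, hc1, c2, hc2, hlt⟩ : ∃ c1 ∈ (cols X).filter (Bet x0 · v),
          ∃ c2 ∈ (cols X).filter (Bet x0 · v), c1 < c2 := by
        obtain ⟨a, ha, b, hb, hab⟩ := Finset.one_lt_card.1 (not_le.1 h1)
        rcases lt_or_gt_of_ne hab with h | h
        · exact ⟨a, ha, b, hb, h⟩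
        · exact ⟨b, hb, a, ha, h⟩
      obtain ⟨w, w1, w2, w3⟩ := exists_fresh (cols X) hlt
      have b1 := (Finset.mem_filter.1 hc1).2
      have b2 := (Finset.mem_filter.1 hc2).2
      have hw : Bet x0 w v := by
        rcases b1 with b1 | b1 <;> rcases b2 with b2 | b2
        · exact .inl ⟨by linarith, by linarith⟩
        · linarith
        · linarith
        · exact .inr ⟨by linarith, by linarith⟩
      have hwf : ∀ i, ∀ q ∈ X i, q.1 ≠ w := fun i q hq h => w3 (mem_cols.2 ⟨i, q, hq, h⟩)
      have x0w : x0 ≠ w := by rcases hw with h | h <;> [exact h.1.ne; exact h.2.ne']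
      have vw : w ≠ v := by rcases hw with h | h <;> [exact h.2.ne; exact h.1.ne']
      have sub1 : ∀ c, Bet x0 c w → Bet x0 c v := by
        intro c hc
        rcases hc with h | h <;> rcases hw with h' | h'
        · exact .inl ⟨by linarith, by linarith⟩
        · linarith
        · linarith
        · exact .inr ⟨by linarith, by linarith⟩
      have sub2 : ∀ c, Bet w c v → Bet x0 c v := by
        intro c hc
        rcases hc with h | h <;> rcases hw with h' | h'
        · exact .inl ⟨by linarith, by linarith⟩
        · linarith
        · linarith
        · exact .inr ⟨by linarith, by linarith⟩
      have card1 : ((cols X).filter (Bet x0 · w)).card ≤ n := by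
        refine Nat.lt_succ_iff.1 (lt_of_lt_of_le (Finset.card_lt_card ?_) hc)
        rw [Finset.ssubset_iff_of_subset (Finset.monotone_filter_right _ fun c _ hc => sub1 c hc)]
        rcases hw with h | h
        · exact ⟨c2, hc2, fun h' => by
            rcases (Finset.mem_filter.1 h').2 with h'' | h'' <;> linarith⟩
        · exact ⟨c1, hc1, fun h' => by
            rcases (Finset.mem_filter.1 h').2 with h'' | h'' <;> linarith⟩
      have colsub : ∀ c, c ∈ cols (VM1 x0 w X) → c ≠ w → c ∈ cols X := by
        intro c hc hcw
        obtain ⟨i, q, hq, rfl⟩ := mem_cols.1 hc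
        rcases VM1_mem.1 hq with h | h
        · exact mem_cols.2 ⟨i, q, h.1, rfl⟩
        · exact absurd h.1 hcw
      have card2 : ((cols (VM1 x0 w X)).filter (Bet w · v)).card ≤ n := by
        refine Nat.lt_succ_iff.1 (lt_of_lt_of_le (Finset.card_lt_card ?_) hc)
        rw [Finset.ssubset_iff_of_subset (fun c hc => by
          rw [Finset.mem_filter] at hc ⊢
          refine ⟨colsub c hc.1 fun h => ?_, sub2 c hc.2⟩
          rcases hc.2 with h' | h' <;> linarith)]
        rcases hw with h | h
        · exact ⟨c1, hc1, fun h' => by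
            rcases (Finset.mem_filter.1 h').2 with h'' | h'' <;> linarith⟩
        · exact ⟨c2, hc2, fun h' => by
            rcases (Finset.mem_filter.1 h').2 with h'' | h'' <;> linarith⟩
      have e1 := ih X x0 w card1 x0w hwf fun c hc => hn c (sub1 c hc)
      have e2 := ih (VM1 x0 w X) w v card2 vw (fun i q hq h => by
        rcases VM1_mem.1 hq with h' | h'
        · exact hv i q h'.1 h
        · exact vw (h'.1 ▸ h)) (fun c hcb => by
        rw [RW_VM1_new hwf, RW_VM1_old]
        · exact hn c (sub2 c hcb)
        · intro e
          rw [e] at hcb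
          rcases hcb with h' | h' <;> rcases hw with h | h <;> linarith
        · intro e
          rw [e] at hcb
          rcases hcb with h' | h' <;> linarith)
      rw [VM1_comp hwf] at e2
      exact tr _ _ _ e1 e2

lemma TE.trans {ι : Type*} {X Y Z : ι → Finset Pt} (h : TE X Y) (h' : TE Y Z) : TE X Z :=
  TopEq.trans h h'
lemma TE.symm {ι : Type*} {X Y : ι → Finset Pt} (h : TE X Y) : TE Y X := TopEq.symm h

theorem TE_MP {ι : Type*} [Fintype ι] (X : ι → Finset Pt) (x0 v : ℝ) (h : x0 ≠ v)
    (hv : ∀ i, ∀ q ∈ X i, q.1 ≠ v) (hn : ∀ c, Bet x0 c v → NI (RW X x0) (RW X c)) :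
    TE X (VM1 x0 v X) :=
  MP TE (fun _ _ _ => TE.trans) (fun X x0 v x2 h1 h2 h3 => TV X x0 v x2 h1 h2 h3) X x0 v h hv hn

def trF (X : Finset Pt) : Finset Pt := X.image fun p => (p.2, p.1)

lemma mem_trF {X : Finset Pt} {q : Pt} : q ∈ trF X ↔ (q.2, q.1) ∈ X := by
  simp only [trF, Finset.mem_image]
  constructor
  · rintro ⟨p, hp, rfl⟩; exact hp
  · exact fun h => ⟨_, h, rfl⟩

lemma trF_trF (X : Finset Pt) : trF (trF X) = X := by
  ext q; simp [mem_trF]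

def trR : R3 ≃ₜ R3 where
  toFun z := (z.2.1, z.1, 1 - z.2.2)
  invFun z := (z.2.1, z.1, 1 - z.2.2)
  left_inv z := by simp
  right_inv z := by simp
  continuous_toFun := by fun_prop
  continuous_invFun := by fun_prop

lemma sp_trF (X : Finset Pt) : sp (trF X) = trR '' sp X := by
  ext z
  simp only [mem_image, mem_sp, mem_trF]
  constructor
  · rintro ⟨q, hq, s, hs, rfl⟩
    exact ⟨_, ⟨_, hq, 1 - s, ⟨by linarith [hs.2], by linarith [hs.1]⟩, rfl⟩, by simp [trR]⟩
  · rintro ⟨_, ⟨q, hq, s, hs, rfl⟩, rfl⟩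
    exact ⟨(q.2, q.1), hq, 1 - s, ⟨by linarith [hs.2], by linarith [hs.1]⟩, by simp [trR]⟩

lemma TE.tr {ι : Type*} {X Y : ι → Finset Pt} (h : TE X Y) :
    TE (fun i => trF (X i)) (fun i => trF (Y i)) := by
  obtain ⟨h, hh⟩ := h
  refine ⟨(trR.symm.trans h).trans trR, fun i => ?_⟩
  have := hh i
  dsimp only at this
  simp only [sp_trF]
  rw [← this, ← image_comp, ← image_comp]
  refine image_congr fun z _ => ?_
  simp

theorem TC {ι : Type*} [Fintype ι] (X : ι → Finset Pt) (x0 x1 : ℝ) (h : x0 < x1)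
    (hX : ∀ i, ∀ q ∈ X i, q.1 ≠ x0 → x0 < q.1 ∧ q.1 < x1) : TE X (VM1 x0 x1 X) := by
  obtain ⟨K, k1, k2, k3⟩ : ∃ K, x0 < K ∧ K < x1 ∧ ∀ i, ∀ q ∈ X i, q.1 ≠ x0 → K < q.1 := by
    have : ∀ᶠ K in 𝓝[>] x0, ∀ c ∈ cols X, c ≠ x0 → K < c := by
      rw [Filter.eventually_all_finset]
      intro c hc
      by_cases hc0 : c = x0
      · simp [hc0]
      obtain ⟨i, q, hq, rfl⟩ := mem_cols.1 hc
      filter_upwards [Ioo_mem_nhdsGT (hX i q hq hc0).1] with K hK _ using hK.2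
    obtain ⟨K, hK, h1, h2⟩ := (this.and (Ioo_mem_nhdsGT h)).exists
    exact ⟨K, h1, h2, fun i q hq => hK _ (mem_cols.2 ⟨i, q, hq, rfl⟩)⟩
  have hs0 : ∀ i, sp (X i) = _ := fun i => sp_split (X i) x0
  have hs1 : ∀ i, sp (VM1 x0 x1 X i) = _ := fun i => sp_vimg (X i) x0 x1
  unfold TE
  simp_rw [hs0, hs1]
  have hL : ∀ i, ∀ z ∈ sp (offCol (X i) x0), 0 ≤ z.2.2 ∧ (0 < z.2.2 → z.1 < x1 * z.2.2) ∧
      K * z.2.2 ≤ z.1 ∧ (z.2.2 = 0 → z.1 = 0) := by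
    intro i z hz
    obtain ⟨q, hq, s, hs, rfl⟩ := mem_sp.1 hz
    rw [offCol, Finset.mem_filter] at hq
    have a1 := k3 i q hq.1 hq.2
    have a2 := (hX i q hq.1 hq.2).2
    refine ⟨hs.1, fun h => ?_, ?_, fun h => ?_⟩ <;> dsimp only at *
    · nlinarith
    · nlinarith [hs.1]
    · simp [h]
  refine ((SL _ _ (ap x0) (x0 - 2 * K, 0, -1) (fun i => sp_closed _) ?_ ?_).trans
    (SL _ _ _ (x1 - 2 * K, 0, -1) (fun i => sp_closed _) ?_ ?_)).trans
    (SL _ _ _ (ap x1) (fun i => sp_closed _) ?_ ?_)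
  · simp only [ap]; intro h; linarith
  · intro i i' j hj s hs hs1 u hu hz
    obtain ⟨a1, a2, a3, a4⟩ := hL i _ hz
    simp only [ap] at a1 a2 a3 a4
    nlinarith
  · dsimp only; intro h; linarith
  · intro i i' j hj s hs hs1 u hu hz
    obtain ⟨a1, a2, a3, a4⟩ := hL i _ hz
    simp only [ap] at a1 a2 a3 a4
    nlinarith
  · simp only [ap]; intro h; linarith
  · intro i i' j hj s hs hs1 u hu hz
    obtain ⟨a1, a2, a3, a4⟩ := hL i _ hz
    simp only [ap] at a1 a2 a3 a4
    have hu1 := hu.2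
    have hu0 := hu.1
    rcases a1.eq_or_lt with h | h
    · have b := a4 h.symm
      have c1 : -1 + u * 2 = 0 := by
        have : s * (-1 + u * (1 - -1)) = 0 := h.symm
        rcases mul_eq_zero.1 this with h | h <;> linarith
      have : s * (x1 - 2 * K + u * (x1 - (x1 - 2 * K))) = 0 := b
      rcases mul_eq_zero.1 this with h | h
      · linarith
      · have : u = 1/2 := by linarith
        subst this; linarith
    · have b := a2 h
      have c : s * ((x1 - K) * (2 - 2 * u)) < 0 := by nlinarith
      have : 0 ≤ s * ((x1 - K) * (2 - 2 * u)) := mul_nonneg hs.le (mul_nonneg (by linarith) (by linarith))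
      linarith

def on (P : Prop) (S : Set R3) : Set R3 := {z | P ∧ z ∈ S}

lemma mem_on {P : Prop} {S : Set R3} {z : R3} : z ∈ on P S ↔ P ∧ z ∈ S := Iff.rfl

lemma on_closed {P : Prop} {S : Set R3} (h : IsClosed S) : IsClosed (on P S) := by
  by_cases hP : P <;> simp [on, hP, h]

lemma on_true {P : Prop} {S : Set R3} (h : P) : on P S = S := by ext; simp [on, h]

lemma mem_sp' {X : Finset Pt} {z : R3} : z ∈ sp X ↔
    ∃ q, q ∈ X ∧ z ∈ segment ℝ (ap q.1) (ft q.2) := by simp [sp]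

lemma TopEq.congr {ι : Type*} {X Y X' Y' : ι → Set R3} (h : TopEq X Y) (h1 : ∀ i, X' i = X i)
    (h2 : ∀ i, Y' i = Y i) : TopEq X' Y' := by
  rwa [funext h1, funext h2]

lemma seg_mid (a c : R3) : segment ℝ a c =
    segment ℝ ((1/2:ℝ) • (a + c)) a ∪ segment ℝ ((1/2:ℝ) • (a + c)) c := by
  ext z
  simp only [segment_eq_image', mem_union, mem_image]
  constructor
  · rintro ⟨s, ⟨h0, h1⟩, rfl⟩
    rcases le_total s (1/2) with h | h
    · left; exact ⟨1 - 2 * s, ⟨by linarith, by linarith⟩, by module⟩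
    · right; exact ⟨2 * s - 1, ⟨by linarith, by linarith⟩, by module⟩
  · rintro (⟨s, ⟨h0, h1⟩, rfl⟩ | ⟨s, ⟨h0, h1⟩, rfl⟩)
    · exact ⟨(1 - s) / 2, ⟨by linarith, by linarith⟩, by module⟩
    · exact ⟨(1 + s) / 2, ⟨by linarith, by linarith⟩, by module⟩

theorem Delta {ι : Type*} [Finite ι] (L : ι → Set R3) (B : ι → Prop) (a b c : R3)
    (hL : ∀ i, IsClosed (L i))
    (ind : ∀ r t : ℝ, r • (a - c) + t • (b - c) = 0 → r = 0 ∧ t = 0)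
    (av : ∀ i, ∀ r s t : ℝ, 0 ≤ r → 0 ≤ s → 0 ≤ t → r + s + t = 1 →
      r • a + s • b + t • c ∈ L i → r = 1 ∨ t = 1) :
    TopEq (fun i => L i ∪ on (B i) (segment ℝ a c))
      (fun i => L i ∪ on (B i) (segment ℝ a b ∪ segment ℝ b c)) := by
  have key := VM L (fun i => if B i then {a, c} else ∅) ((1/2:ℝ) • (a + c)) b hL ?_ ?_
  · refine key.congr (fun i => ?_) fun i => ?_
    · by_cases h : B i
      · rw [seg_mid, on_true h]
        simp [fan, h]
      · simp [on, fan, h]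
    · by_cases h : B i
      · rw [on_true h]
        simp [fan, h, segment_symm ℝ b a]
      · simp [on, fan, h]
  · intro i j hj i' j' hj' s hs s' hs' e h
    have J : ∀ i j, j ∈ (if B i then ({a, c} : Finset R3) else ∅) → j = a ∨ j = c := by
      intro i j h; by_cases hB : B i <;> simp [hB] at h; exact h
    have h0 : s • (j - (1/2:ℝ) • (a + c)) - s' • (j' - (1/2:ℝ) • (a + c)) - e • (b - (1/2:ℝ) • (a + c)) = 0 :=
      sub_eq_zero.2 h
    have hs0 := hs.1
    have hs0' := hs'.1
    rcases J i j hj with rfl | rfl <;> rcases J i' j' hj' with rfl | rfl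
    · obtain ⟨q1, q2⟩ := ind (s/2 - s'/2 + e/2) (-e) (by rw [← h0]; module)
      constructor <;> linarith
    · obtain ⟨q1, q2⟩ := ind (s/2 + s'/2 + e/2) (-e) (by rw [← h0]; module)
      constructor <;> linarith
    · obtain ⟨q1, q2⟩ := ind (- s/2 - s'/2 + e/2) (-e) (by rw [← h0]; module)
      constructor <;> linarith
    · obtain ⟨q1, q2⟩ := ind (- s/2 + s'/2 + e/2) (-e) (by rw [← h0]; module)
      constructor <;> linarith
  · intro i i' j hj s hs hs1 u hu hz
    have J : ∀ i j, j ∈ (if B i then ({a, c} : Finset R3) else ∅) → j = a ∨ j = c := by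
      intro i j h; by_cases hB : B i <;> simp [hB] at h; exact h
    have h1 : 0 ≤ (1 - s) * (1 - u) := mul_nonneg (by linarith) (by linarith [hu.2])
    have h2 : 0 ≤ u * (1 - s) := mul_nonneg hu.1 (by linarith)
    rcases J i' j hj with rfl | rfl
    · rcases av i (s + (1 - s) * (1 - u) / 2) (u * (1 - s)) ((1 - s) * (1 - u) / 2)
        (by linarith) h2 (by linarith) (by ring) (by convert hz using 1; module) with h | h <;> nlinarith [hu.1, hu.2]
    · rcases av i ((1 - s) * (1 - u) / 2) (u * (1 - s)) (s + (1 - s) * (1 - u) / 2)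
        (by linarith) h2 (by linarith) (by ring) (by convert hz using 1; module) with h | h <;> nlinarith [hu.1, hu.2]

theorem TSt {ι : Type*} [Finite ι] (B X X' : ι → Finset Pt) (P : ι → Prop) (x y x' y' : ℝ)
    (hx : x ≠ x') (hy : y ≠ y')
    (h1 : ∀ i, ∀ q ∈ B i, q ≠ (x, y)) (h2 : ∀ i, ∀ q ∈ B i, q.1 ≠ x')
    (h3 : ∀ i, ∀ q ∈ B i, q.2 ∈ uIcc y y' → q.2 = y)
    (hX : ∀ i q, q ∈ X i ↔ q ∈ B i ∨ (P i ∧ q = (x, y)))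
    (hX' : ∀ i q, q ∈ X' i ↔ q ∈ B i ∨ (P i ∧ (q = (x', y) ∨ q = (x, y') ∨ q = (x', y')))) :
    TE X X' := by
  have cvx : ∀ {s t : ℝ}, 0 ≤ s → 0 ≤ t → 0 < s + t → (s * y' + t * y) / (s + t) ∈ uIcc y y' := by
    intro s t hs ht hst
    rw [mem_uIcc, le_div_iff₀ hst, div_le_iff₀ hst, le_div_iff₀ hst, div_le_iff₀ hst]
    rcases le_total y y' with h | h
    · left; constructor <;> nlinarith
    · right; constructor <;> nlinarith
  have e1 := Delta (fun i => sp (B i)) P (ap x) (ft y') (ft y) (fun i => sp_closed _) ?_ ?_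
  · have e2 := Delta (fun i => sp (B i) ∪ on (P i) (segment ℝ (ap x) (ft y'))) P (ft y') (ap x') (ft y)
      (fun i => (sp_closed _).union (on_closed (seg_closed _ _))) ?_ ?_
    · refine (e1.trans (e2.congr (fun i => ?_) fun i => rfl)).congr (fun i => ?_) (fun i => ?_)
      · ext z; simp only [mem_union, mem_on]; tauto
      · ext z
        simp only [mem_sp', hX, mem_union, mem_on, or_and_right, exists_or, and_assoc,
          exists_and_left, exists_eq_left]
      · ext z
        simp only [mem_sp', hX', mem_union, mem_on, or_and_right, exists_or, and_assoc,
          exists_and_left, exists_eq_left]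
        rw [segment_symm ℝ (ft y') (ap x'), ← mem_sp']
        tauto
    · intro r t h
      simp [ap, ft, Prod.ext_iff] at h
      obtain ⟨h1, h2, h3⟩ := h
      refine ⟨?_, h3⟩
      rw [h3] at h2
      have : r * (y' - y) = 0 := by linarith
      rcases mul_eq_zero.1 this with h | h
      · exact h
      · exact absurd (by linarith) hy
    · intro i r s t hr hs ht hst hm
      rcases hm with hm | hm
      · obtain ⟨q, hq, u, hu, he⟩ := mem_sp.1 hm
        simp [ap, ft, Prod.ext_iff] at he
        obtain ⟨e1, e2, rfl⟩ := he
        by_cases hu0 : s = 0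
        · subst hu0
          have : q.2 ∈ uIcc y y' := by
            have := cvx hr ht (by linarith)
            rwa [show r + t = 1 by linarith, div_one, e2, sub_zero, one_mul] at this
          have := h3 i q hq this
          rw [this] at e2
          have : r * (y' - y) = 0 := by rw [show t = 1 - r by linarith] at e2; linarith
          rcases mul_eq_zero.1 this with h | h
          · right; linarith
          · exact absurd (by linarith) hy
        · exact absurd (mul_left_cancel₀ hu0 e1).symm (h2 i q hq)
      · obtain ⟨-, hm⟩ := hm
        obtain ⟨u, hu, he⟩ := mem_seg.1 hm
        simp [ap, ft, Prod.ext_iff] at he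
        obtain ⟨e1, e2, rfl⟩ := he
        by_cases hu0 : s = 0
        · subst hu0
          have : t * (y' - y) = 0 := by rw [show r = 1 - t by linarith] at e2; linarith
          rcases mul_eq_zero.1 this with h | h
          · left; linarith
          · exact absurd (by linarith) hy
        · exact absurd (mul_left_cancel₀ hu0 e1).symm hx
  · intro r t h
    simp [ap, ft, Prod.ext_iff] at h
    obtain ⟨h1, h2, h3⟩ := h
    refine ⟨h3, ?_⟩
    rw [h3] at h2
    have : t * (y' - y) = 0 := by linarith
    rcases mul_eq_zero.1 this with h | h
    · exact h
    · exact absurd (by linarith) hy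
  · intro i r s t hr hs ht hst hm
    obtain ⟨q, hq, u, hu, he⟩ := mem_sp.1 hm
    simp [ap, ft, Prod.ext_iff] at he
    obtain ⟨e1, e2, rfl⟩ := he
    by_cases hr1 : r = 1
    · exact .inl hr1
    right
    have hst' : 0 < s + t := by
      rcases (add_nonneg hs ht).eq_or_lt with h | h
      · exact absurd (by linarith) hr1
      · exact h
    have hq2 : q.2 = (s * y' + t * y) / (s + t) := by
      rw [eq_div_iff hst'.ne', e2, show 1 - r = s + t by linarith]; ring
    have hq3 := h3 i q hq (hq2 ▸ cvx hs ht hst')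
    have hs0 : s = 0 := by
      rw [hq3, show 1 - r = s + t by linarith] at e2
      have : s * (y' - y) = 0 := by linarith
      rcases mul_eq_zero.1 this with h | h
      · exact h
      · exact absurd (by linarith) hy
    by_cases hr0 : r = 0
    · linarith
    · exact absurd (Prod.ext (mul_left_cancel₀ hr0 e1).symm hq3) (h1 i q hq)

lemma tri1 {x y y' r s t u : ℝ} {q : Pt} (hy : y ≠ y') (h1 : q ≠ (x, y))
    (h3 : q.2 ∈ uIcc y y' → q.2 = y) (hr : 0 ≤ r) (hs : 0 ≤ s) (ht : 0 ≤ t) (hst : r + s + t = 1)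
    (he : r • ap x + s • ft y' + t • ft y = (u * q.1, (1 - u) * q.2, u)) : r = 1 ∨ t = 1 := by
  simp [ap, ft, Prod.ext_iff] at he
  obtain ⟨e1, e2, rfl⟩ := he
  by_cases hr1 : r = 1
  · exact .inl hr1
  right
  have hst' : 0 < s + t := by
    rcases (add_nonneg hs ht).eq_or_lt with h | h
    · exact absurd (by linarith) hr1
    · exact h
  have hq2 : q.2 = (s * y' + t * y) / (s + t) := by
    rw [eq_div_iff hst'.ne', e2, show 1 - r = s + t by linarith]; ring
  have hq3 := h3 (by
    rw [hq2, mem_uIcc, le_div_iff₀ hst', div_le_iff₀ hst', le_div_iff₀ hst', div_le_iff₀ hst']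
    rcases le_total y y' with h | h
    · left; constructor <;> nlinarith
    · right; constructor <;> nlinarith)
  have hs0 : s = 0 := by
    rw [hq3, show 1 - r = s + t by linarith] at e2
    have : s * (y' - y) = 0 := by linarith
    rcases mul_eq_zero.1 this with h | h
    · exact h
    · exact absurd (by linarith) hy
  by_cases hr0 : r = 0
  · linarith
  · exact absurd (Prod.ext (mul_left_cancel₀ hr0 e1).symm hq3) h1

lemma seg_sp (x y : ℝ) : segment ℝ (ap x) (ft y) = sp {(x, y)} := by simp [sp]

lemma mem_sp1 {x y : ℝ} {z : R3} : z ∈ sp {(x, y)} ↔ ∃ s ∈ Icc (0:ℝ) 1, z = (s * x, (1 - s) * y, s) := by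
  simp [mem_sp]

lemma add_mul_mem {a b r t : ℝ} (hr : 0 ≤ r) (ht : 0 ≤ t) (h : r + t = 1) : r * a + t * b ∈ uIcc b a := by
  rw [mem_uIcc]
  obtain rfl : r = 1 - t := by linarith
  rcases le_total a b with h' | h'
  · right; constructor <;> nlinarith
  · left; constructor <;> nlinarith

set_option maxHeartbeats 1000000 in
theorem TEs {ι : Type*} [Finite ι] (B X X' : ι → Finset Pt) (Pn Pk Pl : ι → Prop)
    (xn xk xl y0 y' q c : ℝ) (hy : y0 ≠ y') (hq : q ∉ uIcc y0 y')
    (hnk : xn ∉ uIcc xk c) (hnl : xn ≠ xl) (hc : Bet xk c xl)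
    (hBk : ∀ i, ∀ p ∈ B i, p.1 ∉ uIcc xk c)
    (hB0 : ∀ i, ∀ p ∈ B i, p.2 ∉ uIcc y0 y')
    (hX : ∀ i p, p ∈ X i ↔ p ∈ B i ∨ (Pn i ∧ p = (xn, y0)) ∨ (Pl i ∧ p = (xl, y0)) ∨
      (Pk i ∧ (p = (xk, y0) ∨ p = (xk, q))))
    (hX' : ∀ i p, p ∈ X' i ↔ p ∈ B i ∨ (Pn i ∧ (p = (xn, y') ∨ p = (xk, y'))) ∨
      (Pl i ∧ (p = (xl, y0) ∨ p = (xk, y0))) ∨ (Pk i ∧ p = (xk, q))) :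
    TE X X' := by
  have hck : xk ≠ c := by rcases hc with h | h <;> [exact h.1.ne; exact h.2.ne']
  have hcl : c ≠ xl := by rcases hc with h | h <;> [exact h.2.ne; exact h.1.ne']
  have hlk : xl ∉ uIcc xk c := by
    rw [mem_uIcc]; rcases hc with h | h <;> (rintro (h' | h') <;> linarith)
  have hneg : (xk - c) * (xl - c) < 0 := by rcases hc with h | h <;> nlinarith
  have hnk' : xn ≠ xk := fun h => hnk (h ▸ left_mem_uIcc)
  have hnc : xn ≠ c := fun h => hnk (h ▸ right_mem_uIcc)
  have hlk' : xl ≠ xk := fun h => hlk (h ▸ left_mem_uIcc)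
  have hq0 : q ≠ y0 := fun h => hq (h ▸ left_mem_uIcc)
  have hq' : q ≠ y' := fun h => hq (h ▸ right_mem_uIcc)
  have mz : ∀ {a b : ℝ}, a * b = 0 → b ≠ 0 → a = 0 := fun h h' => (mul_eq_zero.1 h).resolve_right h'
  obtain ⟨m, hm⟩ : ∃ m : R3, m = (c * (1/2), y0 / 2, 1/2) := ⟨_, rfl⟩
  have cl := fun p q : R3 => seg_closed p q
  -- step 1
  have s1 := Delta (fun i => sp (B i) ∪ on (Pl i) (sp {(xl, y0)}) ∪
      on (Pk i) (sp {(xk, y0)} ∪ sp {(xk, q)})) Pn (ap xn) (ft y') (ft y0)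
      (fun i => ((sp_closed _).union (on_closed (sp_closed _))).union
        (on_closed ((sp_closed _).union (sp_closed _)))) (by
      intro r t h
      simp [ap, ft, Prod.ext_iff] at h
      obtain ⟨h1, h2, h3⟩ := h
      refine ⟨h3, ?_⟩
      rw [h3] at h2
      exact mz (a := t) (b := y' - y0) (by linarith) (fun h => hy (by linarith))) (by
      rintro i r s t hr hs ht hst ((hm | ⟨-, hm⟩) | ⟨-, hm | hm⟩)
      · obtain ⟨p, hp, u, hu, he⟩ := mem_sp.1 hm
        exact tri1 hy (fun h => hB0 i p hp (by rw [h]; exact left_mem_uIcc))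
          (fun h => absurd h (hB0 i p hp)) hr hs ht hst he
      · obtain ⟨u, hu, he⟩ := mem_sp1.1 hm
        exact tri1 (q := (xl, y0)) hy (by simp [hnl.symm]) (fun _ => rfl) hr hs ht hst he
      · obtain ⟨u, hu, he⟩ := mem_sp1.1 hm
        exact tri1 (q := (xk, y0)) hy (by simp [hnk'.symm]) (fun _ => rfl) hr hs ht hst he
      · obtain ⟨u, hu, he⟩ := mem_sp1.1 hm
        exact tri1 (q := (xk, q)) hy (by simp [hnk'.symm]) (fun h => absurd h hq) hr hs ht hst he)
  -- step 2
  have hJ : ∀ {i : ι} {j : R3}, j ∈ (if Pn i then ({ft y'} : Finset R3) else ∅) ∪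
      (if Pl i then {ap xl} else ∅) ∪ (if Pk i then {ap xk} else ∅) ↔
      (Pn i ∧ j = ft y') ∨ (Pl i ∧ j = ap xl) ∨ (Pk i ∧ j = ap xk) := by
    intro i j
    by_cases h1 : Pn i <;> by_cases h2 : Pl i <;> by_cases h3 : Pk i <;> simp [h1, h2, h3]
  have s2 := VM (fun i => sp (B i) ∪ on (Pn i) (sp {(xn, y')}) ∪ on (Pk i) (sp {(xk, q)}))
    (fun i => (if Pn i then ({ft y'} : Finset R3) else ∅) ∪
      (if Pl i then {ap xl} else ∅) ∪ (if Pk i then {ap xk} else ∅)) (ft y0) m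
      (fun i => ((sp_closed _).union (on_closed (sp_closed _))).union (on_closed (sp_closed _))) (by
      intro i j hj i' j' hj' s hs s' hs' e h
      have hs0 := hs.1
      have hs0' := hs'.1
      rcases hJ.1 hj with ⟨-, rfl⟩ | ⟨-, rfl⟩ | ⟨-, rfl⟩ <;>
      rcases hJ.1 hj' with ⟨-, rfl⟩ | ⟨-, rfl⟩ | ⟨-, rfl⟩ <;>
      simp [ap, ft, hm, Prod.ext_iff] at h <;> obtain ⟨h1, h2, h3⟩ := h
      · have h3 : e = 0 := by simpa using h3
        rw [h3] at h2
        refine ⟨h3, ?_⟩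
        linarith [mz (a := s - s') (b := y' - y0) (by linarith) (fun h => hy (by linarith))]
      · have : s' = 0 := mz (b := xl - c) (by rw [show e = -2 * s' by linarith] at h1; linarith)
          (fun h => hcl (by linarith))
        have e0 : e = 0 := by linarith
        rw [this, e0] at h2
        exact ⟨e0, by linarith [mz (a := s) (b := y' - y0) (by linarith) (fun h => hy (by linarith))]⟩
      · have : s' = 0 := mz (b := xk - c) (by rw [show e = -2 * s' by linarith] at h1; linarith)
          (fun h => hck (by linarith))
        have e0 : e = 0 := by linarith
        rw [this, e0] at h2
        exact ⟨e0, by linarith [mz (a := s) (b := y' - y0) (by linarith) (fun h => hy (by linarith))]⟩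
      · have : s = 0 := mz (b := xl - c) (by rw [show e = 2 * s by linarith] at h1; linarith)
          (fun h => hcl (by linarith))
        have e0 : e = 0 := by linarith
        rw [this, e0] at h2
        exact ⟨e0, by linarith [mz (a := s') (b := y' - y0) (by linarith) (fun h => hy (by linarith))]⟩
      · have : s - s' = 0 := mz (b := xl - c) (by rw [show e = 2 * (s - s') by linarith] at h1; linarith)
          (fun h => hcl (by linarith))
        exact ⟨by linarith, by linarith⟩
      · rw [show e = 2 * (s - s') by linarith] at h1
        have h4 : s * (xl - c) = s' * (xk - c) := by linarith
        have h5 : s * (xl - c)^2 = s' * ((xk - c) * (xl - c)) := by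
          rw [sq, ← mul_assoc, h4]; ring
        have : s * (xl - c)^2 = 0 := le_antisymm (by nlinarith) (by positivity)
        have s0 : s = 0 := mz this (pow_ne_zero _ fun h => hcl (by linarith))
        have : s' = 0 := mz (b := xk - c) (by rw [s0] at h4; linarith) (fun h => hck (by linarith))
        exact ⟨by linarith, by linarith⟩
      · have : s = 0 := mz (b := xk - c) (by rw [show e = 2 * s by linarith] at h1; linarith)
          (fun h => hck (by linarith))
        have e0 : e = 0 := by linarith
        rw [this, e0] at h2
        exact ⟨e0, by linarith [mz (a := s') (b := y' - y0) (by linarith) (fun h => hy (by linarith))]⟩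
      · rw [show e = 2 * (s - s') by linarith] at h1
        have h4 : s' * (xl - c) = s * (xk - c) := by linarith
        have h5 : s' * (xl - c)^2 = s * ((xk - c) * (xl - c)) := by
          rw [sq, ← mul_assoc, h4]; ring
        have : s' * (xl - c)^2 = 0 := le_antisymm (by nlinarith) (by positivity)
        have s0 : s' = 0 := mz this (pow_ne_zero _ fun h => hcl (by linarith))
        have : s = 0 := mz (b := xk - c) (by rw [s0] at h4; linarith) (fun h => hck (by linarith))
        exact ⟨by linarith, by linarith⟩
      · have : s - s' = 0 := mz (b := xk - c) (by rw [show e = 2 * (s - s') by linarith] at h1; linarith)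
          (fun h => hck (by linarith))
        exact ⟨by linarith, by linarith⟩) (by
      intro i i' j hj s hs hs1 u hu hz
      have : ∃ p : Pt, (p.1 ≠ c ∧ p.2 ≠ y0 ∧ (p.2 ∈ uIcc y0 y' → p.2 = y')) ∧
          ∃ e ∈ Icc (0:ℝ) 1, ft y0 + s • (j - ft y0) + (u * (1 - s)) • (m - ft y0)
            = (e * p.1, (1 - e) * p.2, e) := by
        rcases hz with (hz | ⟨-, hz⟩) | ⟨-, hz⟩
        · obtain ⟨p, hp, u, hu, he⟩ := mem_sp.1 hz
          exact ⟨p, ⟨fun h => hBk i p hp (h ▸ right_mem_uIcc), fun h => hB0 i p hp (h ▸ left_mem_uIcc),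
            fun h => absurd h (hB0 i p hp)⟩, u, hu, he⟩
        · obtain ⟨u, hu, he⟩ := mem_sp1.1 hz
          exact ⟨(xn, y'), ⟨hnc, hy.symm, fun _ => rfl⟩, u, hu, he⟩
        · obtain ⟨u, hu, he⟩ := mem_sp1.1 hz
          exact ⟨(xk, q), ⟨hck, hq0, fun h => absurd h hq⟩, u, hu, he⟩
      obtain ⟨p, ⟨p1, p2, p3⟩, e, he, h⟩ := this
      have v0 : 0 ≤ u * (1 - s) := mul_nonneg hu.1 (by linarith)
      have v1 : u * (1 - s) ≤ 1 - s := by nlinarith [hu.2]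
      have hA : ∀ x, j = ap x → False := by
        rintro x rfl
        simp [ap, ft, hm, Prod.ext_iff] at h
        obtain ⟨h1, h2, h3⟩ := h
        have : (1 - e) * (p.2 - y0) = 0 := by rw [← h3] at h2 ⊢; linarith
        have := mz this (sub_ne_zero.2 p2)
        linarith
      rcases hJ.1 hj with ⟨-, rfl⟩ | ⟨-, hj⟩ | ⟨-, hj⟩
      · simp [ft, hm, Prod.ext_iff] at h
        obtain ⟨h1, h2, h3⟩ := h
        have : e * (p.1 - c) = 0 := by rw [← h3] at h1 ⊢; linarith
        have e0 := mz this (sub_ne_zero.2 p1)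
        have v : u * (1 - s) = 0 := by linarith
        rw [v, e0] at h2
        have hp2 : p.2 = s * y' + (1 - s) * y0 := by linarith
        have := p3 (hp2 ▸ add_mul_mem hs (by linarith) (by ring))
        have : (1 - s) * (y' - y0) = 0 := by linarith
        linarith [mz this (sub_ne_zero.2 hy.symm)]
      · exact hA _ hj
      · exact hA _ hj)
  -- step 3
  have s3 := Delta (fun i => sp (B i) ∪ on (Pn i) (sp {(xn, y')} ∪ segment ℝ m (ft y')) ∪
      on (Pk i) (sp {(xk, q)} ∪ segment ℝ m (ap xk))) Pl m (ft y0) (ap xl)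
      (fun i => ((sp_closed _).union (on_closed ((sp_closed _).union (cl _ _)))).union
        (on_closed ((sp_closed _).union (cl _ _)))) (by
      intro r t h
      simp [ap, ft, hm, Prod.ext_iff] at h
      obtain ⟨h1, h2, h3⟩ := h
      have : r = 0 := mz (b := c - xl) (by rw [show t = - (r / 2) by linarith] at h1; linarith) (sub_ne_zero.2 hcl)
      exact ⟨this, by rw [this] at h3; linarith⟩) (by
      intro i r s t hr hs ht hst hz
      have hsp : ∀ p : Pt, p.2 ≠ y0 → ∀ u, r • m + s • ft y0 + t • ap xl = (u * p.1, (1 - u) * p.2, u) →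
          r = 1 ∨ t = 1 := by
        intro p hp u h
        simp [ap, ft, hm, Prod.ext_iff] at h
        obtain ⟨h1, h2, h3⟩ := h
        have : (1 - u) * (p.2 - y0) = 0 := by
          rw [show u = 1 - r / 2 - s by linarith] at h2 ⊢; linarith
        have := mz this (sub_ne_zero.2 hp)
        right; linarith
      rcases hz with (hz | ⟨-, hz | hz⟩) | ⟨-, hz | hz⟩
      · obtain ⟨p, hp, u, hu, he⟩ := mem_sp.1 hz
        exact hsp p (fun h => hB0 i p hp (h ▸ left_mem_uIcc)) u he
      · obtain ⟨u, hu, he⟩ := mem_sp1.1 hz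
        exact hsp (xn, y') hy.symm u he
      · obtain ⟨u, hu, h⟩ := mem_seg.1 hz
        simp [ap, ft, hm, Prod.ext_iff] at h
        obtain ⟨h1, h2, h3⟩ := h
        have t0 : t = 0 := mz (b := xl - c) (by rw [show u = r + 2 * t by linarith] at h1; linarith)
          (sub_ne_zero.2 hcl.symm)
        have : (1 - u) * (y' - y0) = 0 := by
          rw [show r = u by linarith, show s = 1 - u by linarith] at h2; linarith
        have := mz this (sub_ne_zero.2 hy.symm)
        left; linarith
      · obtain ⟨u, hu, he⟩ := mem_sp1.1 hz
        exact hsp (xk, q) hq0 u he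
      · obtain ⟨u, hu, h⟩ := mem_seg.1 hz
        simp [ap, ft, hm, Prod.ext_iff] at h
        obtain ⟨h1, h2, h3⟩ := h
        have h4 : (1 - u) * (xk - c) = t * (xl - c) := by
          rw [show r = 2 - u - 2 * t by linarith] at h1; linarith
        have h5 : t * (xl - c)^2 = (1 - u) * ((xk - c) * (xl - c)) := by
          rw [← mul_assoc, h4]; ring
        have : t * (xl - c)^2 = 0 := le_antisymm (by nlinarith [hu.2]) (by positivity)
        have t0 : t = 0 := mz this (pow_ne_zero _ fun h => hcl (by linarith))
        have : 1 - u = 0 := mz (b := xk - c) (by rw [t0] at h4; linarith) (fun h => hck (by linarith))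
        left; linarith)
  -- step 4
  have s4 := Delta (fun i => sp (B i) ∪ on (Pn i) (sp {(xn, y')} ∪ segment ℝ m (ft y')) ∪
      on (Pl i) (sp {(xl, y0)} ∪ segment ℝ m (ft y0))) Pk m (ap xk) (ft q)
      (fun i => ((sp_closed _).union (on_closed ((sp_closed _).union (cl _ _)))).union
        (on_closed ((sp_closed _).union (cl _ _)))) (by
      intro r t h
      simp [ap, ft, hm, Prod.ext_iff] at h
      obtain ⟨h1, h2, h3⟩ := h
      have : r = 0 := mz (b := c - xk) (by rw [show t = - (r / 2) by linarith] at h1; linarith) (sub_ne_zero.2 hck.symm)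
      exact ⟨this, by rw [this] at h3; linarith⟩) (by
      intro i r s t hr hs ht hst hz
      have hsp : ∀ p : Pt, p.1 ∉ uIcc xk c → ∀ u, r • m + s • ap xk + t • ft q = (u * p.1, (1 - u) * p.2, u) →
          r = 1 ∨ t = 1 := by
        intro p hp u h
        simp [ap, ft, hm, Prod.ext_iff] at h
        obtain ⟨h1, h2, h3⟩ := h
        by_cases hu : u = 0
        · right; linarith
        exfalso; apply hp
        have : p.1 = (r / 2 / u) * c + (s / u) * xk := by field_simp; linarith
        rw [this]
        have : 0 ≤ u := by linarith
        exact add_mul_mem (by positivity) (by positivity) (by field_simp; linarith)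
      have hmm : ∀ z, z ≠ q → r • m + s • ap xk + t • ft q ∈ segment ℝ m (ft z) → r = 1 ∨ t = 1 := by
        intro y hy hz
        obtain ⟨u, hu, h⟩ := mem_seg.1 hz
        simp [ap, ft, hm, Prod.ext_iff] at h
        obtain ⟨h1, h2, h3⟩ := h
        have s0 : s = 0 := mz (b := xk - c) (by rw [show u = r + 2 * s by linarith] at h1; linarith)
          (sub_ne_zero.2 hck)
        have : (1 - u) * (y - q) = 0 := by
          rw [show r = u by linarith, show t = 1 - u by linarith] at h2; linarith
        have := mz this (sub_ne_zero.2 hy)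
        left; linarith
      rcases hz with (hz | ⟨-, hz | hz⟩) | ⟨-, hz | hz⟩
      · obtain ⟨p, hp, u, hu, he⟩ := mem_sp.1 hz
        exact hsp p (hBk i p hp) u he
      · obtain ⟨u, hu, he⟩ := mem_sp1.1 hz
        exact hsp (xn, y') hnk u he
      · exact hmm _ hq'.symm hz
      · obtain ⟨u, hu, he⟩ := mem_sp1.1 hz
        exact hsp (xl, y0) hlk u he
      · exact hmm _ hq0.symm hz)
  -- step 5
  have s5 := lowmove (fun i => sp (B i) ∪ on (Pn i) (sp {(xn, y')}) ∪ on (Pl i) (sp {(xl, y0)}))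
    (fun i => (if Pn i then ({y'} : Finset ℝ) else ∅) ∪
      (if Pl i then {y0} else ∅) ∪ (if Pk i then {q} else ∅)) c (y0/2) (1/2) xk 0 1
      (fun i => ((sp_closed _).union (on_closed (sp_closed _))).union (on_closed (sp_closed _)))
      hck.symm (by norm_num) (by norm_num) (fun i => by
        rw [uIcc_comm] at hnk hlk
        refine ((off_sp fun p hp => by rw [uIcc_comm]; exact hBk i p hp).union fun z hz => ?_).union fun z hz => ?_
        · exact off_sp (fun p hp => by simp at hp; simpa [hp] using hnk) z hz.2
        · exact off_sp (fun p hp => by simp at hp; simpa [hp] using hlk) z hz.2)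
  have fan2 : ∀ i, ∀ p, fan p ((if Pn i then ({ft y'} : Finset R3) else ∅) ∪
      (if Pl i then {ap xl} else ∅) ∪ (if Pk i then {ap xk} else ∅)) =
      on (Pn i) (segment ℝ p (ft y')) ∪ on (Pl i) (segment ℝ p (ap xl)) ∪
        on (Pk i) (segment ℝ p (ap xk)) := by
    intro i p
    ext z
    by_cases h1 : Pn i <;> by_cases h2 : Pl i <;> by_cases h3 : Pk i <;> simp [h1, h2, h3, fan, on, or_assoc]
  have fan5 : ∀ i, ∀ p, ffan p ((if Pn i then ({y'} : Finset ℝ) else ∅) ∪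
      (if Pl i then {y0} else ∅) ∪ (if Pk i then {q} else ∅)) =
      on (Pn i) (segment ℝ p (ft y')) ∪ on (Pl i) (segment ℝ p (ft y0)) ∪
        on (Pk i) (segment ℝ p (ft q)) := by
    intro i p
    ext z
    by_cases h1 : Pn i <;> by_cases h2 : Pl i <;> by_cases h3 : Pk i <;> simp [h1, h2, h3, ffan, fan, on, or_assoc]
  simp only [fan2] at s2
  simp only [fan5, ← ap_eq, ← hm] at s5
  have sy := fun p q : R3 => segment_symm ℝ p q
  refine ((((s1.trans (s2.congr ?_ fun i => rfl)).trans (s3.congr ?_ fun i => rfl)).trans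
    (s4.symm.congr ?_ fun i => rfl)).trans (s5.congr ?_ fun i => rfl)).congr ?_ ?_
  · intro i; ext z
    simp only [mem_union, mem_on, ← seg_sp, sy (ft y0)]; tauto
  · intro i; ext z
    simp only [mem_union, mem_on, ← seg_sp]; tauto
  · intro i; ext z
    simp only [mem_union, mem_on, ← seg_sp, sy (ft y0)]; tauto
  · intro i; ext z
    simp only [mem_union, mem_on, ← seg_sp]; tauto
  · intro i; ext z
    rw [mem_sp']
    simp only [hX, mem_union, mem_on, or_and_right, exists_or, and_assoc,
      exists_and_left, exists_eq_left, ← seg_sp]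
    rw [← mem_sp']; tauto
  · intro i; ext z
    rw [mem_sp']
    simp only [hX', mem_union, mem_on, or_and_right, exists_or, and_assoc,
      exists_and_left, exists_eq_left, ← seg_sp]
    rw [← mem_sp']; tauto

def e (k : Fin 3) : ℝ := (k : ℝ) - 1

lemma e_bd (k : Fin 3) : -1 ≤ e k ∧ e k ≤ 1 := by fin_cases k <;> norm_num [e]
lemma e_inj {k k' : Fin 3} (h : e k = e k') : k = k' := by
  fin_cases k <;> fin_cases k' <;> first | rfl | (norm_num [e] at h)
lemma e_lt {k k' : Fin 3} (h : e k < e k') : e k + 1 ≤ e k' := by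
  fin_cases k <;> fin_cases k' <;> first | (norm_num [e] at h; done) | norm_num [e]

lemma mem_shiftD {δ : ℝ} {X : Finset Pt} {p : Pt} : p ∈ shiftD δ X ↔ (p.1 - δ, p.2 - δ) ∈ X := by
  simp only [shiftD, Finset.mem_image]
  constructor
  · rintro ⟨q, hq, rfl⟩; simpa using hq
  · intro h; exact ⟨_, h, by simp⟩

abbrev Lb := Fin 4 × Fin 3

def mix (Z Z' : Fin 4 → Finset Pt) (δ : ℝ) (D : Fin 3 → Prop) : Lb → Finset Pt :=
  fun i => shiftD (e i.2 * δ) (if D i.2 then Z' i.1 else Z i.1)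

def copies (Z : Fin 4 → Finset Pt) (δ : ℝ) : Lb → Finset Pt :=
  fun i => shiftD (e i.2 * δ) (Z i.1)

def CopyEq (Z Z' : Fin 4 → Finset Pt) : Prop := ∀ᶠ δ in 𝓝[>] (0:ℝ), TE (copies Z δ) (copies Z' δ)

lemma CopyEq.trans {Z Z' Z'' : Fin 4 → Finset Pt} (h : CopyEq Z Z') (h' : CopyEq Z' Z'') :
    CopyEq Z Z'' := by
  filter_upwards [h, h'] with δ h h' using h.trans h'
lemma CopyEq.symm {Z Z' : Fin 4 → Finset Pt} (h : CopyEq Z Z') : CopyEq Z' Z := by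
  filter_upwards [h] with δ h using h.symm
lemma CopyEq.refl (Z : Fin 4 → Finset Pt) : CopyEq Z Z := Eventually.of_forall fun δ => TopEq.refl _

def trZ {ι : Type*} (Z : ι → Finset Pt) : ι → Finset Pt := fun j => trF (Z j)
lemma trZ_trZ {ι : Type*} (Z : ι → Finset Pt) : trZ (trZ Z) = Z := funext fun j => trF_trF _

lemma CopyEq.tr {Z Z' : Fin 4 → Finset Pt} (h : CopyEq Z Z') : CopyEq (trZ Z) (trZ Z') := by
  filter_upwards [h] with δ h
  have := h.tr
  have hh : ∀ Z, (fun i => trF (copies Z δ i)) = copies (trZ Z) δ := by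
    intro Z; ext i p
    simp [copies, mem_trF, mem_shiftD, trZ]
  rwa [hh, hh] at this

lemma steps {α : Type*} (E : α → α → Prop) (tr : ∀ x y z, E x y → E y z → E x z) (σ : ℝ) (hσ : σ = 1 ∨ σ = -1)
    (F : (Fin 3 → Prop) → α)
    (h : ∀ k, E (F (fun k' => 0 < σ * (e k' - e k))) (F (fun k' => 0 ≤ σ * (e k' - e k)))) :
    E (F fun _ => False) (F fun _ => True) := by
  have h0 := h 0
  have h1 := h 1
  have h2 := h 2
  rcases hσ with rfl | rfl
  · have a0 : (fun k' : Fin 3 => (0:ℝ) < 1 * (e k' - e 2)) = fun _ => False := by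
      funext k; fin_cases k <;> norm_num [e]
    have a1 : (fun k' : Fin 3 => (0:ℝ) ≤ 1 * (e k' - e 2)) = fun k' => 0 < 1 * (e k' - e 1) := by
      funext k; fin_cases k <;> norm_num [e]
    have a2 : (fun k' : Fin 3 => (0:ℝ) ≤ 1 * (e k' - e 1)) = fun k' => 0 < 1 * (e k' - e 0) := by
      funext k; fin_cases k <;> norm_num [e]
    have a3 : (fun k' : Fin 3 => (0:ℝ) ≤ 1 * (e k' - e 0)) = fun _ => True := by
      funext k; fin_cases k <;> norm_num [e]
    rw [a0, a1] at h2
    rw [a2] at h1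
    rw [a3] at h0
    exact tr _ _ _ (tr _ _ _ h2 h1) h0
  · have a0 : (fun k' : Fin 3 => (0:ℝ) < -1 * (e k' - e 0)) = fun _ => False := by
      funext k; fin_cases k <;> norm_num [e]
    have a1 : (fun k' : Fin 3 => (0:ℝ) ≤ -1 * (e k' - e 0)) = fun k' => 0 < -1 * (e k' - e 1) := by
      funext k; fin_cases k <;> norm_num [e]
    have a2 : (fun k' : Fin 3 => (0:ℝ) ≤ -1 * (e k' - e 1)) = fun k' => 0 < -1 * (e k' - e 2) := by
      funext k; fin_cases k <;> norm_num [e]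
    have a3 : (fun k' : Fin 3 => (0:ℝ) ≤ -1 * (e k' - e 2)) = fun _ => True := by
      funext k; fin_cases k <;> norm_num [e]
    rw [a0, a1] at h0
    rw [a2] at h1
    rw [a3] at h2
    exact tr _ _ _ (tr _ _ _ h0 h1) h2

lemma TE_steps (Z Z' : Fin 4 → Finset Pt) (δ σ : ℝ) (hσ : σ = 1 ∨ σ = -1)
    (h : ∀ k, TE (mix Z Z' δ (fun k' => 0 < σ * (e k' - e k)))
      (mix Z Z' δ (fun k' => 0 ≤ σ * (e k' - e k)))) : TE (copies Z δ) (copies Z' δ) := by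
  have := steps TE (fun _ _ _ => TE.trans) σ hσ (mix Z Z' δ) h
  have a1 : mix Z Z' δ (fun _ => False) = copies Z δ := by funext i; simp [mix, copies]
  have a2 : mix Z Z' δ (fun _ => True) = copies Z' δ := by funext i; simp [mix, copies]
  rwa [a1, a2] at this

def SepS (S : Finset ℝ) (δ : ℝ) : Prop := 0 < δ ∧ ∀ a ∈ S, ∀ b ∈ S, a ≠ b → 10 * δ < |a - b|

lemma sep_ev (S : Finset ℝ) : ∀ᶠ δ in 𝓝[>] (0:ℝ), SepS S δ := by
  have : ∀ᶠ δ in 𝓝[>] (0:ℝ), ∀ a ∈ S, ∀ b ∈ S, a ≠ b → 10 * δ < |a - b| := by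
    rw [Filter.eventually_all_finset]; intro a _
    rw [Filter.eventually_all_finset]; intro b _
    by_cases h : a = b
    · simp [h]
    have h' : 0 < |a - b| / 10 := by have := abs_pos.2 (sub_ne_zero.2 h); positivity
    filter_upwards [Ioo_mem_nhdsGT h'] with δ hδ _
    linarith [hδ.2]
  filter_upwards [this, self_mem_nhdsWithin] with δ h h' using ⟨h', h⟩

lemma SepS.lt {S : Finset ℝ} {δ a b : ℝ} (h : SepS S δ) (ha : a ∈ S) (hb : b ∈ S) (hab : a < b) :
    a + 10 * δ < b := by
  have := h.2 a ha b hb hab.ne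
  rw [abs_of_neg (by linarith)] at this; linarith

lemma e_mul {k : Fin 3} {δ : ℝ} (h : 0 < δ) : -δ ≤ e k * δ ∧ e k * δ ≤ δ := by
  have := e_bd k; constructor <;> nlinarith

lemma SepS.lt' {S : Finset ℝ} {δ a b : ℝ} (h : SepS S δ) (ha : a ∈ S) (hb : b ∈ S) (hab : a < b)
    (k k' : Fin 3) : a + e k * δ + 8 * δ < b + e k' * δ := by
  have := h.lt ha hb hab
  have h1 := e_mul (k := k) h.1
  have h2 := e_mul (k := k') h.1
  linarith

lemma SepS.eq {S : Finset ℝ} {δ a b : ℝ} (h : SepS S δ) (ha : a ∈ S) (hb : b ∈ S) {k k' : Fin 3}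
    (he : a + e k * δ = b + e k' * δ) : a = b ∧ k = k' := by
  rcases lt_trichotomy a b with h' | h' | h'
  · have := h.lt' ha hb h' k k'; linarith [h.1]
  · subst h'
    exact ⟨rfl, e_inj (mul_right_cancel₀ h.1.ne' (by linarith))⟩
  · have := h.lt' hb ha h' k' k; linarith [h.1]

lemma SepS.lt_iff {S : Finset ℝ} {δ a b : ℝ} (h : SepS S δ) (ha : a ∈ S) (hb : b ∈ S) (hab : a ≠ b)
    {k k' : Fin 3} : a + e k * δ < b + e k' * δ ↔ a < b := by
  rcases lt_or_gt_of_ne hab with h' | h'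
  · have := h.lt' ha hb h' k k'; simp only [h', iff_true]; linarith [h.1]
  · have := h.lt' hb ha h' k' k
    have := h.1
    constructor <;> intro <;> linarith

def coords (Z : Fin 4 → Finset Pt) : Finset ℝ := cols Z ∪ cols (trZ Z)

lemma c1 {Z : Fin 4 → Finset Pt} {j : Fin 4} {p : Pt} (h : p ∈ Z j) : p.1 ∈ coords Z :=
  Finset.mem_union_left _ (mem_cols.2 ⟨j, p, h, rfl⟩)
lemma c2 {Z : Fin 4 → Finset Pt} {j : Fin 4} {p : Pt} (h : p ∈ Z j) : p.2 ∈ coords Z :=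
  Finset.mem_union_right _ (mem_cols.2 ⟨j, (p.2, p.1), mem_trF.2 h, rfl⟩)

lemma NI_empty {A : Set ℝ} : NI A ∅ := by simp [NI]

/-- NI is stable under small shifts -/
lemma NI_shift {S : Finset ℝ} {δ : ℝ} (h : SepS S δ) {A B : Set ℝ} (hA : A ⊆ S) (hB : B ⊆ S)
    (hN : NI A B) (k k' : Fin 3) : NI ((· + e k * δ) '' A) ((· + e k' * δ) '' B) := by
  constructor
  · rintro _ ⟨a, ha, rfl⟩ _ ⟨b, hb, rfl⟩ he
    exact hN.1 a ha b hb (h.eq (hA ha) (hB hb) he).1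
  · rintro _ ⟨a, ha, rfl⟩ _ ⟨a', ha', rfl⟩ _ ⟨b, hb, rfl⟩ _ ⟨b', hb', rfl⟩
    have n1 := hN.1 a ha b hb
    have n2 := hN.1 a' ha' b hb
    have n3 := hN.1 a ha b' hb'
    have n4 := hN.1 a' ha' b' hb'
    dsimp only
    rw [h.lt_iff (hA ha) (hB hb) n1, h.lt_iff (hB hb) (hA ha') n2.symm,
      h.lt_iff (hA ha') (hB hb') n4, h.lt_iff (hB hb) (hA ha) n1.symm,
      h.lt_iff (hA ha) (hB hb') n3, h.lt_iff (hB hb') (hA ha') n4.symm]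
    exact hN.2 a ha a' ha' b hb b' hb'

lemma NI.mono {A B A' B' : Set ℝ} (h : NI A B) (hA : A' ⊆ A) (hB : B' ⊆ B) : NI A' B' :=
  ⟨fun a ha b hb => h.1 a (hA ha) b (hB hb), fun a ha a' ha' b hb b' hb' =>
    h.2 a (hA ha) a' (hA ha') b (hB hb) b' (hB hb')⟩

lemma mem_mix {Z Z' : Fin 4 → Finset Pt} {δ : ℝ} {D : Fin 3 → Prop} {i : Lb} {p : Pt} :
    p ∈ mix Z Z' δ D i ↔ ∃ q ∈ (if D i.2 then Z' i.1 else Z i.1), p = (q.1 + e i.2 * δ, q.2 + e i.2 * δ) := by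
  simp only [mix, shiftD, Finset.mem_image, eq_comm]

/-- moving one column in one copy of a VM1 mixture -/
lemma mix_step {Z : Fin 4 → Finset Pt} {S : Finset ℝ} {δ x0 v σ : ℝ} (hS : SepS S δ) (hZ : coords Z ⊆ S)
    (hx0 : x0 ∈ S) (hvS : v ∈ S) (h0v : x0 ≠ v) (hσ : σ = 1 ∨ σ = -1) (k : Fin 3) :
    mix Z (VM1 x0 v Z) δ (fun k' => 0 ≤ σ * (e k' - e k)) =
    VM1 (x0 + e k * δ) (v + e k * δ) (mix Z (VM1 x0 v Z) δ (fun k' => 0 < σ * (e k' - e k))) := by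
  have hlt : ∀ k', k' ≠ k → ((0 ≤ σ * (e k' - e k)) ↔ (0 < σ * (e k' - e k))) := by
    intro k' hk
    have : σ * (e k' - e k) ≠ 0 := by
      refine mul_ne_zero ?_ (sub_ne_zero.2 fun h => hk (e_inj h))
      rcases hσ with rfl | rfl <;> norm_num
    exact ⟨fun h => lt_of_le_of_ne h this.symm, le_of_lt⟩
  ext ⟨j, k'⟩ p
  rw [VM1_mem]
  by_cases hk : k' = k
  · subst hk
    simp only [mix, mem_shiftD, sub_self, mul_zero, lt_irrefl, le_refl, if_true, if_false, VM1_mem]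
    constructor
    · rintro (⟨h1, h2⟩ | ⟨h1, h2⟩)
      · exact .inl ⟨h1, fun h => h2 (by linarith)⟩
      · refine .inr ⟨by linarith, ?_⟩
        convert h2 using 2; ring
    · rintro (⟨h1, h2⟩ | ⟨h1, h2⟩)
      · exact .inl ⟨h1, fun h => h2 (by linarith)⟩
      · refine .inr ⟨by linarith, ?_⟩
        convert h2 using 2; ring
  · have hc : ∀ D : Fin 3 → Prop, ∀ y, (x0 + e k * δ, y) ∉ mix Z (VM1 x0 v Z) δ D (j, k') := by
      intro D y h
      rw [mem_mix] at h
      obtain ⟨q, hq, he⟩ := h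
      have : q.1 ∈ S := by
        dsimp only at hq
        split_ifs at hq with hD
        · rcases VM1_mem.1 hq with h | h
          · exact hZ (c1 h.1)
          · rw [h.1]; exact hvS
        · exact hZ (c1 hq)
      exact hk (hS.eq hx0 this (Prod.ext_iff.1 he).1).2.symm
    have e1 : p ∈ mix Z (VM1 x0 v Z) δ (fun k' => 0 ≤ σ * (e k' - e k)) (j, k') ↔
        p ∈ mix Z (VM1 x0 v Z) δ (fun k' => 0 < σ * (e k' - e k)) (j, k') := by
      rw [mem_mix, mem_mix]; simp only [hlt k' hk]
    rw [e1]
    constructor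
    · intro h
      refine .inl ⟨h, fun h' => hc _ p.2 (by rw [← h']; exact h)⟩
    · rintro (h | h)
      · exact h.1
      · exact absurd h.2 (hc _ _)

lemma RW_mix {Z Z' : Fin 4 → Finset Pt} {δ : ℝ} {D : Fin 3 → Prop} {c y : ℝ} (h : y ∈ RW (mix Z Z' δ D) c) :
    ∃ j k q, q ∈ (if D k then Z' j else Z j) ∧ c = q.1 + e k * δ ∧ y = q.2 + e k * δ := by
  obtain ⟨⟨j, k⟩, h⟩ := h
  obtain ⟨q, hq, he⟩ := mem_mix.1 h
  exact ⟨j, k, q, hq, (Prod.ext_iff.1 he).1, (Prod.ext_iff.1 he).2⟩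

lemma SepS.bet {S : Finset ℝ} {δ a b c : ℝ} (h : SepS S δ) (ha : a ∈ S) (hb : b ∈ S) (hc : c ∈ S)
    (hab : a ≠ b) (hcb : b ≠ c) {k k' k'' : Fin 3} :
    Bet (a + e k * δ) (b + e k' * δ) (c + e k'' * δ) ↔ Bet a b c := by
  simp only [Bet, h.lt_iff ha hb hab, h.lt_iff hb hc hcb, h.lt_iff hb ha hab.symm, h.lt_iff hc hb hcb.symm]

lemma mixS {Z Z' : Fin 4 → Finset Pt} {S : Finset ℝ} (hZ : coords Z ⊆ S) (hZ' : coords Z' ⊆ S) {P : Prop}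
    {j : Fin 4} {q : Pt} (h : q ∈ (if P then Z' j else Z j)) : q.1 ∈ S ∧ q.2 ∈ S := by
  split_ifs at h
  · exact ⟨hZ' (c1 h), hZ' (c2 h)⟩
  · exact ⟨hZ (c1 h), hZ (c2 h)⟩

lemma RW_mix' {Z Z' : Fin 4 → Finset Pt} {S : Finset ℝ} {δ : ℝ} {D : Fin 3 → Prop} {c y : ℝ} {k : Fin 3}
    (hS : SepS S δ) (hZ : coords Z ⊆ S) (hZ' : coords Z' ⊆ S) (hc : c ∈ S)
    (h : y ∈ RW (mix Z Z' δ D) (c + e k * δ)) :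
    ∃ j q, q ∈ (if D k then Z' j else Z j) ∧ q.1 = c ∧ y = q.2 + e k * δ := by
  obtain ⟨j, k', q, h1, h2, h3⟩ := RW_mix h
  obtain ⟨h4, rfl⟩ := hS.eq hc (mixS hZ hZ' h1).1 h2
  exact ⟨j, q, h1, h4.symm, h3⟩

lemma coords_VM1 {Z : Fin 4 → Finset Pt} {S : Finset ℝ} {x0 v : ℝ} (hZ : coords Z ⊆ S) (hv : v ∈ S) :
    coords (VM1 x0 v Z) ⊆ S := by
  intro c hc
  rcases Finset.mem_union.1 hc with h | h
  · obtain ⟨j, q, hq, rfl⟩ := mem_cols.1 h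
    rcases VM1_mem.1 hq with h | h
    · exact hZ (c1 h.1)
    · rw [h.1]; exact hv
  · obtain ⟨j, q, hq, rfl⟩ := mem_cols.1 h
    rcases VM1_mem.1 (mem_trF.1 hq) with h | h
    · exact hZ (c2 h.1)
    · exact hZ (c2 h.2)

theorem CV (Z : Fin 4 → Finset Pt) (x0 v : ℝ) (h0v : x0 ≠ v)
    (hv : ∀ j, ∀ q ∈ Z j, q.1 ≠ v) (hn : ∀ c, Bet x0 c v → NI (RW Z x0) (RW Z c)) :
    CopyEq Z (VM1 x0 v Z) := by
  filter_upwards [sep_ev (insert x0 (insert v (coords Z)))] with δ hS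
  set S := insert x0 (insert v (coords Z)) with hSd
  have hZ : coords Z ⊆ S := fun c hc => by simp [hSd, hc]
  have hx0 : x0 ∈ S := by simp [hSd]
  have hvS : v ∈ S := by simp [hSd]
  have hZ' := coords_VM1 (x0 := x0) hZ hvS
  obtain ⟨σ, hσ, hs⟩ : ∃ σ : ℝ, (σ = 1 ∨ σ = -1) ∧ 0 < σ * (v - x0) := by
    rcases lt_or_gt_of_ne h0v with h | h
    · exact ⟨1, .inl rfl, by linarith⟩
    · exact ⟨-1, .inr rfl, by linarith⟩
  refine TE_steps _ _ δ σ hσ fun k => ?_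
  rw [mix_step hS hZ hx0 hvS h0v hσ]
  have hd := hS.1
  have kk : ¬ 0 < σ * (e k - e k) := by simp
  refine TE_MP _ _ _ (fun h => h0v (by linarith)) ?_ ?_
  · rintro ⟨j, k'⟩ p hp hp1
    obtain ⟨q, hq, rfl⟩ := mem_mix.1 hp
    obtain ⟨h1, rfl⟩ := hS.eq (mixS hZ hZ' hq).1 hvS hp1
    dsimp only at hq
    rw [if_neg kk] at hq
    exact hv _ _ hq h1
  · intro c' hc'
    by_cases hE : RW (mix Z (VM1 x0 v Z) δ fun k' => 0 < σ * (e k' - e k)) c' = ∅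
    · rw [hE]; exact NI_empty
    obtain ⟨y, hy⟩ := nonempty_iff_ne_empty.2 hE
    obtain ⟨j, k', q, hq, rfl, -⟩ := RW_mix hy
    have hqS := (mixS hZ hZ' hq).1
    by_cases hqv : q.1 = v
    · exfalso
      have : 0 < σ * (e k' - e k) := by
        by_contra hD
        rw [if_neg hD] at hq
        exact hv _ _ hq hqv
      rw [hqv] at hc'
      rcases hσ with rfl | rfl
      · rcases hc' with h | h <;> nlinarith
      · rcases hc' with h | h <;> nlinarith
    by_cases hq0 : q.1 = x0
    · exfalso
      have : ¬ 0 < σ * (e k' - e k) := by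
        intro hD
        rw [if_pos hD] at hq
        rcases VM1_mem.1 hq with h | h
        · exact h.2 hq0
        · exact hqv h.1
      rw [hq0] at hc'
      rcases hσ with rfl | rfl
      · rcases hc' with h | h <;> nlinarith
      · rcases hc' with h | h <;> nlinarith
    rw [hS.bet hx0 hqS hvS (Ne.symm hq0) hqv] at hc'
    have hR : ∀ c, RW Z c ⊆ S := by
      rintro c y ⟨j, h⟩
      exact hZ (c2 h)
    refine (NI_shift hS (hR _) (hR _) (hn _ hc') k k').mono ?_ ?_
    · intro y hy
      obtain ⟨j, r, hr, h1, rfl⟩ := RW_mix' hS hZ hZ' hx0 hy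
      rw [if_neg kk] at hr
      exact ⟨r.2, ⟨j, h1 ▸ hr⟩, rfl⟩
    · intro y hy
      obtain ⟨j, r, hr, h1, rfl⟩ := RW_mix' hS hZ hZ' hqS hy
      refine ⟨r.2, ⟨j, ?_⟩, rfl⟩
      split_ifs at hr
      · rcases VM1_mem.1 hr with h | h
        · exact h1 ▸ h.1
        · exact absurd (h1 ▸ h.1) hqv
      · exact h1 ▸ hr

lemma exists_right (S : Finset ℝ) (a : ℝ) : ∃ v, a < v ∧ ∀ c ∈ S, a < c → v < c := by
  have : ∀ᶠ K in 𝓝[>] a, ∀ c ∈ S, a < c → K < c := by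
    rw [Filter.eventually_all_finset]
    intro c hc
    by_cases hc0 : a < c
    · filter_upwards [Ioo_mem_nhdsGT hc0] with K hK _ using hK.2
    · simp [hc0]
  obtain ⟨v, h1, h2⟩ := (this.and self_mem_nhdsWithin).exists
  exact ⟨v, h2, h1⟩

def VS {ι : Type*} (x1 x2 : ℝ) (X : ι → Finset Pt) : ι → Finset Pt := fun i => (X i).image (swapv x1 x2)

lemma VS_mem {ι : Type*} {x1 x2 : ℝ} {X : ι → Finset Pt} (h : x1 ≠ x2) {i : ι} {q : Pt} : q ∈ VS x1 x2 X i ↔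
    (q ∈ X i ∧ q.1 ≠ x1 ∧ q.1 ≠ x2) ∨ (q.1 = x2 ∧ (x1, q.2) ∈ X i) ∨ (q.1 = x1 ∧ (x2, q.2) ∈ X i) := by
  simp only [VS, Finset.mem_image]
  constructor
  · rintro ⟨⟨a, b⟩, hp, rfl⟩
    simp only [swapv]
    split_ifs with h1 h2
    · subst h1; simp [hp]
    · subst h2; simp [hp]
    · simp [hp, h1, h2]
  · obtain ⟨a, b⟩ := q
    rintro (⟨h1, h2, h3⟩ | ⟨h1, h2⟩ | ⟨h1, h2⟩)
    · exact ⟨_, h1, by simp_all [swapv]⟩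
    · exact ⟨_, h2, by simp_all [swapv]⟩
    · exact ⟨_, h2, by simp_all [swapv, h.symm]⟩

lemma VS_comm {ι : Type*} {x1 x2 : ℝ} {X : ι → Finset Pt} (h : x1 ≠ x2) : VS x1 x2 X = VS x2 x1 X := by
  ext i q
  rw [VS_mem h, VS_mem h.symm]; tauto

lemma VS_eq {ι : Type*} {x1 x2 v : ℝ} {X : ι → Finset Pt} (h : x1 ≠ x2) (h1 : v ≠ x1) (h2 : v ≠ x2)
    (hv : ∀ i, ∀ q ∈ X i, q.1 ≠ v) :
    VM1 v x2 (VM1 x2 x1 (VM1 x1 v X)) = VS x1 x2 X := by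
  ext i q
  obtain ⟨a, b⟩ := q
  rw [VS_mem h]
  simp only [VM1_mem]
  have := hv i (v, b)
  constructor
  · rintro (⟨(⟨(⟨p1, p2⟩ | ⟨p1, p2⟩), p3⟩ | ⟨p1, (⟨p2, p3⟩ | ⟨p2, p3⟩)⟩), p4⟩ | ⟨p1, (⟨(⟨p2, p3⟩ | ⟨p2, p3⟩), p4⟩ | ⟨p2, p3⟩)⟩) <;> simp_all
  · rintro (⟨p1, p2, p3⟩ | ⟨p1, p2⟩ | ⟨p1, p2⟩)
    · have := hv i (a, b) p1; simp_all
    · simp_all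
    · simp_all [Ne.symm h, Ne.symm h1]

structure VGood {ι : Type*} (E : (ι → Finset Pt) → (ι → Finset Pt) → Prop) : Prop where
  tr : ∀ X Y Z, E X Y → E Y Z → E X Z
  mv : ∀ X x0 v, x0 ≠ v → (∀ i, ∀ q ∈ X i, q.1 ≠ v) →
      (∀ c, Bet x0 c v → NI (RW X x0) (RW X c)) → E X (VM1 x0 v X)
  cl : ∀ X x0 x1, x0 < x1 → (∀ i, ∀ q ∈ X i, q.1 ≠ x0 → x0 < q.1 ∧ q.1 < x1) → E X (VM1 x0 x1 X)
  cr : ∀ X x0 x1, x1 < x0 → (∀ i, ∀ q ∈ X i, q.1 ≠ x0 → x1 < q.1 ∧ q.1 < x0) → E X (VM1 x0 x1 X)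

lemma NI.symm {A B : Set ℝ} (h : NI A B) : NI B A :=
  ⟨fun a ha b hb => (h.1 b hb a ha).symm, fun a ha a' ha' b hb b' hb' => by
    have := h.2 b hb b' hb' a ha a' ha'; tauto⟩

lemma NI_empty' {B : Set ℝ} : NI ∅ B := NI_empty.symm

lemma VGood.swap {ι : Type*} [Fintype ι] {E : (ι → Finset Pt) → (ι → Finset Pt) → Prop} (g : VGood E)
    (X : ι → Finset Pt) (x1 x2 : ℝ) (h : x1 < x2) (hno : ∀ i, ∀ q ∈ X i, ¬ (x1 < q.1 ∧ q.1 < x2))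
    (hN : NI (RW X x1) (RW X x2)) : E X (VS x1 x2 X) := by
  obtain ⟨v, hv, hv'⟩ := exists_right (cols X) x2
  have fv : ∀ i, ∀ q ∈ X i, q.1 ≠ v := by
    intro i q hq he
    have := hv' q.1 (mem_cols.2 ⟨i, q, hq, rfl⟩) (by linarith)
    linarith
  have em : ∀ (Y : ι → Finset Pt) c, (∀ i, ∀ q ∈ Y i, q.1 ≠ c) → RW Y c = ∅ := by
    intro Y c hc
    ext y; simp only [RW, mem_setOf_eq, mem_empty_iff_false, iff_false]
    rintro ⟨i, hi⟩; exact hc i _ hi rfl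
  rw [← VS_eq h.ne (by linarith) hv.ne' fv]
  have m1 := g.mv X x1 v (by linarith) fv (fun c hc => by
    by_cases hc2 : c = x2
    · rw [hc2]; exact hN
    · rw [em X c]; · exact NI_empty
      rintro i q hq rfl
      have a1 := hno i q hq
      have a2 := hv' q.1 (mem_cols.2 ⟨i, q, hq, rfl⟩)
      rcases lt_or_gt_of_ne hc2 with h' | h' <;> rcases hc with hc | hc <;> first | linarith | (have := a2 h'; linarith) | exact a1 ⟨hc.1, h'⟩)
  have m2 := g.mv (VM1 x1 v X) x2 x1 h.ne' (fun i q hq he => by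
    rcases VM1_mem.1 hq with h | h
    · exact h.2 he
    · linarith [h.1]) (fun c hc => by
    rw [em _ c]; · exact NI_empty
    rintro i q hq rfl
    rcases VM1_mem.1 hq with h | h
    · have := hno i q h.1
      rcases hc with hc | hc
      · linarith
      · exact this hc
    · rcases hc with hc | hc <;> linarith [h.1])
  have m3 := g.mv (VM1 x2 x1 (VM1 x1 v X)) v x2 hv.ne' (fun i q hq he => by
    rcases VM1_mem.1 hq with h | h
    · exact h.2 he
    · linarith [h.1]) (fun c hc => by
    rw [em _ c]; · exact NI_empty
    rintro i q hq rfl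
    rcases VM1_mem.1 hq with h | h
    · rcases VM1_mem.1 h.1 with h | h
      · have := hv' q.1 (mem_cols.2 ⟨i, q, h.1, rfl⟩)
        rcases hc with hc | hc
        · linarith
        · have := this hc.1; linarith
      · rcases hc with hc | hc <;> linarith [h.1]
    · rcases hc with hc | hc <;> linarith [h.1])
  exact g.tr _ _ _ m1 (g.tr _ _ _ m2 m3)

lemma VM1_id {ι : Type*} {x0 v : ℝ} {X : ι → Finset Pt} (h : ∀ i, ∀ q ∈ X i, q.1 ≠ x0) : VM1 x0 v X = X := by
  ext i q
  rw [VM1_mem]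
  constructor
  · rintro (h' | h')
    · exact h'.1
    · exact absurd rfl (h i _ h'.2)
  · intro h'; exact .inl ⟨h', h i q h'⟩

lemma VGood.cyc {ι : Type*} {E : (ι → Finset Pt) → (ι → Finset Pt) → Prop} (g : VGood E)
    (X : ι → Finset Pt) (x0 x1 : ℝ) (h : x0 ≠ x1)
    (hX : ((∀ i, ∀ p ∈ X i, x0 ≤ p.1) ∧ ∀ i, ∀ p ∈ X i, p.1 ≠ x0 → p.1 < x1) ∨
      ((∀ i, ∀ p ∈ X i, p.1 ≤ x0) ∧ ∀ i, ∀ p ∈ X i, p.1 ≠ x0 → x1 < p.1)) : E X (VM1 x0 x1 X) := by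
  have one : (∀ i, ∀ p ∈ X i, p.1 = x0) → E X (VM1 x0 x1 X) := by
    intro hh
    refine g.mv X x0 x1 h (fun i q hq => (hh i q hq).trans_ne h) fun c hc => ?_
    have : RW X c = ∅ := by
      ext y; simp only [RW, mem_setOf_eq, mem_empty_iff_false, iff_false]
      rintro ⟨i, hi⟩
      have := hh i _ hi
      simp only at this
      rcases hc with hc | hc <;> linarith
    rw [this]; exact NI_empty
  rcases hX with ⟨a, b⟩ | ⟨a, b⟩
  · rcases lt_or_gt_of_ne h with h' | h'
    · exact g.cl X x0 x1 h' fun i q hq hn => ⟨lt_of_le_of_ne (a i q hq) hn.symm, b i q hq hn⟩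
    · refine one fun i p hp => ?_
      by_contra hn
      have := a i p hp
      have := b i p hp hn
      linarith
  · rcases lt_or_gt_of_ne h with h' | h'
    · refine one fun i p hp => ?_
      by_contra hn
      have := a i p hp
      have := b i p hp hn
      linarith
    · exact g.cr X x0 x1 h' fun i q hq hn => ⟨b i q hq hn, lt_of_le_of_ne (a i q hq) hn⟩

theorem CC (Z : Fin 4 → Finset Pt) (x0 x1 : ℝ) (h : x0 < x1)
    (hX : ∀ i, ∀ q ∈ Z i, q.1 ≠ x0 → x0 < q.1 ∧ q.1 < x1) : CopyEq Z (VM1 x0 x1 Z) := by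
  filter_upwards [sep_ev (insert x0 (insert x1 (coords Z)))] with δ hS
  set S := insert x0 (insert x1 (coords Z)) with hSd
  have hZ : coords Z ⊆ S := fun c hc => by simp [hSd, hc]
  have hx0 : x0 ∈ S := by simp [hSd]
  have hvS : x1 ∈ S := by simp [hSd]
  have hZ' := coords_VM1 (x0 := x0) hZ hvS
  refine TE_steps _ _ δ (-1) (.inr rfl) fun k => ?_
  rw [mix_step hS hZ hx0 hvS h.ne (.inr rfl)]
  have hd := hS.1
  refine TC _ _ _ (by linarith) ?_
  rintro ⟨j, k'⟩ p hp hp0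
  obtain ⟨q, hq, rfl⟩ := mem_mix.1 hp
  dsimp only at hq hp0 ⊢
  have l0 := hS.lt' hx0 hvS h
  by_cases hD : 0 < -1 * (e k' - e k)
  · rw [if_pos hD] at hq
    have hk : e k' * δ < e k * δ := by nlinarith
    rcases VM1_mem.1 hq with h' | h'
    · obtain ⟨a, b⟩ := hX _ _ h'.1 h'.2
      have := hS.lt' hx0 (hZ (c1 h'.1)) a k k'
      have := hS.lt' (hZ (c1 h'.1)) hvS b k' k
      constructor <;> linarith
    · rw [h'.1]
      have := l0 k k'
      constructor <;> linarith
  · rw [if_neg hD] at hq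
    by_cases h0 : q.1 = x0
    · rw [h0] at hp0 ⊢
      have hk : e k * δ ≤ e k' * δ := by nlinarith
      have : e k * δ ≠ e k' * δ := fun h => hp0 (by rw [h])
      have := lt_of_le_of_ne hk this
      have := l0 k' k
      constructor <;> linarith
    · obtain ⟨a, b⟩ := hX _ _ hq h0
      have := hS.lt' hx0 (hZ (c1 hq)) a k k'
      have := hS.lt' (hZ (c1 hq)) hvS b k' k
      constructor <;> linarith

theorem VGood_CopyEq : VGood CopyEq where
  tr := fun _ _ _ h h' => h.trans h'
  mv := CV
  cl := CC
  cr := fun X x0 x1 h hX => by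
    have hf : ∀ i, ∀ q ∈ X i, q.1 ≠ x1 := fun i q hq he => by
      by_cases h0 : q.1 = x0
      · linarith
      · have := hX i q hq h0; linarith
    have := CC (VM1 x0 x1 X) x1 x0 h (fun i q hq hn => by
      rcases VM1_mem.1 hq with h' | h'
      · exact hX i q h'.1 h'.2
      · exact absurd h'.1 hn)
    rw [VM1_comp hf, VM1_self] at this
    exact this.symm

def CW {ι : Type*} (X : ι → Finset Pt) (y : ℝ) : Set ℝ := {x | ∃ i, (x, y) ∈ X i}

lemma RW_trZ {ι : Type*} (X : ι → Finset Pt) (y : ℝ) : RW (trZ X) y = CW X y := by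
  ext x; simp [RW, CW, trZ, mem_trF]

lemma TE_HM {ι : Type*} [Fintype ι] (G G' : ι → Finset Pt) (y0 v : ℝ) (h0 : y0 ≠ v)
    (hv : ∀ i, ∀ q ∈ G i, q.2 ≠ v) (hn : ∀ c, Bet y0 c v → NI (CW G y0) (CW G c))
    (hG : ∀ i q, q ∈ G' i ↔ (q ∈ G i ∧ q.2 ≠ y0) ∨ (q.2 = v ∧ (q.1, y0) ∈ G i)) : TE G G' := by
  have := (TE_MP (trZ G) y0 v h0 (fun i q hq => hv i _ (mem_trF.1 hq))
    (fun c hc => by rw [RW_trZ, RW_trZ]; exact hn c hc)).tr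
  have e1 : (fun i => trF (trZ G i)) = G := trZ_trZ G
  have e2 : (fun i => trF (VM1 y0 v (trZ G) i)) = G' := by
    ext i q
    rw [hG, mem_trF, VM1_mem]
    simp [trZ, mem_trF]
  rwa [e1, e2] at this

lemma NI_out {A B : Set ℝ} {u v : ℝ} (hA : ∀ a ∈ A, a ∈ uIcc u v) (hB : ∀ b ∈ B, b ∉ uIcc u v) : NI A B := by
  have key : ∀ a ∈ A, ∀ a' ∈ A, ∀ b ∈ B, ¬ (a ≤ b ∧ b ≤ a') := by
    intro a ha a' ha' b hb h
    exact hB b hb (uIcc_subset_uIcc (hA a ha) (hA a' ha') (mem_uIcc.2 (.inl h)))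
  refine ⟨fun a ha b hb h => key a ha a ha b hb ⟨h.le, h.ge⟩, fun a ha a' ha' b hb b' hb' => ⟨fun h => ?_, fun h => ?_⟩⟩
  · exact key a ha a' ha' b hb ⟨h.1.le, h.2.1.le⟩
  · exact key a ha a' ha' b' hb' ⟨h.2.1.le, h.2.2.le⟩

def SM (Z : Fin 4 → Finset Pt) (j0 : Fin 4) (x y x' y' : ℝ) : Fin 4 → Finset Pt :=
  fun j => if j = j0 then stabSet x y x' y' (Z j) else Z j

lemma mem_stabSet {x y x' y' : ℝ} {C : Finset Pt} {q : Pt} : q ∈ stabSet x y x' y' C ↔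
    q = (x', y) ∨ q = (x, y') ∨ q = (x', y') ∨ (q ≠ (x, y) ∧ q ∈ C) := by simp [stabSet]

lemma mem_SM {Z : Fin 4 → Finset Pt} {j0 j : Fin 4} {x y x' y' : ℝ} {q : Pt} : q ∈ SM Z j0 x y x' y' j ↔
    (q ∈ Z j ∧ ¬ (j = j0 ∧ q = (x, y))) ∨ (j = j0 ∧ (q = (x', y) ∨ q = (x, y') ∨ q = (x', y'))) := by
  unfold SM; split_ifs with h
  · rw [mem_stabSet]; tauto
  · tauto

lemma coords_sub {Z : Fin 4 → Finset Pt} {S : Finset ℝ} (h : ∀ j, ∀ q ∈ Z j, q.1 ∈ S ∧ q.2 ∈ S) : coords Z ⊆ S := by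
  intro c hc
  rcases Finset.mem_union.1 hc with h' | h'
  · obtain ⟨j, q, hq, rfl⟩ := mem_cols.1 h'
    exact (h j q hq).1
  · obtain ⟨j, q, hq, rfl⟩ := mem_cols.1 h'
    exact (h j _ (mem_trF.1 hq)).2

lemma ek_cmp {k k' : Fin 3} {δ : ℝ} (hd : 0 < δ) (h : k' ≠ k) : e k' * δ + δ ≤ e k * δ ∨ e k * δ + δ ≤ e k' * δ := by
  rcases lt_trichotomy (e k') (e k) with h' | h' | h'
  · left; have := e_lt h'; nlinarith
  · exact absurd (e_inj h') h
  · right; have := e_lt h'; nlinarith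

structure StCond (Z : Fin 4 → Finset Pt) (j0 : Fin 4) (x y x' y' : ℝ) : Prop where
  mem : (x, y) ∈ Z j0
  ux : ∀ j, j ≠ j0 → (x, y) ∉ Z j
  hx : x ≠ x'
  hy : y ≠ y'
  fx : ∀ j, ∀ q ∈ Z j, q.1 ≠ x'
  fy : ∀ j, ∀ q ∈ Z j, q.2 ≠ y'
  bx : ∀ j, ∀ q ∈ Z j, ¬ Bet x q.1 x'
  by' : ∀ j, ∀ q ∈ Z j, ¬ Bet y q.2 y'
  ty : 0 < (x - x') * (y - y')

theorem CSt (Z : Fin 4 → Finset Pt) (j0 : Fin 4) (x y x' y' : ℝ) (H : StCond Z j0 x y x' y') :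
    CopyEq Z (SM Z j0 x y x' y') := by
  obtain ⟨hm, hu, hx, hy, fx, fy, bx, by', hty⟩ := H
  filter_upwards [sep_ev (insert x' (insert y' (coords Z)))] with δ hS
  set S := insert x' (insert y' (coords Z)) with hSd
  set Z' := SM Z j0 x y x' y' with hZd
  have hZ : coords Z ⊆ S := fun c hc => by simp [hSd, hc]
  have xS : x ∈ S := hZ (c1 hm)
  have yS : y ∈ S := hZ (c2 hm)
  have x'S : x' ∈ S := by simp [hSd]
  have y'S : y' ∈ S := by simp [hSd]
  have hZ' : coords Z' ⊆ S := coords_sub fun j q hq => by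
    rcases mem_SM.1 hq with h | ⟨-, h⟩
    · exact ⟨hZ (c1 h.1), hZ (c2 h.1)⟩
    · rcases h with rfl | rfl | rfl <;> simp [xS, yS, x'S, y'S]
  have hd := hS.1
  obtain ⟨σ, hσ, sy, sx⟩ : ∃ σ : ℝ, (σ = 1 ∨ σ = -1) ∧ 0 < σ * (y' - y) ∧ 0 < σ * (x' - x) := by
    rcases lt_or_gt_of_ne hy with h | h
    · exact ⟨1, .inl rfl, by linarith, by nlinarith⟩
    · exact ⟨-1, .inr rfl, by linarith, by nlinarith⟩
  refine TE_steps _ _ δ σ hσ fun k => ?_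
  set F := mix Z Z' δ (fun k' => 0 < σ * (e k' - e k)) with hF
  set F' := mix Z Z' δ (fun k' => 0 ≤ σ * (e k' - e k)) with hF'
  have kk : ¬ 0 < σ * (e k - e k) := by simp
  set B : Lb → Finset Pt := fun i => if i = (j0, k) then (F i).erase (x + e k * δ, y + e k * δ) else F i with hB
  set w := y + e k * δ + σ * (δ / 2) with hw
  set G : Lb → Finset Pt := fun i => if i = (j0, k) then
    B i ∪ {(x' + e k * δ, y + e k * δ), (x + e k * δ, w), (x' + e k * δ, w)} else B i with hG
  have mF : ∀ j k' p, p ∈ F (j, k') ↔ ∃ q ∈ (if 0 < σ * (e k' - e k) then Z' j else Z j),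
      p = (q.1 + e k' * δ, q.2 + e k' * δ) := fun j k' p => mem_mix
  have BF : ∀ i, B i ⊆ F i := by
    intro i; simp only [hB]; split_ifs
    · exact Finset.erase_subset _ _
    · exact subset_rfl
  have wy : w ≠ y + e k * δ := by rcases hσ with rfl | rfl <;> simp only [hw] <;> intro h <;> linarith
  -- rows of F near
  have near : ∀ i, ∀ p ∈ F i, p.2 ∈ uIcc (y + e k * δ) w → p.2 = y + e k * δ := by
    rintro ⟨j, k'⟩ p hp hpy
    obtain ⟨q, hq, rfl⟩ := (mF _ _ _).1 hp
    have hqS := (mixS hZ hZ' hq).2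
    have hb : |q.2 + e k' * δ - (y + e k * δ)| ≤ δ / 2 := by
      rw [abs_le]
      rw [mem_uIcc, hw] at hpy
      rcases hσ with rfl | rfl <;> rcases hpy with h | h <;> constructor <;> linarith [h.1, h.2]
    rw [abs_le] at hb
    by_cases h1 : q.2 = y
    · by_cases h2 : k' = k
      · simp [h1, h2]
      · exfalso
        rw [h1] at hb
        rcases ek_cmp hd h2 with h | h <;> linarith [hb.1, hb.2]
    · exfalso
      rcases lt_or_gt_of_ne h1 with h | h
      · have := hS.lt' hqS yS h k' k; linarith [hb.1, hb.2]
      · have := hS.lt' yS hqS h k k'; linarith [hb.1, hb.2]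
  have fX' : ∀ i, ∀ p ∈ F i, p.1 ≠ x' + e k * δ := by
    rintro ⟨j, k'⟩ p hp hpy
    obtain ⟨q, hq, rfl⟩ := (mF _ _ _).1 hp
    obtain ⟨h1, rfl⟩ := hS.eq (mixS hZ hZ' hq).1 x'S hpy
    rw [if_neg kk] at hq
    exact fx _ _ hq h1
  have fY' : ∀ i, ∀ p ∈ F i, p.2 ≠ y' + e k * δ := by
    rintro ⟨j, k'⟩ p hp hpy
    obtain ⟨q, hq, rfl⟩ := (mF _ _ _).1 hp
    obtain ⟨h1, rfl⟩ := hS.eq (mixS hZ hZ' hq).2 y'S hpy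
    rw [if_neg kk] at hq
    exact fy _ _ hq h1
  have mB : ∀ i q, q ∈ F i ↔ q ∈ B i ∨ (i = (j0, k) ∧ q = (x + e k * δ, y + e k * δ)) := by
    intro i q
    simp only [hB]
    split_ifs with h
    · subst h
      have : ((x + e k * δ, y + e k * δ) : Pt) ∈ F (j0, k) :=
        (mF _ _ _).2 ⟨(x, y), by rw [if_neg kk]; exact hm, rfl⟩
      rw [Finset.mem_erase]
      constructor
      · intro h; by_cases hh : q = (x + e k * δ, y + e k * δ) <;> simp [h, hh]
      · rintro (h | h); exacts [h.2, h.2 ▸ this]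
    · simp [h]
  have mG : ∀ i q, q ∈ G i ↔ q ∈ B i ∨ (i = (j0, k) ∧
      (q = (x' + e k * δ, y + e k * δ) ∨ q = (x + e k * δ, w) ∨ q = (x' + e k * δ, w))) := by
    intro i q
    by_cases h : i = (j0, k)
    · simp only [hG, if_pos h, Finset.mem_union, Finset.mem_insert, Finset.mem_singleton, and_iff_right h]
    · simp only [hG, if_neg h, h, false_and, or_false]
  have nB : ∀ i, ∀ q ∈ B i, q ≠ (x + e k * δ, y + e k * δ) := by
    rintro i q hq rfl
    by_cases h : i = (j0, k)
    · simp [hB, h] at hq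
    · simp only [hB, if_neg h] at hq
      obtain ⟨j, k'⟩ := i
      obtain ⟨q, hq, he⟩ := (mF _ _ _).1 hq
      obtain ⟨h1, rfl⟩ := hS.eq xS (mixS hZ hZ' hq).1 (Prod.ext_iff.1 he).1
      obtain ⟨h2, -⟩ := hS.eq yS (mixS hZ hZ' hq).2 (Prod.ext_iff.1 he).2
      rw [if_neg kk] at hq
      have : q = (x, y) := by ext; exacts [h1.symm, h2.symm]
      subst this
      exact hu j (fun hj => h (by rw [hj])) hq
  have s1 : TE F G := TSt B F G (fun i => i = (j0, k)) _ _ _ _ (by simpa using hx) wy.symm nB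
    (fun i q hq => fX' i q (BF i hq)) (fun i q hq => near i q (BF i hq)) mB mG
  refine s1.trans (TE_HM G F' w (y' + e k * δ) ?_ ?_ ?_ ?_)
  · intro h
    rcases hσ with rfl | rfl
    · have := hS.lt' yS y'S (by linarith) k k; linarith
    · have := hS.lt' y'S yS (by linarith) k k; linarith
  · intro i q hq
    rcases (mG i q).1 hq with h | ⟨-, h⟩
    · exact fY' i q (BF i h)
    · have a1 : y + e k * δ ≠ y' + e k * δ := by simpa using hy
      have a2 : w ≠ y' + e k * δ := by
        intro h
        rcases hσ with rfl | rfl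
        · have := hS.lt' yS y'S (by linarith) k k; linarith
        · have := hS.lt' y'S yS (by linarith) k k; linarith
      rcases h with rfl | rfl | rfl
      exacts [a1, a2, a2]
  · intro c hc
    refine NI_out (u := x + e k * δ) (v := x' + e k * δ) ?_ ?_
    · rintro a ⟨i, hi⟩
      rcases (mG i _).1 hi with h | ⟨-, h⟩
      · exact absurd (near i _ (BF i h) right_mem_uIcc) wy
      · simp only [Prod.mk.injEq] at h
        rcases h with h | h | h
        · exact h.1 ▸ right_mem_uIcc
        · exact h.1 ▸ left_mem_uIcc
        · exact h.1 ▸ right_mem_uIcc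
    · rintro b ⟨i, hi⟩
      have hcy : 0 < σ * (c - (y + e k * δ)) := by
        rcases hσ with rfl | rfl
        · have := hS.lt' yS y'S (by linarith) k k
          rcases hc with h | h <;> linarith
        · have := hS.lt' y'S yS (by linarith) k k
          rcases hc with h | h <;> linarith
      have hcy' : σ * (c - (y' + e k * δ)) < 0 := by
        rcases hσ with rfl | rfl
        · have := hS.lt' yS y'S (by linarith) k k
          rcases hc with h | h <;> linarith
        · have := hS.lt' y'S yS (by linarith) k k
          rcases hc with h | h <;> linarith
      rcases (mG i _).1 hi with h | ⟨-, h⟩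
      · obtain ⟨j, k'⟩ := i
        obtain ⟨q, hq, he⟩ := (mF _ _ _).1 (BF _ h)
        obtain ⟨rfl, rfl⟩ := Prod.ext_iff.1 he
        have hqS := mixS hZ hZ' hq
        dsimp only at hcy hcy' hc ⊢
        -- the row of q is y
        have qy : q.2 = y := by
          by_contra hne
          by_cases hq' : q.2 = y'
          · have hD : 0 < σ * (e k' - e k) := by
              by_contra hD
              rw [if_neg hD] at hq
              exact fy _ _ hq hq'
            rw [hq'] at hcy'
            rcases hσ with rfl | rfl <;> nlinarith
          have nb : ¬ Bet y q.2 y' := by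
            split_ifs at hq
            · rcases mem_SM.1 hq with h | ⟨-, h⟩
              · exact by' _ _ h.1
              · rcases h with rfl | rfl | rfl <;> simp at hne hq'
            · exact by' _ _ hq
          rw [← hS.bet yS hqS.2 y'S (Ne.symm hne) hq' (k := k) (k' := k') (k'' := k)] at nb
          apply nb
          rcases hσ with rfl | rfl
          · left; constructor <;> linarith
          · right; constructor <;> linarith
        rw [qy] at hcy
        have hD : 0 < σ * (e k' - e k) := by
          rcases hσ with rfl | rfl <;> nlinarith
        rw [if_pos hD] at hq
        have hD' : 0 < σ * (e k' * δ - e k * δ) := by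
          have := mul_pos hD hd; linarith
        rcases mem_SM.1 hq with h | ⟨-, h⟩
        · have q1 : q.1 ≠ x := by
            intro hqx
            have hqq : q = (x, y) := by ext; exacts [hqx, qy]
            by_cases hj : j = j0
            · exact h.2 ⟨hj, hqq⟩
            · exact hu j hj (hqq ▸ h.1)
          have nb := bx _ _ h.1
          have q2 := fx _ _ h.1
          rw [← hS.bet xS hqS.1 x'S (Ne.symm q1) q2 (k := k) (k' := k') (k'' := k)] at nb
          have n1 : q.1 + e k' * δ ≠ x + e k * δ := fun h => q1 (hS.eq hqS.1 xS h).1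
          have n2 : q.1 + e k' * δ ≠ x' + e k * δ := fun h => q2 (hS.eq hqS.1 x'S h).1
          intro hin
          apply nb
          rcases mem_uIcc.1 hin with h | h
          · exact .inl ⟨lt_of_le_of_ne h.1 n1.symm, lt_of_le_of_ne h.2 n2⟩
          · exact .inr ⟨lt_of_le_of_ne h.1 n2.symm, lt_of_le_of_ne h.2 n1⟩
        · have q1 : q.1 = x' := by
            rcases h with rfl | rfl | rfl
            · rfl
            · exact absurd qy hy.symm
            · rfl
          rw [q1]
          rw [mem_uIcc]
          rcases hσ with rfl | rfl
          · rintro (h | h) <;> linarith [h.1, h.2]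
          · rintro (h | h) <;> linarith [h.1, h.2]
      · exfalso
        simp only [Prod.mk.injEq] at h
        have cy : c ≠ y + e k * δ := by rintro rfl; simp at hcy
        have cw : c ≠ w := by rintro rfl; rcases hc with h | h <;> linarith [h.1, h.2]
        rcases h with h | h | h
        · exact cy h.2
        · exact cw h.2
        · exact cw h.2
  · -- membership
    rintro ⟨j, k'⟩ q
    rw [mG]
    have hlt : ∀ k', k' ≠ k → ((0 ≤ σ * (e k' - e k)) ↔ (0 < σ * (e k' - e k))) := by
      intro k' hk
      have : σ * (e k' - e k) ≠ 0 := by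
        refine mul_ne_zero ?_ (sub_ne_zero.2 fun h => hk (e_inj h))
        rcases hσ with rfl | rfl <;> norm_num
      exact ⟨fun h => lt_of_le_of_ne h this.symm, le_of_lt⟩
    have Bw : ∀ i z, (z, w) ∉ B i := fun i z h => wy (near i _ (BF i h) right_mem_uIcc)
    by_cases hi : (j, k') = (j0, k)
    · obtain ⟨rfl, rfl⟩ := Prod.ext_iff.1 hi
      simp only [mG, Bw, false_or, hi, true_and]
      have mF' : q ∈ F' (j, k') ↔ (q.1 - e k' * δ, q.2 - e k' * δ) ∈ Z' j := by
        simp [hF', mix, mem_shiftD]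
      have mB' : q ∈ B (j, k') ↔ (q.1 - e k' * δ, q.2 - e k' * δ) ∈ Z j ∧ q ≠ (x + e k' * δ, y + e k' * δ) := by
        simp [hB, hF, mix, mem_shiftD, and_comm]
      rw [mF', mB', hZd, mem_SM]
      obtain ⟨q1, q2⟩ := q
      have wy' := wy.symm
      simp only [Prod.mk.injEq, sub_eq_iff_eq_add, true_and, ne_eq]
      constructor
      · rintro (⟨h1, h2⟩ | h | h | h)
        · refine .inl ⟨.inl ⟨h1, h2⟩, ?_⟩
          rintro rfl
          refine Bw (j, k') q1 ?_
          simp only [hB, if_true, Finset.mem_erase, hF, mix, mem_shiftD, if_neg kk]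
          refine ⟨fun h => wy (Prod.ext_iff.1 h).2, h1⟩
        · exact .inl ⟨.inr (.inl h), fun hh => wy' (by rw [← hh, h.2])⟩
        · right; refine ⟨h.2, ?_⟩; simp [h.1]
        · right; refine ⟨h.2, ?_⟩; simp [h.1]
      · rintro (⟨h1 | h1 | h1 | h1, h2⟩ | ⟨h1, h2 | h2 | h2⟩)
        · exact .inl h1
        · exact .inr (.inl h1)
        · exact absurd h1.2 h2
        · exact absurd h1.2 h2
        · exact absurd h2.2 wy
        · exact .inr (.inr (.inl ⟨h2.1, h1⟩))
        · exact .inr (.inr (.inr ⟨h2.1, h1⟩))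
    · have e1 : q ∈ F' (j, k') ↔ q ∈ F (j, k') := by
        rw [hF', hF, mem_mix, mem_mix]
        by_cases hk : k' = k
        · subst hk
          have hj : j ≠ j0 := fun h => hi (by rw [h])
          simp [hZd, SM, hj]
        · simp only [hlt k' hk]
      rw [e1, mB]
      have Bw' := Bw (j, k') q.1
      simp only [hi, false_and, or_false, mG, Bw', and_false]
      constructor
      · intro h
        refine ⟨h, fun hh => Bw (j, k') q.1 (by rw [← hh]; exact h)⟩
      · exact fun h => h.1

structure ESC (B Z Z' : Fin 4 → Finset Pt) (jn jk jl : Fin 4) (xn xk xl y0 y1 q : ℝ) : Prop where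
  nk : jn ≠ jk
  nl : jn ≠ jl
  kl : jk ≠ jl
  B1 : ∀ j, ∀ p ∈ B j, p.1 ≠ xk
  B2 : ∀ j, ∀ p ∈ B j, p.2 ≠ y0
  B3 : ∀ j, ∀ p ∈ B j, p.2 ≠ y1
  B4 : ∀ j, ∀ p ∈ B j, ¬ Bet y0 p.2 y1
  q0 : q ≠ y0
  q1 : q ≠ y1
  qb : ¬ Bet y0 q y1
  od : (y0 < y1 ∧ ((xn < xk ∧ xk < xl) ∨ (xl < xn ∧ xn < xk) ∨ (xk < xl ∧ xl < xn))) ∨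
    (y1 < y0 ∧ ((xn < xl ∧ xl < xk) ∨ (xk < xn ∧ xn < xl) ∨ (xl < xk ∧ xk < xn)))
  hZ : ∀ j p, p ∈ Z j ↔ p ∈ B j ∨ (j = jn ∧ p = (xn, y0)) ∨ (j = jl ∧ p = (xl, y0)) ∨
      (j = jk ∧ (p = (xk, y0) ∨ p = (xk, q)))
  hZ' : ∀ j p, p ∈ Z' j ↔ p ∈ B j ∨ (j = jn ∧ (p = (xn, y1) ∨ p = (xk, y1))) ∨
      (j = jl ∧ (p = (xl, y0) ∨ p = (xk, y0))) ∨ (j = jk ∧ p = (xk, q))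

lemma mem_ite_emp {P : Prop} [Decidable P] {A : Finset Pt} {p : Pt} : p ∈ (if P then A else ∅) ↔ P ∧ p ∈ A := by
  split_ifs with h <;> simp [h]

lemma sub_pt {p : Pt} {a b t : ℝ} : ((p.1 - t, p.2 - t) : Pt) = (a, b) ↔ p = (a + t, b + t) := by
  obtain ⟨p1, p2⟩ := p
  simp [sub_eq_iff_eq_add]

theorem CES {B Z Z' : Fin 4 → Finset Pt} {jn jk jl : Fin 4} {xn xk xl y0 y1 q : ℝ}
    (H : ESC B Z Z' jn jk jl xn xk xl y0 y1 q) : CopyEq Z Z' := by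
  obtain ⟨jnk, jnl, jkl, B1, B2, B3, B4, q0, q1, qb, od, mZ, mZ'⟩ := H
  filter_upwards [sep_ev (insert y1 (coords Z))] with δ hS
  set S := insert y1 (coords Z) with hSd
  have hZ : coords Z ⊆ S := fun c hc => by simp [hSd, hc]
  have nS : (xn, y0) ∈ Z jn := (mZ _ _).2 (by simp)
  have lS : (xl, y0) ∈ Z jl := (mZ _ _).2 (by simp)
  have kS : (xk, y0) ∈ Z jk := (mZ _ _).2 (by simp)
  have qS' : (xk, q) ∈ Z jk := (mZ _ _).2 (by simp)
  have xnS : xn ∈ S := hZ (c1 nS)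
  have xlS : xl ∈ S := hZ (c1 lS)
  have xkS : xk ∈ S := hZ (c1 kS)
  have y0S : y0 ∈ S := hZ (c2 kS)
  have qS : q ∈ S := hZ (c2 qS')
  have y1S : y1 ∈ S := by simp [hSd]
  have BS : ∀ j, ∀ p ∈ B j, p.1 ∈ S ∧ p.2 ∈ S := fun j p hp =>
    ⟨hZ (c1 ((mZ j p).2 (.inl hp))), hZ (c2 ((mZ j p).2 (.inl hp)))⟩
  have hZ' : coords Z' ⊆ S := coords_sub fun j p hp => by
    rcases (mZ' j p).1 hp with h | ⟨-, rfl | rfl⟩ | ⟨-, rfl | rfl⟩ | ⟨-, rfl⟩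
    · exact BS j p h
    all_goals (refine ⟨?_, ?_⟩ <;> assumption)
  have hd := hS.1
  have y01 : y0 ≠ y1 := by rcases od with h | h; exacts [h.1.ne, h.1.ne']
  have xnk : xn ≠ xk := by rintro rfl; rcases od with ⟨-, h | h | h⟩ | ⟨-, h | h | h⟩ <;> linarith [h.1, h.2]
  have xnl : xn ≠ xl := by rintro rfl; rcases od with ⟨-, h | h | h⟩ | ⟨-, h | h | h⟩ <;> linarith [h.1, h.2]
  have xkl : xk ≠ xl := by rintro rfl; rcases od with ⟨-, h | h | h⟩ | ⟨-, h | h | h⟩ <;> linarith [h.1, h.2]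
  obtain ⟨σ, hσ, sy, od'⟩ : ∃ σ : ℝ, (σ = 1 ∨ σ = -1) ∧ 0 < σ * (y1 - y0) ∧
      ((σ = 1 ∧ ((xn < xk ∧ xk < xl) ∨ (xl < xn ∧ xn < xk) ∨ (xk < xl ∧ xl < xn))) ∨
        (σ = -1 ∧ ((xn < xl ∧ xl < xk) ∨ (xk < xn ∧ xn < xl) ∨ (xl < xk ∧ xk < xn)))) := by
    rcases od with h | h
    · exact ⟨1, .inl rfl, by linarith, .inl ⟨rfl, h.2⟩⟩
    · exact ⟨-1, .inr rfl, by linarith, .inr ⟨rfl, h.2⟩⟩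
  refine TE_steps _ _ δ σ hσ fun k => ?_
  set F := mix Z Z' δ (fun k' => 0 < σ * (e k' - e k)) with hF
  set F' := mix Z Z' δ (fun k' => 0 ≤ σ * (e k' - e k)) with hF'
  have kk : ¬ 0 < σ * (e k - e k) := by simp
  set t := e k * δ with ht
  set w := y0 + t + σ * (δ / 2) with hw
  set C : Lb → Finset Pt := fun i => if i.2 = k then shiftD t (B i.1) else F i with hC
  set G : Lb → Finset Pt := fun i => C i ∪ ((if i = (jn, k) then {(xn + t, w), (xk + t, w)} else ∅) ∪
    ((if i = (jl, k) then {(xl + t, y0 + t), (xk + t, y0 + t)} else ∅) ∪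
      (if i = (jk, k) then {(xk + t, q + t)} else ∅))) with hG
  have mF : ∀ j k' p, p ∈ F (j, k') ↔ ∃ q ∈ (if 0 < σ * (e k' - e k) then Z' j else Z j),
      p = (q.1 + e k' * δ, q.2 + e k' * δ) := fun j k' p => mem_mix
  have mG : ∀ i p, p ∈ G i ↔ p ∈ C i ∨ (i = (jn, k) ∧ (p = (xn + t, w) ∨ p = (xk + t, w))) ∨
      (i = (jl, k) ∧ (p = (xl + t, y0 + t) ∨ p = (xk + t, y0 + t))) ∨ (i = (jk, k) ∧ p = (xk + t, q + t)) := by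
    intro i p
    simp only [hG, Finset.mem_union, mem_ite_emp, Finset.mem_insert, Finset.mem_singleton]
  have mF2 : ∀ i p, p ∈ F i ↔ p ∈ C i ∨ (i = (jn, k) ∧ p = (xn + t, y0 + t)) ∨ (i = (jl, k) ∧ p = (xl + t, y0 + t)) ∨
      (i = (jk, k) ∧ (p = (xk + t, y0 + t) ∨ p = (xk + t, q + t))) := by
    rintro ⟨j, k'⟩ p
    by_cases hk : k' = k
    · subst hk
      have : p ∈ F (j, k') ↔ (p.1 - t, p.2 - t) ∈ Z j := by
        simp [hF, mix, mem_shiftD, ht]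
      have lab : ∀ j' : Fin 4, ((j, k') = (j', k')) ↔ j = j' := fun j' => by simp
      rw [this, mZ]
      simp only [sub_pt, lab, hC, mem_shiftD, if_true]
    · simp [hC, hk]
  -- decomposition of elements of C
  have cC : ∀ i, ∀ p ∈ C i, ∃ j k' r, r.1 ∈ S ∧ r.2 ∈ S ∧ p = (r.1 + e k' * δ, r.2 + e k' * δ) ∧
      ((k' = k ∧ r ∈ B j) ∨ (k' ≠ k ∧ r ∈ (if 0 < σ * (e k' - e k) then Z' j else Z j))) := by
    rintro ⟨j, k'⟩ p hp
    by_cases hk : k' = k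
    · simp only [hC, hk, if_true, mem_shiftD] at hp
      exact ⟨j, k, _, (BS _ _ hp).1, (BS _ _ hp).2, by simp [ht], .inl ⟨rfl, hp⟩⟩
    · simp only [hC, hk, if_false] at hp
      obtain ⟨r, hr, he⟩ := (mF _ _ _).1 hp
      exact ⟨j, k', r, (mixS hZ hZ' hr).1, (mixS hZ hZ' hr).2, he, .inr ⟨hk, hr⟩⟩
  have apart : ∀ a ∈ S, ∀ b ∈ S, ∀ k', (k' = k → a ≠ b) → δ ≤ |a + e k' * δ - (b + t)| := by
    intro a ha b hb k' hk
    by_cases hab : a = b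
    · rw [hab]
      have : k' ≠ k := fun h => hk h hab
      rcases ek_cmp hd this with h | h
      · exact le_abs.2 (.inr (by linarith))
      · exact le_abs.2 (.inl (by linarith))
    · rcases lt_or_gt_of_ne hab with h | h
      · have := hS.lt' ha hb h k' k
        exact le_abs.2 (.inr (by linarith))
      · have := hS.lt' hb ha h k k'
        exact le_abs.2 (.inl (by linarith))
  have nin : ∀ z b s : ℝ, (s = 1 ∨ s = -1) → δ ≤ |z - b| → z ∉ uIcc b (b + s * (δ / 2)) := by
    intro z b s hs h hz
    rw [mem_uIcc] at hz
    have : |z - b| ≤ δ / 2 := by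
      rw [abs_le]
      rcases hs with rfl | rfl <;> rcases hz with h | h <;> constructor <;> linarith [h.1, h.2]
    linarith
  obtain ⟨s, hs, hs'⟩ : ∃ s : ℝ, (s = 1 ∨ s = -1) ∧ 0 < s * (xl - xk) := by
    rcases lt_or_gt_of_ne xkl with h | h
    · exact ⟨1, .inl rfl, by linarith⟩
    · exact ⟨-1, .inr rfl, by linarith⟩
  have wy : w ≠ y0 + t := by rcases hσ with rfl | rfl <;> simp only [hw] <;> intro h <;> linarith
  have wy1 : w ≠ y1 + t := by
    intro h
    rcases hσ with rfl | rfl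
    · have := hS.lt' y0S y1S (by linarith) k k; linarith
    · have := hS.lt' y1S y0S (by linarith) k k; linarith
  have kb : ∀ a ∈ S, ∀ b ∈ S, a ≠ b → δ ≤ |a + t - (b + t)| := fun a ha b hb h => apart a ha b hb k (fun _ => h)
  have C0 : ∀ i, ∀ p ∈ C i, p.2 ∉ uIcc (y0 + t) w := by
    intro i p hp
    obtain ⟨j, k', r, r1, r2, rfl, h⟩ := cC i p hp
    refine nin _ _ _ hσ (apart _ r2 _ y0S k' ?_)
    rcases h with h | h
    · exact fun _ => B2 _ _ h.2
    · exact fun h' => absurd h' h.1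
  have s1 : TE F G := by
    refine TEs C F G (fun i => i = (jn, k)) (fun i => i = (jk, k)) (fun i => i = (jl, k)) (xn + t) (xk + t) (xl + t)
      (y0 + t) w (q + t) (xk + t + s * (δ / 2)) wy.symm ?_ ?_ ?_ ?_ ?_ C0 mF2 mG
    · exact nin _ _ _ hσ (kb _ qS _ y0S q0)
    · exact nin _ _ _ hs (kb _ xnS _ xkS xnk)
    · simpa using xnl
    · rcases hs with rfl | rfl
      · have := hS.lt' xkS xlS (by linarith) k k
        left; constructor <;> linarith
      · have := hS.lt' xlS xkS (by linarith) k k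
        right; constructor <;> linarith
    · intro i p hp
      obtain ⟨j, k', r, r1, r2, rfl, h⟩ := cC i p hp
      refine nin _ _ _ hs (apart _ r1 _ xkS k' ?_)
      rcases h with h | h
      · exact fun _ => B1 _ _ h.2
      · exact fun h' => absurd h' h.1
  refine s1.trans (TE_HM G F' w (y1 + t) wy1 ?_ ?_ ?_)
  · intro i p hp
    rcases (mG i p).1 hp with g | ⟨-, rfl | rfl⟩ | ⟨-, rfl | rfl⟩ | ⟨-, rfl⟩
    · obtain ⟨j, k', r, r1, r2, rfl, h⟩ := cC i p g
      intro he
      obtain ⟨h1, rfl⟩ := hS.eq r2 y1S he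
      rcases h with h | h
      · exact B3 _ _ h.2 h1
      · exact h.1 rfl
    · exact wy1
    · exact wy1
    · simpa using y01
    · simpa using y01
    · simpa using q1
  · intro c hc
    have hcy : 0 < σ * (c - (y0 + t)) := by
      rcases hσ with rfl | rfl
      · have := hS.lt' y0S y1S (by linarith) k k
        rcases hc with h | h <;> linarith
      · have := hS.lt' y1S y0S (by linarith) k k
        rcases hc with h | h <;> linarith
    have hcy' : σ * (c - (y1 + t)) < 0 := by
      rcases hσ with rfl | rfl
      · have := hS.lt' y0S y1S (by linarith) k k
        rcases hc with h | h <;> linarith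
      · have := hS.lt' y1S y0S (by linarith) k k
        rcases hc with h | h <;> linarith
    have hcb : Bet (y0 + t) c (y1 + t) := by
      rcases hσ with rfl | rfl
      · left; constructor <;> linarith
      · right; constructor <;> linarith
    have cw : c ≠ w := by rintro rfl; rcases hc with h | h <;> linarith [h.1, h.2]
    have cy : c ≠ y0 + t := by rintro rfl; simp at hcy
    have cA : ∀ a ∈ CW G w, a = xn + t ∨ a = xk + t := by
      rintro a ⟨i, hi⟩
      rcases (mG i _).1 hi with h | ⟨-, h⟩ | ⟨-, h⟩ | ⟨-, h⟩
      · exact absurd right_mem_uIcc (C0 i _ h)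
      · simpa using h
      · simp [wy] at h
      · exfalso
        simp only [Prod.mk.injEq] at h
        have := nin _ _ _ hσ (kb _ qS _ y0S q0)
        rw [← h.2, ← hw] at this
        exact this right_mem_uIcc
    have cB : ∀ b ∈ CW G c, ∃ k', 0 < σ * (e k' * δ - t) ∧ c = y0 + e k' * δ ∧ (b = xl + e k' * δ ∨ b = xk + e k' * δ) := by
      rintro b ⟨i, hi⟩
      rcases (mG i _).1 hi with g | ⟨-, h⟩ | ⟨-, h⟩ | ⟨-, h⟩
      · obtain ⟨j, k', r, r1, r2, he, h⟩ := cC i _ g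
        obtain ⟨rfl, rfl⟩ := Prod.ext_iff.1 he
        dsimp only at *
        have ry : r.2 = y0 := by
          by_contra hne
          by_cases hr1 : r.2 = y1
          · rcases h with h | h
            · exact B3 _ _ h.2 hr1
            have hD : 0 < σ * (e k' - e k) := by
              by_contra hD
              rw [if_neg hD] at h
              rcases (mZ _ _).1 h.2 with h | ⟨-, h⟩ | ⟨-, h⟩ | ⟨-, h | h⟩
              · exact B3 _ _ h hr1
              · exact hne (by rw [h])
              · exact hne (by rw [h])
              · exact hne (by rw [h])
              · exact q1 (by rw [← hr1, h])
            rw [hr1] at hcy'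
            have := mul_pos hD hd
            rw [ht] at hcy'
            linarith
          have nb : ¬ Bet y0 r.2 y1 := by
            rcases h with h | ⟨-, h⟩
            · exact B4 _ _ h.2
            split_ifs at h
            · rcases (mZ' _ _).1 h with h | ⟨-, rfl | rfl⟩ | ⟨-, rfl | rfl⟩ | ⟨-, rfl⟩
              · exact B4 _ _ h
              · simp at hr1
              · simp at hr1
              · simp at hne
              · simp at hne
              · exact qb
            · rcases (mZ _ _).1 h with h | ⟨-, rfl⟩ | ⟨-, rfl⟩ | ⟨-, rfl | rfl⟩
              · exact B4 _ _ h
              · simp at hne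
              · simp at hne
              · simp at hne
              · exact qb
          rw [← hS.bet y0S r2 y1S (Ne.symm hne) hr1 (k := k) (k' := k') (k'' := k)] at nb
          exact nb hcb
        rw [ry] at hcy
        have hD' : 0 < σ * (e k' * δ - t) := by linarith
        refine ⟨k', hD', by rw [ry], ?_⟩
        have hD : 0 < σ * (e k' - e k) := by
          have : 0 < (σ * (e k' - e k)) * δ := by rw [ht] at hD'; linarith
          exact pos_of_mul_pos_left this hd.le
        rcases h with h | ⟨-, h⟩
        · exact absurd ry (B2 _ _ h.2)
        rw [if_pos hD] at h
        rcases (mZ' _ _).1 h with h | ⟨-, rfl | rfl⟩ | ⟨-, rfl | rfl⟩ | ⟨-, rfl⟩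
        · exact absurd ry (B2 _ _ h)
        · exact absurd ry y01.symm
        · exact absurd ry y01.symm
        · exact .inl rfl
        · exact .inr rfl
        · exact absurd ry q0
      · simp [cw] at h
      · simp [cy] at h
      · exfalso
        simp only [Prod.mk.injEq] at h
        apply qb
        rw [h.2] at hcb
        rcases hcb with h | h
        · left; constructor <;> linarith [h.1, h.2]
        · right; constructor <;> linarith [h.1, h.2]
    by_cases hE : CW G c = ∅
    · rw [hE]; exact NI_empty
    obtain ⟨b, hb⟩ := nonempty_iff_ne_empty.2 hE
    obtain ⟨k', hk1, hk2, -⟩ := cB b hb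
    have cB' : ∀ b ∈ CW G c, b = xl + e k' * δ ∨ b = xk + e k' * δ := by
      intro b hb
      obtain ⟨k'', -, h2, h3⟩ := cB b hb
      obtain ⟨-, rfl⟩ := hS.eq y0S y0S (hk2.symm.trans h2)
      exact h3
    have ee := e_mul (k := k) hd
    have ee' := e_mul (k := k') hd
    rw [← ht] at ee
    have l1 := fun h : xn < xk => hS.lt xnS xkS h
    have l2 := fun h : xk < xn => hS.lt xkS xnS h
    have l3 := fun h : xn < xl => hS.lt xnS xlS h
    have l4 := fun h : xl < xn => hS.lt xlS xnS h
    have l5 := fun h : xk < xl => hS.lt xkS xlS h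
    have l6 := fun h : xl < xk => hS.lt xlS xkS h
    have out1 : (xl + e k' * δ ∉ uIcc (xn + t) (xk + t) ∧ xk + e k' * δ ∉ uIcc (xn + t) (xk + t)) → NI (CW G w) (CW G c) := by
      rintro ⟨h1, h2⟩
      refine NI_out (u := xn + t) (v := xk + t) ?_ ?_
      · intro a ha; rcases cA a ha with rfl | rfl; exacts [left_mem_uIcc, right_mem_uIcc]
      · intro a ha; rcases cB' a ha with rfl | rfl; exacts [h1, h2]
    have out2 : (xn + t ∉ uIcc (xl + e k' * δ) (xk + e k' * δ) ∧ xk + t ∉ uIcc (xl + e k' * δ) (xk + e k' * δ)) → NI (CW G w) (CW G c) := by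
      rintro ⟨h1, h2⟩
      refine (NI_out (u := xl + e k' * δ) (v := xk + e k' * δ) ?_ ?_).symm
      · intro a ha; rcases cB' a ha with rfl | rfl; exacts [left_mem_uIcc, right_mem_uIcc]
      · intro a ha; rcases cA a ha with rfl | rfl; exacts [h1, h2]
    simp only [mem_uIcc] at out1 out2
    rcases od' with ⟨rfl, h | h | h⟩ | ⟨rfl, h | h | h⟩
    · have := l1 h.1; have := l5 h.2
      apply out1; constructor <;> (rintro (h | h) <;> linarith [h.1, h.2])
    · have := l4 h.1; have := l1 h.2
      apply out1; constructor <;> (rintro (h | h) <;> linarith [h.1, h.2])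
    · have := l5 h.1; have := l4 h.2
      apply out2; constructor <;> (rintro (h | h) <;> linarith [h.1, h.2])
    · have := l3 h.1; have := l6 h.2
      apply out2; constructor <;> (rintro (h | h) <;> linarith [h.1, h.2])
    · have := l2 h.1; have := l3 h.2
      apply out1; constructor <;> (rintro (h | h) <;> linarith [h.1, h.2])
    · have := l6 h.1; have := l2 h.2
      apply out1; constructor <;> (rintro (h | h) <;> linarith [h.1, h.2])
  · rintro ⟨j, k'⟩ p
    have Cw : ∀ i z, (z, w) ∉ C i := fun i z h => C0 i _ h right_mem_uIcc
    have qw : w ≠ q + t := by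
      intro h
      have := nin _ _ _ hσ (kb _ qS _ y0S q0)
      rw [← h, ← hw] at this
      exact this right_mem_uIcc
    by_cases hk : k' = k
    · subst hk
      have e1 : p ∈ F' (j, k') ↔ (p.1 - t, p.2 - t) ∈ Z' j := by
        simp [hF', mix, mem_shiftD, ht]
      rw [e1, mZ']
      simp only [sub_pt]
      simp only [mG, Cw, false_or, Prod.mk.injEq, and_true, wy, and_false, or_false, qw, false_and]
      have e2 : p ∈ C (j, k') ↔ (p.1 - t, p.2 - t) ∈ B j := by simp [hC, mem_shiftD]
      rw [e2]
      obtain ⟨p1, p2⟩ := p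
      have pw : p2 = w → ((p1 - t, p2 - t) : Pt) ∉ B j := by
        rintro rfl h; exact Cw (j, k') p1 (e2.2 h)
      simp only [Prod.mk.injEq]
      constructor
      · rintro (h | ⟨h1, h | h⟩ | ⟨h1, h | h⟩ | ⟨h1, h⟩)
        · exact .inl ⟨.inl h, fun hw => pw hw h⟩
        · exact .inr ⟨h.2, h1, .inl h.1⟩
        · exact .inr ⟨h.2, h1, .inr h.1⟩
        · exact .inl ⟨.inr (.inr (.inl ⟨h1, .inl h⟩)), by rw [h.2]; exact wy.symm⟩
        · exact .inl ⟨.inr (.inr (.inl ⟨h1, .inr h⟩)), by rw [h.2]; exact wy.symm⟩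
        · exact .inl ⟨.inr (.inr (.inr ⟨h1, h⟩)), by rw [h.2]; exact qw.symm⟩
      · rintro (⟨h | ⟨h1, h | h⟩ | ⟨h1, h⟩ | ⟨h1, h⟩, h2⟩ | ⟨h1, h2, h3 | h3⟩)
        · exact .inl h
        · exact absurd h.2 h2
        · exact absurd h.2 h2
        · exact .inr (.inr (.inl ⟨h1, h⟩))
        · exact .inr (.inr (.inr ⟨h1, h⟩))
        · exact .inr (.inl ⟨h2, .inl ⟨h3, h1⟩⟩)
        · exact .inr (.inl ⟨h2, .inr ⟨h3, h1⟩⟩)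
    · have hlt : ((0 ≤ σ * (e k' - e k)) ↔ (0 < σ * (e k' - e k))) := by
        have : σ * (e k' - e k) ≠ 0 := by
          refine mul_ne_zero ?_ (sub_ne_zero.2 fun h => hk (e_inj h))
          rcases hσ with rfl | rfl <;> norm_num
        exact ⟨fun h => lt_of_le_of_ne h this.symm, le_of_lt⟩
      have e1 : p ∈ F' (j, k') ↔ p ∈ C (j, k') := by
        simp only [hC, hk, if_false]
        rw [hF', hF, mem_mix, mem_mix]
        simp only [hlt]
      rw [e1]
      simp only [mG, Cw, false_or, Prod.mk.injEq, hk, and_false, or_false, false_and]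
      constructor
      · intro h
        exact ⟨h, fun hh => Cw (j, k') p.1 (by rw [← hh]; exact h)⟩
      · exact fun h => h.1

def Zt (T : Theta) : Fin 4 → Finset Pt := ![T.a, T.b, T.c, T.d]

@[simp] lemma Zt0 (T : Theta) : Zt T 0 = T.a := rfl
@[simp] lemma Zt1 (T : Theta) : Zt T 1 = T.b := rfl
@[simp] lemma Zt2 (T : Theta) : Zt T 2 = T.c := rfl
@[simp] lemma Zt3 (T : Theta) : Zt T 3 = T.d := rfl

lemma Zt_map (f : Pt → Pt) (T : Theta) : Zt (mapTheta f T) = fun j => (Zt T j).image f := by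
  ext j p; fin_cases j <;> simp [Zt, mapTheta]

lemma Zt_tr (T : Theta) : Zt T.tr = trZ (Zt T) := Zt_map _ _

lemma mem_U {T : Theta} {p : Pt} : p ∈ T.U ↔ ∃ j, p ∈ Zt T j := by
  simp [Theta.U, Fin.exists_fin_succ, Zt, or_assoc]

structure TGood (E E1 : (Fin 4 → Finset Pt) → (Fin 4 → Finset Pt) → Prop) : Prop where
  v : VGood E
  h : VGood (fun X Y => E (trZ X) (trZ Y))
  imp : ∀ X Y, E X Y → E1 X Y
  rf : ∀ X, E1 X X
  st : ∀ Z j0 x y x' y', StCond Z j0 x y x' y' → E1 Z (SM Z j0 x y x' y')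
  sti : ∀ Z j0 x y x' y', StCond Z j0 x y x' y' → E1 (SM Z j0 x y x' y') Z
  es : ∀ B Z Z' jn jk jl xn xk xl y0 y1 q, ESC B Z Z' jn jk jl xn xk xl y0 y1 q → E1 Z Z'
  est : ∀ B Z Z' jn jk jl xn xk xl y0 y1 q, ESC B Z Z' jn jk jl xn xk xl y0 y1 q → E1 (trZ Z) (trZ Z')

theorem TGood_CopyEq : TGood CopyEq CopyEq where
  v := VGood_CopyEq
  h := by
    have g := VGood_CopyEq
    exact ⟨fun X Y Z h h' => h.trans h', fun X x0 v a b c => (g.mv X x0 v a b c).tr,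
      fun X x0 v a b => (g.cl X x0 v a b).tr, fun X x0 v a b => (g.cr X x0 v a b).tr⟩
  imp := fun _ _ h => h
  rf := CopyEq.refl
  st := CSt
  sti := fun Z j x y x' y' h => (CSt Z j x y x' y' h).symm
  es := fun B Z Z' _ _ _ _ _ _ _ _ _ h => CES h
  est := fun B Z Z' _ _ _ _ _ _ _ _ _ h => (CES h).tr

lemma image_hmap (y0 y1 : ℝ) (X : Fin 4 → Finset Pt) :
    (fun j => (X j).image (hmap y0 y1)) = trZ (VM1 y0 y1 (trZ X)) := by
  ext j p
  simp only [trZ, VM1, trF, Finset.image_image]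
  have : (fun p : Pt => (p.2, p.1)) ∘ vmap y0 y1 ∘ (fun p : Pt => (p.2, p.1)) = hmap y0 y1 := by
    funext p; simp only [Function.comp, vmap, hmap]; split_ifs <;> rfl
  rw [this]

lemma image_swaph (y0 y1 : ℝ) (X : Fin 4 → Finset Pt) :
    (fun j => (X j).image (swaph y0 y1)) = trZ (VS y0 y1 (trZ X)) := by
  ext j p
  simp only [trZ, VS, trF, Finset.image_image]
  have : (fun p : Pt => (p.2, p.1)) ∘ swapv y0 y1 ∘ (fun p : Pt => (p.2, p.1)) = swaph y0 y1 := by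
    funext p; simp only [Function.comp, swapv, swaph]; split_ifs <;> rfl
  rw [this]

lemma VGood.comm {E : (Fin 4 → Finset Pt) → (Fin 4 → Finset Pt) → Prop} (g : VGood E)
    (X : Fin 4 → Finset Pt) (x1 x2 : ℝ) (h : x1 ≠ x2)
    (hno : ∀ i, ∀ q ∈ X i, ¬ (min x1 x2 < q.1 ∧ q.1 < max x1 x2))
    (hN : NI (RW X x1) (RW X x2)) : E X (VS x1 x2 X) := by
  rcases lt_or_gt_of_ne h with h' | h'
  · rw [min_eq_left h'.le, max_eq_right h'.le] at hno
    exact g.swap X x1 x2 h' hno hN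
  · rw [min_eq_right h'.le, max_eq_left h'.le] at hno
    rw [VS_comm h]
    exact g.swap X x2 x1 h' hno hN.symm

lemma Bet_iff {a b c : ℝ} : Bet a b c ↔ min a c < b ∧ b < max a c := by
  rcases le_total a c with h | h
  · rw [min_eq_left h, max_eq_right h]
    exact ⟨fun h' => h'.elim id fun h' => ⟨by linarith [h'.1, h'.2], by linarith [h'.1, h'.2]⟩, .inl⟩
  · rw [min_eq_right h, max_eq_left h]
    exact ⟨fun h' => h'.elim (fun h' => ⟨by linarith [h'.1, h'.2], by linarith [h'.1, h'.2]⟩) id, .inr⟩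

lemma TG_cyc {E E1 : (Fin 4 → Finset Pt) → (Fin 4 → Finset Pt) → Prop} (g : TGood E E1) {T T' : Theta} (h : ThCyclic T T') : E1 (Zt T) (Zt T') := by
  obtain ⟨-, -, f, hf, rfl⟩ := h
  rw [Zt_map]
  have hf' : CyclicData T.U f := hf
  rcases hf with ⟨x0, x1, -, h, rfl⟩ | ⟨x0, x1, -, h, rfl⟩
  · change E1 _ (VM1 x0 x1 (Zt T))
    by_cases h01 : x0 = x1
    · rw [← h01, VM1_self]; exact g.rf _
    apply g.imp
    refine g.v.cyc _ _ _ h01 (h.imp (fun h => ⟨fun i p hp => h.1 p (mem_U.2 ⟨i, hp⟩), fun i p hp => h.2 p (mem_U.2 ⟨i, hp⟩)⟩)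
      (fun h => ⟨fun i p hp => h.1 p (mem_U.2 ⟨i, hp⟩), fun i p hp => h.2 p (mem_U.2 ⟨i, hp⟩)⟩))
  · rw [image_hmap]
    by_cases h01 : x0 = x1
    · rw [← h01, VM1_self, trZ_trZ]; exact g.rf _
    apply g.imp
    have := g.h.cyc (trZ (Zt T)) _ _ h01 (h.imp (fun h => ⟨fun i p hp => h.1 _ (mem_U.2 ⟨i, mem_trF.1 hp⟩), fun i p hp => h.2 _ (mem_U.2 ⟨i, mem_trF.1 hp⟩)⟩)
      (fun h => ⟨fun i p hp => h.1 _ (mem_U.2 ⟨i, mem_trF.1 hp⟩), fun i p hp => h.2 _ (mem_U.2 ⟨i, mem_trF.1 hp⟩)⟩))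
    rwa [trZ_trZ] at this

lemma TG_comm {E E1 : (Fin 4 → Finset Pt) → (Fin 4 → Finset Pt) → Prop} (g : TGood E E1) {T T' : Theta} (h : ThComm T T') : E1 (Zt T) (Zt T') := by
  obtain ⟨-, -, f, hf, rfl⟩ := h
  rw [Zt_map]
  rcases hf with ⟨x0, x1, h01, -, -, h1, h2, h3, rfl⟩ | ⟨x0, x1, h01, -, -, h1, h2, h3, rfl⟩
  · apply g.imp
    refine g.v.comm _ _ _ h01 (fun i p hp => h1 p (mem_U.2 ⟨i, hp⟩)) ⟨?_, ?_⟩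
    · rintro a ⟨i, ha⟩ b ⟨j, hb⟩
      exact h2 _ (mem_U.2 ⟨i, ha⟩) _ (mem_U.2 ⟨j, hb⟩) rfl rfl
    · rintro a ⟨i, ha⟩ a' ⟨i', ha'⟩ b ⟨j, hb⟩ b' ⟨j', hb'⟩
      have := h3 _ (mem_U.2 ⟨i, ha⟩) _ (mem_U.2 ⟨i', ha'⟩) _ (mem_U.2 ⟨j, hb⟩) _ (mem_U.2 ⟨j', hb'⟩) rfl rfl rfl rfl
      rwa [not_or] at this
  · rw [image_swaph]
    apply g.imp
    have := g.h.comm (trZ (Zt T)) _ _ h01 (fun i p hp => h1 _ (mem_U.2 ⟨i, mem_trF.1 hp⟩)) ⟨?_, ?_⟩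
    · rwa [trZ_trZ] at this
    · rintro a ⟨i, ha⟩ b ⟨j, hb⟩
      exact h2 _ (mem_U.2 ⟨i, mem_trF.1 ha⟩) _ (mem_U.2 ⟨j, mem_trF.1 hb⟩) rfl rfl
    · rintro a ⟨i, ha⟩ a' ⟨i', ha'⟩ b ⟨j, hb⟩ b' ⟨j', hb'⟩
      have := h3 _ (mem_U.2 ⟨i, mem_trF.1 ha⟩) _ (mem_U.2 ⟨i', mem_trF.1 ha'⟩) _ (mem_U.2 ⟨j, mem_trF.1 hb⟩) _ (mem_U.2 ⟨j', mem_trF.1 hb'⟩) rfl rfl rfl rfl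
      rwa [not_or] at this

lemma Zt_disj {T : Theta} (h : ThetaOK T) {i j : Fin 4} (hij : i ≠ j) : Disjoint (Zt T i) (Zt T j) := by
  obtain ⟨-, -, -, -, -, -, h1, h2, h3, h4, h5, h6, -⟩ := h
  fin_cases i <;> fin_cases j <;> first | exact absurd rfl hij | assumption | (apply Disjoint.symm; assumption)

lemma St_ext {T T' : Theta} (h : ThStabI T T') : ∃ j0 x y x' y', StCond (Zt T) j0 x y x' y' ∧ Zt T' = SM (Zt T) j0 x y x' y' := by
  obtain ⟨hT, -, x, y, x', y', -, hx, hy, fx, fy, bx, by', ty, h⟩ := h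
  obtain ⟨j0, hm, he⟩ : ∃ j0, (x, y) ∈ Zt T j0 ∧ Zt T' = SM (Zt T) j0 x y x' y' := by
    rcases h with ⟨h, rfl⟩ | ⟨h, rfl⟩ | ⟨h, rfl⟩ | ⟨h, rfl⟩
    · refine ⟨0, h, ?_⟩; ext j p; fin_cases j <;> simp [SM, Zt]
    · refine ⟨1, h, ?_⟩; ext j p; fin_cases j <;> simp [SM, Zt]
    · refine ⟨2, h, ?_⟩; ext j p; fin_cases j <;> simp [SM, Zt]
    · refine ⟨3, h, ?_⟩; ext j p; fin_cases j <;> simp [SM, Zt]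
  refine ⟨j0, x, y, x', y', ⟨hm, ?_, hx, hy, fun j q hq => fx q (mem_U.2 ⟨j, hq⟩), fun j q hq => fy q (mem_U.2 ⟨j, hq⟩),
    fun j q hq => ?_, fun j q hq => ?_, ty⟩, he⟩
  · intro j hj hm'
    exact Finset.disjoint_left.1 (Zt_disj hT hj) hm' hm
  · rw [Bet_iff]; exact bx q (mem_U.2 ⟨j, hq⟩)
  · rw [Bet_iff]; exact by' q (mem_U.2 ⟨j, hq⟩)

lemma diag_card {K : Finset Pt} (hK : IsDiagram K) {f : Pt → ℝ} (hf : f = Prod.fst ∨ f = Prod.snd) (y : ℝ) :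
    (K.filter (fun q => f q = y)).card = 2 ∨ (K.filter (fun q => f q = y)).card = 0 := by
  by_cases h : ∃ p ∈ K, f p = y
  · obtain ⟨p, hp, rfl⟩ := h
    rcases hf with rfl | rfl
    · exact .inl (hK p hp).1
    · exact .inl (hK p hp).2
  · right
    rw [Finset.card_eq_zero, Finset.filter_eq_empty_iff]
    intro p hp he; exact h ⟨p, hp, he⟩

lemma diag_card_le {K P : Finset Pt} (hK : IsDiagram K) (hP : P ⊆ K) {f : Pt → ℝ} (hf : f = Prod.fst ∨ f = Prod.snd) (y : ℝ) :
    (P.filter (fun q => f q = y)).card ≤ 2 := by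
  have := Finset.card_le_card (Finset.filter_subset_filter (fun q => f q = y) hP)
  rcases diag_card hK hf y with h | h <;> omega

lemma path_card {P : Finset Pt} (hP : IsPath P) {f : Pt → ℝ} (hf : f = Prod.fst ∨ f = Prod.snd) (y : ℝ) :
    (P.filter (fun q => f q = y)).card ≤ 2 := by
  rcases hP with ⟨p, rfl⟩ | ⟨q, -, hK⟩ | ⟨q, r, -, -, -, -, hK⟩
  · exact (Finset.card_filter_le _ _).trans (by simp)
  · exact diag_card_le hK.1 (Finset.subset_insert _ _) hf y
  · exact diag_card_le hK.1 ((Finset.subset_insert _ _).trans (Finset.subset_insert _ _)) hf y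

lemma three_le {F : Finset Pt} {p q r : Pt} (hp : p ∈ F) (hq : q ∈ F) (hr : r ∈ F) (h1 : p ≠ q) (h2 : p ≠ r) (h3 : q ≠ r) :
    3 ≤ F.card := by
  have : ({p, q, r} : Finset Pt) ⊆ F := by
    intro z hz; simp at hz; rcases hz with rfl | rfl | rfl <;> assumption
  have h := Finset.card_le_card this
  rwa [Finset.card_eq_three.2 ⟨p, q, r, h1, h2, h3, rfl⟩] at h

/-- if p is the only point in its row and in its column, the path is a single point -/
lemma path_single {P : Finset Pt} (hP : IsPath P) {p : Pt} (hp : p ∈ P)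
    (h1 : (P.filter (fun q => q.1 = p.1)).card = 1) (h2 : (P.filter (fun q => q.2 = p.2)).card = 1) : P = {p} := by
  have u : ∀ f : Pt → ℝ, (P.filter (fun q => f q = f p)).card = 1 → ∀ z ∈ P, f z = f p → z = p := by
    intro f hf z hz hzp
    exact Finset.card_le_one.1 hf.le z (by simp [hz, hzp]) p (by simp [hp])
  have oth : ∀ K : Finset Pt, IsDiagram K → p ∈ K → ∀ f : Pt → ℝ, (f = Prod.fst ∨ f = Prod.snd) →
      ∃ z ∈ K, z ≠ p ∧ f z = f p := by
    intro K hK hpK f hf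
    have h : 1 < (K.filter (fun q => f q = f p)).card := by
      rcases diag_card hK hf (f p) with h | h
      · omega
      · rw [Finset.card_eq_zero, Finset.filter_eq_empty_iff] at h
        exact absurd rfl (h hpK)
    obtain ⟨z, hz, hzp⟩ := Finset.exists_mem_ne h p
    rw [Finset.mem_filter] at hz
    exact ⟨z, hz.1, hzp, hz.2⟩
  rcases hP with ⟨p', rfl⟩ | ⟨q, hq, hK⟩ | ⟨q, r, hqr, hq, hr, hqr', hK⟩
  · simp at hp; rw [hp]
  · exfalso
    obtain ⟨z, hz, hzp, hz'⟩ := oth _ hK.1 (Finset.mem_insert_of_mem hp) Prod.fst (.inl rfl)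
    obtain ⟨w, hw, hwp, hw'⟩ := oth _ hK.1 (Finset.mem_insert_of_mem hp) Prod.snd (.inr rfl)
    rw [Finset.mem_insert] at hz hw
    rcases hz with rfl | hz
    · rcases hw with rfl | hw
      · exact hzp (Prod.ext hz' hw')
      · exact hwp (u Prod.snd h2 w hw hw')
    · exact hzp (u Prod.fst h1 z hz hz')
  · exfalso
    have hpK : p ∈ insert q (insert r P) := by simp [hp]
    have pq : p ≠ q := by rintro rfl; exact hq hp
    have pr : p ≠ r := by rintro rfl; exact hr hp
    obtain ⟨z, hz, hzp, hz'⟩ := oth _ hK.1 hpK Prod.fst (.inl rfl)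
    obtain ⟨w, hw, hwp, hw'⟩ := oth _ hK.1 hpK Prod.snd (.inr rfl)
    have hz2 : z = q ∨ z = r := by
      rw [Finset.mem_insert, Finset.mem_insert] at hz
      rcases hz with h | h | h
      · exact .inl h
      · exact .inr h
      · exact absurd (u Prod.fst h1 z h hz') hzp
    have hw2 : w = q ∨ w = r := by
      rw [Finset.mem_insert, Finset.mem_insert] at hw
      rcases hw with h | h | h
      · exact .inl h
      · exact .inr h
      · exact absurd (u Prod.snd h2 w h hw') hwp
    have tri : ∀ f : Pt → ℝ, (f = Prod.fst ∨ f = Prod.snd) → f q = f r → ∀ z, (z = q ∨ z = r) → f z = f p → False := by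
      intro f hf hqr' z hz hzp
      have hq' : f q = f p := by rcases hz with rfl | rfl; exacts [hzp, hqr'.trans hzp]
      have h3 := three_le (F := (insert q (insert r P)).filter (fun z => f z = f p)) (p := p) (q := q) (r := r)
        (by simp [hp]) (by simp [hq']) (by simp [← hqr', hq']) pq pr hqr
      rcases diag_card hK.1 hf (f p) with h | h <;> omega
    rcases hqr' with h | h
    · exact tri Prod.fst (.inl rfl) h z hz2 hz'
    · exact tri Prod.snd (.inr rfl) h w hw2 hw'

lemma ES_core (Z Z' : Fin 4 → Finset Pt) (y0 y1 q : ℝ) (x : Fin 3 → ℝ) (π : Fin 3 → Fin 4) (n k l : Fin 3)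
    (hnk : n ≠ k) (hnl : n ≠ l) (hkl : k ≠ l) (hπ : Function.Injective π)
    (hs : ∀ j : Fin 4, j ≠ 3 → ∃ i, π i = j) (h3 : ∀ i, π i ≠ 3)
    (row : ∀ j, ∀ p ∈ Z j, p.2 = y0 → ∃ i, j = π i ∧ p = (x i, y0))
    (mem : ∀ i, (x i, y0) ∈ Z (π i)) (hq : (x k, q) ∈ Z (π k)) (q0 : q ≠ y0)
    (col : ∀ j, ∀ p ∈ Z j, p.1 = x k → j = π k ∧ (p.2 = y0 ∨ p.2 = q))
    (gap : ∀ j, ∀ p ∈ Z j, p.2 ≠ y0 → p.2 ≠ y1 ∧ ¬ Bet y0 p.2 y1)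
    (od : (y0 < y1 ∧ ((x n < x k ∧ x k < x l) ∨ (x l < x n ∧ x n < x k) ∨ (x k < x l ∧ x l < x n))) ∨
      (y1 < y0 ∧ ((x n < x l ∧ x l < x k) ∨ (x k < x n ∧ x n < x l) ∨ (x l < x k ∧ x k < x n))))
    (d3 : Z' 3 = Z 3)
    (dn : ∀ p, p ∈ Z' (π n) ↔ (p ∈ Z (π n) ∧ p ≠ (x n, y0)) ∨ p = (x n, y1) ∨ p = (x k, y1))
    (dk : ∀ p, p ∈ Z' (π k) ↔ (p ∈ Z (π k) ∧ p ≠ (x k, y0)))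
    (dl : ∀ p, p ∈ Z' (π l) ↔ (p ∈ Z (π l) ∧ p ≠ (x l, y0)) ∨ p = (x l, y0) ∨ p = (x k, y0)) :
    ESC (fun j => (Z j).filter fun p => p.2 ≠ y0 ∧ p.1 ≠ x k) Z Z' (π n) (π k) (π l) (x n) (x k) (x l) y0 y1 q := by
  have cov : ∀ i : Fin 3, i = n ∨ i = k ∨ i = l := by
    revert hnk hnl hkl; clear * -; revert n k l; decide
  have xnk : x n ≠ x k := by intro h; rcases od with ⟨-, h | h | h⟩ | ⟨-, h | h | h⟩ <;> linarith [h.1, h.2]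
  have xlk : x l ≠ x k := by intro h; rcases od with ⟨-, h | h | h⟩ | ⟨-, h | h | h⟩ <;> linarith [h.1, h.2]
  have nk := hπ.ne hnk
  have nl := hπ.ne hnl
  have kl := hπ.ne hkl
  have rowi : ∀ i p, p ∈ Z (π i) → p.2 = y0 → p = (x i, y0) := by
    intro i p hp he
    obtain ⟨i', h1, h2⟩ := row _ p hp he
    rw [hπ h1]; exact h2
  have colo : ∀ j, j ≠ π k → ∀ p ∈ Z j, p.1 ≠ x k := fun j hj p hp h => hj (col j p hp h).1
  have colk : ∀ p ∈ Z (π k), p.1 = x k → p = (x k, y0) ∨ p = (x k, q) := fun p hp h => by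
    rcases (col _ p hp h).2 with h' | h'
    · exact .inl (Prod.ext h h')
    · exact .inr (Prod.ext h h')
  have lab : ∀ j, j = 3 ∨ j = π n ∨ j = π k ∨ j = π l := by
    intro j
    by_cases hj : j = 3
    · exact .inl hj
    obtain ⟨i, rfl⟩ := hs j hj
    rcases cov i with rfl | rfl | rfl <;> simp
  refine ⟨nk, nl, kl, ?_, ?_, ?_, ?_, q0, (gap _ _ hq q0).1, (gap _ _ hq q0).2, od, ?_, ?_⟩
  · intro j p hp; exact (Finset.mem_filter.1 hp).2.2
  · intro j p hp; exact (Finset.mem_filter.1 hp).2.1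
  · intro j p hp; have := Finset.mem_filter.1 hp; exact (gap j p this.1 this.2.1).1
  · intro j p hp; have := Finset.mem_filter.1 hp; exact (gap j p this.1 this.2.1).2
  · intro j p
    simp only [Finset.mem_filter]
    constructor
    · intro hp
      by_cases hy : p.2 = y0
      · obtain ⟨i, rfl, rfl⟩ := row j p hp hy
        rcases cov i with rfl | rfl | rfl <;> simp
      by_cases hx : p.1 = x k
      · obtain ⟨rfl, h⟩ := col j p hp hx
        exact .inr (.inr (.inr ⟨rfl, colk p hp hx⟩))
      · exact .inl ⟨hp, hy, hx⟩
    · rintro (h | ⟨rfl, rfl⟩ | ⟨rfl, rfl⟩ | ⟨rfl, rfl | rfl⟩)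
      exacts [h.1, mem _, mem _, mem _, hq]
  · intro j p
    simp only [Finset.mem_filter]
    rcases lab j with rfl | rfl | rfl | rfl
    · rw [d3]
      have := (h3 n).symm; have := (h3 k).symm; have := (h3 l).symm
      constructor
      · intro hp
        refine .inl ⟨hp, fun h => ?_, colo _ (h3 k).symm p hp⟩
        obtain ⟨i, h, -⟩ := row _ p hp h
        exact h3 i h.symm
      · rintro (h | ⟨h, -⟩ | ⟨h, -⟩ | ⟨h, -⟩)
        · exact h.1
        all_goals exact absurd h (h3 _).symm
    · rw [dn]
      have c := colo _ nk p
      have r := rowi n p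
      have m := mem n
      constructor
      · rintro (⟨h1, h2⟩ | h)
        · exact .inl ⟨h1, fun h => h2 (r h1 h), c h1⟩
        · exact .inr (.inl ⟨rfl, h⟩)
      · rintro (h | ⟨-, h⟩ | ⟨h, -⟩ | ⟨h, -⟩)
        · refine .inl ⟨h.1, ?_⟩; rintro rfl; exact h.2.1 rfl
        · exact .inr h
        · exact absurd h nl
        · exact absurd h nk
    · rw [dk]
      have c := colk p
      have r := rowi k p
      constructor
      · rintro ⟨h1, h2⟩
        by_cases hx : p.1 = x k
        · rcases c h1 hx with h | h
          · exact absurd h h2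
          · exact .inr (.inr (.inr ⟨rfl, h⟩))
        · exact .inl ⟨h1, fun h => h2 (r h1 h), hx⟩
      · rintro (h | ⟨h, -⟩ | ⟨h, -⟩ | ⟨-, rfl⟩)
        · refine ⟨h.1, ?_⟩; rintro rfl; exact h.2.1 rfl
        · exact absurd h nk.symm
        · exact absurd h kl
        · exact ⟨hq, by simp [q0]⟩
    · rw [dl]
      have c := colo _ kl.symm p
      have r := rowi l p
      constructor
      · rintro (⟨h1, h2⟩ | h)
        · exact .inl ⟨h1, fun h => h2 (r h1 h), c h1⟩
        · exact .inr (.inr (.inl ⟨rfl, h⟩))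
      · rintro (h | ⟨h, -⟩ | ⟨-, h⟩ | ⟨h, -⟩)
        · refine .inl ⟨h.1, ?_⟩; rintro rfl; exact h.2.1 rfl
        · exact absurd h nl.symm
        · exact .inr h
        · exact absurd h kl.symm

lemma Zt_path {T : Theta} (h : ThetaOK T) {j : Fin 4} (hj : j ≠ 3) : IsPath (Zt T j) ∧ Ends (Zt T j) = Ends T.a := by
  obtain ⟨h0, h1, h2, -, e1, e2, -⟩ := h
  fin_cases j
  · exact ⟨h0, rfl⟩
  · exact ⟨h1, e1.symm⟩
  · exact ⟨h2, e2.symm⟩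
  · exact absurd rfl hj

/-- two points of different labels in a common line: an end, and no label is 3 -/
lemma Zt_gp {T : Theta} (h : ThetaOK T) {i j : Fin 4} (hij : i ≠ j) {p q : Pt} (hp : p ∈ Zt T i) (hq : q ∈ Zt T j) :
    (p.1 = q.1 → (true, p.1) ∈ Ends T.a ∧ i ≠ 3 ∧ j ≠ 3) ∧ (p.2 = q.2 → (false, p.2) ∈ Ends T.a ∧ i ≠ 3 ∧ j ≠ 3) := by
  obtain ⟨-, -, -, -, -, -, -, -, -, -, -, -, h1, h2, h3, h4, h5, h6⟩ := h
  have S : ∀ A C : Finset Pt, CrossGP A C (Ends T.a) → p ∈ A → q ∈ C → (p.1 = q.1 → (true, p.1) ∈ Ends T.a) ∧ (p.2 = q.2 → (false, p.2) ∈ Ends T.a) :=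
    fun A C h ha hc => h p ha q hc
  have S' : ∀ A C : Finset Pt, CrossGP C A (Ends T.a) → p ∈ A → q ∈ C → (p.1 = q.1 → (true, p.1) ∈ Ends T.a) ∧ (p.2 = q.2 → (false, p.2) ∈ Ends T.a) :=
    fun A C h ha hc => ⟨fun e => by rw [e]; exact (h q hc p ha).1 e.symm, fun e => by rw [e]; exact (h q hc p ha).2 e.symm⟩
  have N : ∀ A C : Finset Pt, CrossGP A C ∅ → p ∈ A → q ∈ C → p.1 ≠ q.1 ∧ p.2 ≠ q.2 :=
    fun A C h ha hc => ⟨fun e => (h p ha q hc).1 e, fun e => (h p ha q hc).2 e⟩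
  have N' : ∀ A C : Finset Pt, CrossGP C A ∅ → p ∈ A → q ∈ C → p.1 ≠ q.1 ∧ p.2 ≠ q.2 :=
    fun A C h ha hc => ⟨fun e => (h q hc p ha).1 e.symm, fun e => (h q hc p ha).2 e.symm⟩
  fin_cases i <;> fin_cases j <;> simp at hij hp hq
  · have := S _ _ h1 hp hq; simpa using this
  · have := S _ _ h2 hp hq; simpa using this
  · have := N _ _ h4 hp hq; simpa using this
  · have := S' _ _ h1 hp hq; simpa using this
  · have := S _ _ h3 hp hq; simpa using this
  · have := N _ _ h5 hp hq; simpa using this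
  · have := S' _ _ h2 hp hq; simpa using this
  · have := S' _ _ h3 hp hq; simpa using this
  · have := N _ _ h6 hp hq; simpa using this
  · have := N' _ _ h4 hp hq; simpa using this
  · have := N' _ _ h5 hp hq; simpa using this
  · have := N' _ _ h6 hp hq; simpa using this

lemma mem_Ends_true {P : Finset Pt} {x : ℝ} : (true, x) ∈ Ends P ↔ (P.filter (fun p => p.1 = x)).card = 1 := by
  simp [Ends]
lemma mem_Ends_false {P : Finset Pt} {x : ℝ} : (false, x) ∈ Ends P ↔ (P.filter (fun p => p.2 = x)).card = 1 := by
  simp [Ends]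

lemma pi_surj : ∀ π : Fin 3 → Fin 4, (∀ i, π i ≠ 3) → (∀ i i', π i = π i' → i = i') → ∀ j : Fin 4, j ≠ 3 → ∃ i, π i = j := by
  decide

lemma ES_ext {T T' : Theta} (h : ThEndShiftH T T') : ∃ B jn jk jl xn xk xl y0 y1 q,
    ESC B (Zt T) (Zt T') jn jk jl xn xk xl y0 y1 q := by
  obtain ⟨hT, -, y0, P1, P2, P3, ε, hε, gap, e1, e2, e3, l12, l23, hF, hd, r1, r2, r3, hr, ha, hb, hc⟩ := h
  set P : Fin 3 → Pt := ![P1, P2, P3] with hP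
  set r : Fin 3 → Finset Pt := ![r1, r2, r3] with hrr
  have hP2 : ∀ i, (P i).2 = y0 := by intro i; fin_cases i <;> simpa [hP]
  have Pinj : ∀ i i', P i = P i' → i = i' := by
    intro i i' h
    have h := congrArg Prod.fst h
    fin_cases i <;> fin_cases i' <;> simp [hP] at h ⊢ <;> linarith
  have memP : ∀ i, ∃ j : Fin 4, j ≠ 3 ∧ P i ∈ Zt T j := by
    intro i
    have : P i ∈ ({P1, P2, P3} : Finset Pt) := by fin_cases i <;> simp [hP]
    rw [← hF, Finset.mem_filter] at this
    simp only [Finset.mem_union] at this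
    rcases this.1 with (h | h) | h
    exacts [⟨0, by decide, h⟩, ⟨1, by decide, h⟩, ⟨2, by decide, h⟩]
  choose π h3 hm using memP
  have row0 : ∀ j : Fin 4, j ≠ 3 → ∀ p ∈ Zt T j, p.2 = y0 → ∃ i, p = P i := by
    intro j hj p hp hy
    have : p ∈ ({P1, P2, P3} : Finset Pt) := by
      rw [← hF, Finset.mem_filter]
      refine ⟨?_, hy⟩
      fin_cases j <;> simp at hp hj <;> simp [hp]
    simp only [Finset.mem_insert, Finset.mem_singleton] at this
    rcases this with h | h | h
    exacts [⟨0, h⟩, ⟨1, h⟩, ⟨2, h⟩]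
  have hEnd : (false, y0) ∈ Ends T.a := by
    by_contra hne
    have same : ∀ i i', π i = π i' := by
      intro i i'
      by_contra h
      have := ((Zt_gp hT h (hm i) (hm i')).2 ((hP2 i).trans (hP2 i').symm)).1
      rw [hP2] at this; exact hne this
    have := three_le (F := (Zt T (π 0)).filter (fun p => p.2 = y0)) (p := P 0) (q := P 1) (r := P 2)
      (by simp [hm, hP2]) (by rw [same 0 1]; simp [hm, hP2]) (by rw [same 0 2]; simp [hm, hP2])
      (fun h => absurd (Pinj _ _ h) (by decide)) (fun h => absurd (Pinj _ _ h) (by decide)) (fun h => absurd (Pinj _ _ h) (by decide))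
    have h2 := path_card (Zt_path hT (h3 0)).1 (f := Prod.snd) (.inr rfl) y0
    omega
  have one : ∀ j : Fin 4, j ≠ 3 → ((Zt T j).filter (fun p => p.2 = y0)).card = 1 := by
    intro j hj
    rw [← mem_Ends_false, (Zt_path hT hj).2]; exact hEnd
  have uniq : ∀ i, ∀ p ∈ Zt T (π i), p.2 = y0 → p = P i := by
    intro i p hp hy
    exact Finset.card_le_one.1 (one _ (h3 i)).le p (by simp [hp, hy]) (P i) (by simp [hm, hP2])
  have πinj : ∀ i i', π i = π i' → i = i' := by
    intro i i' h
    apply Pinj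
    exact (uniq i' _ (h ▸ hm i) (hP2 i))
  have hs := pi_surj π h3 πinj
  have mP : ∀ i i', P i' ∈ Zt T (π i) ↔ i' = i := by
    intro i i'
    constructor
    · intro h; exact Pinj _ _ (uniq i _ h (hP2 _))
    · rintro rfl; exact hm _
  have row : ∀ j, ∀ p ∈ Zt T j, p.2 = y0 → ∃ i, j = π i ∧ p = P i := by
    intro j p hp hy
    by_cases hj : j = 3
    · exfalso
      have h := (Zt_gp hT (hj ▸ (h3 0).symm) hp (hm 0)).2 (hy.trans (hP2 0).symm)
      exact h.2.1 hj
    · obtain ⟨i, rfl⟩ := hs j hj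
      exact ⟨i, rfl, uniq i p hp hy⟩
  have upd : ∀ j : Fin 4, j ≠ 3 → Zt T' j = updPath (Zt T j) (P 0) (P 1) (P 2) (r 0) (r 1) (r 2) := by
    intro j hj
    fin_cases j <;> simp at hj <;> simpa [hP, hrr]
  have mem' : ∀ i p, p ∈ Zt T' (π i) ↔ (p ∈ Zt T (π i) ∧ p ≠ P i) ∨ p ∈ r i := by
    intro i p
    rw [upd _ (h3 i), updPath]
    simp only [mP]
    have hi : i = 0 ∨ i = 1 ∨ i = 2 := by clear * -; revert i; decide
    have n1 : (0 : Fin 3) ≠ 1 := by decide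
    have n2 : (0 : Fin 3) ≠ 2 := by decide
    have n3 : (1 : Fin 3) ≠ 2 := by decide
    rcases hi with rfl | rfl | rfl
    · rw [if_pos rfl, Finset.mem_union, Finset.mem_erase, and_comm]
    · rw [if_neg n1, if_pos rfl, Finset.mem_union, Finset.mem_erase, and_comm]
    · rw [if_neg n2, if_neg n3, Finset.mem_union, Finset.mem_erase, and_comm]
  have gapP : ∀ σ : ℝ, (σ = 1 ∨ σ = -1) → ∀ j, ∀ p ∈ Zt T j, p.2 ≠ y0 → p.2 ≠ y0 + σ * ε ∧ ¬ Bet y0 p.2 (y0 + σ * ε) := by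
    intro σ hσ j p hp hy
    have := gap p (mem_U.2 ⟨j, hp⟩) (P 0) (mem_U.2 ⟨_, hm 0⟩) (by rw [hP2]; exact hy)
    rw [hP2, lt_abs] at this
    rcases hσ with rfl | rfl <;> refine ⟨fun h => ?_, fun h => ?_⟩
    · rcases this with h' | h' <;> linarith
    · rcases this with h' | h' <;> rcases h with h | h <;> linarith [h.1, h.2]
    · rcases this with h' | h' <;> linarith
    · rcases this with h' | h' <;> rcases h with h | h <;> linarith [h.1, h.2]
  have Pe : ∀ i, P i = ((P i).1, y0) := fun i => Prod.ext rfl (hP2 i)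
  have pO : ∀ i, pathOf T (P i) = Zt T (π i) := by
    intro i
    have hh : ∀ j : Fin 4, P i ∈ Zt T j ↔ j = π i := by
      intro j
      constructor
      · intro h
        by_contra hne
        exact Finset.disjoint_left.1 (Zt_disj hT hne) h (hm i)
      · rintro rfl; exact hm i
    have h0 := hh 0
    have h1 := hh 1
    have h2 := hh 2
    simp only [Zt0, Zt1, Zt2] at h0 h1 h2
    unfold pathOf
    have := h3 i
    generalize π i = j at *
    fin_cases j <;> simp at this <;> simp [h0, h1]
  suffices H : ∀ n k l : Fin 3, ∀ σ : ℝ, (σ = 1 ∨ σ = -1) → n ≠ k → n ≠ l → k ≠ l →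
      (∀ p, p ∈ r n ↔ p = ((P n).1, y0 + σ * ε) ∨ p = ((P k).1, y0 + σ * ε)) → r k = ∅ →
      (∀ p, p ∈ r l ↔ p = ((P l).1, y0) ∨ p = ((P k).1, y0)) → pathOf T (P k) ≠ {P k} →
      ((σ = 1 ∧ (((P n).1 < (P k).1 ∧ (P k).1 < (P l).1) ∨ ((P l).1 < (P n).1 ∧ (P n).1 < (P k).1) ∨ ((P k).1 < (P l).1 ∧ (P l).1 < (P n).1))) ∨
      (σ = -1 ∧ (((P n).1 < (P l).1 ∧ (P l).1 < (P k).1) ∨ ((P k).1 < (P n).1 ∧ (P n).1 < (P l).1) ∨ ((P l).1 < (P k).1 ∧ (P k).1 < (P n).1)))) →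
      ∃ B jn jk jl xn xk xl y0 y1 q, ESC B (Zt T) (Zt T') jn jk jl xn xk xl y0 y1 q by
    have E1 : P1 = (P1.1, y0) := Prod.ext rfl e1
    have E2 : P2 = (P2.1, y0) := Prod.ext rfl e2
    have E3 : P3 = (P3.1, y0) := Prod.ext rfl e3
    have l13 := l12.trans l23
    rcases hr with ⟨rfl, rfl, rfl, h⟩ | ⟨rfl, rfl, rfl, h⟩ | ⟨rfl, rfl, rfl, h⟩ | ⟨rfl, rfl, rfl, h⟩ | ⟨rfl, rfl, rfl, h⟩ | ⟨rfl, rfl, rfl, h⟩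
    · refine H 0 1 2 1 (.inl rfl) (by decide) (by decide) (by decide) ?_ ?_ ?_ h ?_
      · intro p; simp [hP, hrr, ptUp, e1, e2]
      · simp [hrr]
      · intro p; simp [hP, hrr, ← E1, ← E2, ← E3]; tauto
      · simp [hP, l12, l23]
    · refine H 0 2 1 (-1) (.inr rfl) (by decide) (by decide) (by decide) ?_ ?_ ?_ h ?_
      · intro p; simp [hP, hrr, ptDn, e1, e3, sub_eq_add_neg]
      · simp [hrr]
      · intro p; simp [hP, hrr, ← E1, ← E2, ← E3]
      · simp [hP, l12, l23]
    · refine H 1 2 0 1 (.inl rfl) (by decide) (by decide) (by decide) ?_ ?_ ?_ h ?_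
      · intro p; simp [hP, hrr, ptUp, e3, e2]
      · simp [hrr]
      · intro p; simp [hP, hrr, ← E1, ← E2, ← E3]
      · simp [hP, l12, l23]
    · refine H 1 0 2 (-1) (.inr rfl) (by decide) (by decide) (by decide) ?_ ?_ ?_ h ?_
      · intro p; simp [hP, hrr, ptDn, e1, e2, sub_eq_add_neg]
      · simp [hrr]
      · intro p; simp [hP, hrr, ← E1, ← E2, ← E3]; tauto
      · simp [hP, l12, l23]
    · refine H 2 0 1 1 (.inl rfl) (by decide) (by decide) (by decide) ?_ ?_ ?_ h ?_
      · intro p; simp [hP, hrr, ptUp, e1, e3]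
      · simp [hrr]
      · intro p; simp [hP, hrr, ← E1, ← E2, ← E3]; tauto
      · simp [hP, l12, l23]
    · refine H 2 1 0 (-1) (.inr rfl) (by decide) (by decide) (by decide) ?_ ?_ ?_ h ?_
      · intro p; simp [hP, hrr, ptDn, e3, e2, sub_eq_add_neg]
      · simp [hrr]
      · intro p; simp [hP, hrr, ← E1, ← E2, ← E3]
      · simp [hP, l12, l23]
  intro n k l σ hσ hnk hnl hkl rn rk rl hne hod
  rw [pO] at hne
  have hk := hm k
  have cne : ((Zt T (π k)).filter (fun p => p.1 = (P k).1)).card ≠ 1 := by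
    intro h
    refine hne (path_single (Zt_path hT (h3 k)).1 hk h ?_)
    rw [hP2]; exact one _ (h3 k)
  have cEnd : (true, (P k).1) ∉ Ends T.a := by
    rw [← (Zt_path hT (h3 k)).2, mem_Ends_true]; exact cne
  have c2 : ((Zt T (π k)).filter (fun p => p.1 = (P k).1)).card = 2 := by
    have h2 := path_card (Zt_path hT (h3 k)).1 (f := Prod.fst) (.inl rfl) (P k).1
    have : 0 < ((Zt T (π k)).filter (fun p => p.1 = (P k).1)).card := Finset.card_pos.2 ⟨P k, by simp [hk]⟩
    omega
  obtain ⟨Q, hQ, hQP⟩ := Finset.exists_mem_ne (by omega : 1 < ((Zt T (π k)).filter (fun p => p.1 = (P k).1)).card) (P k)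
  rw [Finset.mem_filter] at hQ
  have hQe : Q = ((P k).1, Q.2) := Prod.ext hQ.2 rfl
  have q0 : Q.2 ≠ y0 := fun h => hQP (uniq k Q hQ.1 h)
  refine ⟨_, _, _, _, _, _, _, y0, y0 + σ * ε, Q.2, ES_core (Zt T) (Zt T') y0 (y0 + σ * ε) Q.2 (fun i => (P i).1) π n k l hnk hnl hkl
    (fun i i' => πinj i i') hs h3 ?_ ?_ ?_ q0 ?_ (gapP σ hσ) ?_ hd ?_ ?_ ?_⟩
  · intro j p hp hy
    obtain ⟨i, h1, h2⟩ := row j p hp hy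
    exact ⟨i, h1, h2.trans (Pe i)⟩
  · intro i; rw [← Pe i]; exact hm i
  · rw [← hQe]; exact hQ.1
  · intro j p hp hx
    have hj : j = π k := by
      by_contra hj
      have h := ((Zt_gp hT hj hp hk).1 hx).1
      rw [hx] at h; exact cEnd h
    refine ⟨hj, ?_⟩
    subst hj
    by_contra hc
    rw [not_or] at hc
    have := three_le (F := (Zt T (π k)).filter (fun p => p.1 = (P k).1)) (p := p) (q := P k) (r := Q)
      (by simp [hp]; exact hx) (by simp [hk]) (by simp [hQ.1, hQ.2]) (by rintro rfl; exact hc.1 (hP2 k)) (by rintro rfl; exact hc.2 rfl) hQP.symm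
    omega
  · rcases hod with ⟨rfl, h⟩ | ⟨rfl, h⟩
    · exact .inl ⟨by linarith, h⟩
    · exact .inr ⟨by linarith, h⟩
  · intro p; rw [mem', rn, ← Pe]
  · intro p; rw [mem', rk, ← Pe]; simp
  · intro p; rw [mem', rl, ← Pe]

theorem TG_move {E E1 : (Fin 4 → Finset Pt) → (Fin 4 → Finset Pt) → Prop} (g : TGood E E1) {T T' : Theta}
    (h : ThMove T T') : E1 (Zt T) (Zt T') := by
  rcases h with h | h | h | h | h | h
  · exact TG_cyc g h
  · exact TG_comm g h
  · obtain ⟨j0, x, y, x', y', h, e⟩ := St_ext h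
    rw [e]; exact g.st _ _ _ _ _ _ h
  · obtain ⟨j0, x, y, x', y', h, e⟩ := St_ext h
    rw [e]; exact g.sti _ _ _ _ _ _ h
  · obtain ⟨B, jn, jk, jl, xn, xk, xl, y0, y1, q, h⟩ := ES_ext h
    exact g.es _ _ _ _ _ _ _ _ _ _ _ _ h
  · obtain ⟨B, jn, jk, jl, xn, xk, xl, y0, y1, q, h⟩ := ES_ext h
    have := g.est _ _ _ _ _ _ _ _ _ _ _ _ h
    rwa [Zt_tr, Zt_tr, trZ_trZ, trZ_trZ] at this

def Lam : R3 ≃ₜ R3 where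
  toFun z := (2 * z.1, 2 * z.2.1, 2 * z.2.2 - 1)
  invFun z := (z.1 / 2, z.2.1 / 2, (z.2.2 + 1) / 2)
  left_inv z := by simp
  right_inv z := by simp only []; ext <;> simp <;> ring
  continuous_toFun := by fun_prop
  continuous_invFun := by fun_prop

lemma Lam_seg (x y : ℝ) : Lam '' segment ℝ (ap x) (ft y) = segment ℝ ((2 * x, 0, 1) : R3) ((0, 2 * y, -1) : R3) := by
  ext z
  simp only [mem_image, mem_seg]
  constructor
  · rintro ⟨_, ⟨s, hs, rfl⟩, rfl⟩
    refine ⟨s, hs, ?_⟩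
    simp only [Lam, ap, ft]
    ext <;> simp <;> ring
  · rintro ⟨s, hs, rfl⟩
    refine ⟨_, ⟨s, hs, rfl⟩, ?_⟩
    simp only [Lam, ap, ft]
    ext <;> simp <;> ring

lemma spatial_eq (X : Finset Pt) : spatial X = Lam '' sp X := by
  simp only [spatial, sp, image_iUnion, Lam_seg]

lemma spatial_union (A C : Finset Pt) : spatial (A ∪ C) = spatial A ∪ spatial C := by
  ext z; simp only [spatial, Finset.mem_union, mem_iUnion, mem_union]; constructor
  · rintro ⟨p, h | h, hz⟩
    · exact .inl ⟨p, h, hz⟩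
    · exact .inr ⟨p, h, hz⟩
  · rintro (⟨p, h, hz⟩ | ⟨p, h, hz⟩)
    · exact ⟨p, .inl h, hz⟩
    · exact ⟨p, .inr h, hz⟩

lemma shiftD_zero (X : Finset Pt) : shiftD 0 X = X := by ext p; simp [mem_shiftD]
lemma shiftD_union (t : ℝ) (A C : Finset Pt) : shiftD t (A ∪ C) = shiftD t A ∪ shiftD t C := by
  ext p; simp [mem_shiftD]

lemma TE_spatial {ι : Type*} {X Y : ι → Finset Pt} (h : TE X Y) :
    ∃ g : R3 ≃ₜ R3, ∀ i, g '' spatial (X i) = spatial (Y i) := by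
  obtain ⟨h, hh⟩ := h
  refine ⟨(Lam.symm.trans h).trans Lam, fun i => ?_⟩
  have hi := hh i
  dsimp only at hi
  rw [spatial_eq, spatial_eq, ← hi]
  rw [← image_comp, ← image_comp]
  apply image_congr
  intro a _
  simp

lemma SphereSeparated.image {A C : Set R3} (g : R3 ≃ₜ R3) (h : SphereSeparated A C) : SphereSeparated (g '' A) (g '' C) := by
  obtain ⟨S, ⟨φ⟩, hS, U, V, hU, hV, hUV, hUV', hA, hC⟩ := h
  refine ⟨g '' S, ⟨(g.image S).symm.trans φ⟩, ?_, g '' U, g '' V, g.isOpenMap _ hU, g.isOpenMap _ hV,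
    (disjoint_image_iff g.injective).2 hUV, ?_, image_mono hA, image_mono hC⟩
  · rw [← image_union, ← image_inter g.injective, hS, image_empty]
  · rw [← image_union, hUV', image_compl_eq g.bijective]

theorem bypass_transfer {T T' : Theta} (hT : ThetaOK T) (hT' : ThetaOK T') (h : CopyEq (Zt T) (Zt T'))
    (hb : IsBypass (T.b ∪ T.c ∪ T.d) T.a T.b) : IsBypass (T'.b ∪ T'.c ∪ T'.d) T'.a T'.b := by
  obtain ⟨-, -, -, -, -, ⟨f, f1, f2, f3, f4⟩, ⟨ε, hε, hs⟩⟩ := hb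
  obtain ⟨pa, pb, pc, dd, eab, eac, dab, dac, dbc, dad, dbd, dcd, g1, g2, g3, g4, g5, g6⟩ := hT'
  have sdT : (T.b ∪ T.c ∪ T.d) \ T.b = T.c ∪ T.d := by
    obtain ⟨-, -, -, -, -, -, -, -, dbc, -, dbd, -⟩ := hT
    rw [Finset.union_assoc, Finset.union_sdiff_left, Finset.sdiff_eq_self_of_disjoint]
    exact (Finset.disjoint_union_right.2 ⟨dbc, dbd⟩).symm
  have sdT' : (T'.b ∪ T'.c ∪ T'.d) \ T'.b = T'.c ∪ T'.d := by
    rw [Finset.union_assoc, Finset.union_sdiff_left, Finset.sdiff_eq_self_of_disjoint]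
    exact (Finset.disjoint_union_right.2 ⟨dbc, dbd⟩).symm
  obtain ⟨u, hu, hu'⟩ := mem_nhdsGT_iff_exists_Ioo_subset.1 h
  have key : ∀ δ, 0 < δ → δ < u → ∃ g : R3 ≃ₜ R3, ∀ j k, g '' spatial (shiftD (e k * δ) (Zt T j)) = spatial (shiftD (e k * δ) (Zt T' j)) := by
    intro δ h1 h2
    obtain ⟨g, hg⟩ := TE_spatial (hu' ⟨h1, h2⟩ : TE (copies (Zt T) δ) (copies (Zt T') δ))
    exact ⟨g, fun j k => hg (j, k)⟩
  have e1 : ∀ δ : ℝ, e 1 * δ = 0 := by intro δ; norm_num [e]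
  have e2 : ∀ δ : ℝ, e 2 * δ = δ := by intro δ; norm_num [e]
  have e0 : ∀ δ : ℝ, e 0 * δ = -δ := by intro δ; norm_num [e]
  rw [mem_Ioi] at hu
  refine ⟨pa, pb, ?_, eab, ?_, ?_, ?_⟩
  · intro p hp; simp [hp]
  · intro p hp q hq
    simp only [Finset.mem_union] at hq
    rcases hq with (hq | hq) | hq
    · exact g1 p hp q hq
    · exact g2 p hp q hq
    · exact ⟨fun e => ((g4 p hp q hq).1 e).elim, fun e => ((g4 p hp q hq).2 e).elim⟩
  · obtain ⟨g, hg⟩ := key (u / 2) (by linarith) (by linarith)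
    have hg0 : ∀ j, g '' spatial (Zt T j) = spatial (Zt T' j) := by
      intro j; have := hg j 1; rwa [e1, shiftD_zero, shiftD_zero] at this
    have ga := hg0 0; have gb := hg0 1; have gc := hg0 2; have gd := hg0 3
    simp only [Zt0, Zt1, Zt2, Zt3] at ga gb gc gd
    refine ⟨g ∘ f, g.continuous.comp_continuousOn f1, g.injective.comp_injOn f2, ?_, ?_⟩
    · rw [image_comp, f3, image_union, ga, gb]
    · have := congrArg (fun s => g '' s) f4
      rw [image_inter g.injective, ← image_comp, spatial_union, spatial_union, image_union, image_union, gb, gc, gd] at this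
      rw [spatial_union, spatial_union, this]
  · refine ⟨min ε (u / 2), lt_min hε (by linarith), fun δ hδ hδ' => ?_⟩
    have hu2 := hδ'.trans (min_le_right _ _)
    obtain ⟨g, hg⟩ := key δ hδ (by linarith)
    have := (hs δ hδ (hδ'.trans (min_le_left _ _))).image g
    have hg0 : ∀ j, g '' spatial (Zt T j) = spatial (Zt T' j) := by
      intro j; have := hg j 1; rwa [e1, shiftD_zero, shiftD_zero] at this
    have hg1 : ∀ j, g '' spatial (shiftD δ (Zt T j)) = spatial (shiftD δ (Zt T' j)) := by
      intro j; have := hg j 2; rwa [e2] at this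
    have hg2 : ∀ j, g '' spatial (shiftD (-δ) (Zt T j)) = spatial (shiftD (-δ) (Zt T' j)) := by
      intro j; have := hg j 0; rwa [e0] at this
    have ga := hg0 0; have gb := hg0 1; have gc := hg0 2; have gd := hg0 3
    have ga1 := hg1 0; have gb1 := hg1 1; have ga2 := hg2 0; have gb2 := hg2 1
    simp only [Zt0, Zt1, Zt2, Zt3] at ga gb gc gd ga1 ga2 gb1 gb2
    rw [sdT'] 
    rw [sdT] at this
    simp only [spatial_union, shiftD_union, image_union, ga, gb, gc, gd, ga1, ga2, gb1, gb2] at this ⊢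
    exact this

lemma diag_image {R : Finset Pt} (hR : IsDiagram R) {f : Pt → Pt}
    (h1 : ∀ p ∈ R, ∀ q ∈ R, (f p).1 = (f q).1 ↔ p.1 = q.1) (h2 : ∀ p ∈ R, ∀ q ∈ R, (f p).2 = (f q).2 ↔ p.2 = q.2) :
    IsDiagram (R.image f) := by
  have inj : Set.InjOn f R := by
    intro p hp q hq h
    exact Prod.ext ((h1 p hp q hq).1 (by rw [h])) ((h2 p hp q hq).1 (by rw [h]))
  intro p' hp'
  obtain ⟨p, hp, rfl⟩ := Finset.mem_image.1 hp'
  rw [Finset.filter_image, Finset.filter_image, Finset.card_image_of_injOn, Finset.card_image_of_injOn]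
  · rw [Finset.filter_congr fun q hq => h1 q hq p hp, Finset.filter_congr fun q hq => h2 q hq p hp]
    exact hR p hp
  · exact inj.mono (by intro q hq; simp at hq; exact hq.1)
  · exact inj.mono (by intro q hq; simp at hq; exact hq.1)

lemma diag_vmap {R : Finset Pt} (hR : IsDiagram R) {x0 v : ℝ} (hv : ∀ q ∈ R, q.1 ≠ x0 → q.1 ≠ v) :
    IsDiagram (R.image (vmap x0 v)) := by
  apply diag_image hR
  · intro p hp q hq
    have a := hv p hp; have b := hv q hq
    simp only [vmap]; split_ifs with h h'
    · simp [h, h']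
    · simp only [h]; exact ⟨fun e => absurd e.symm (b h'), fun e => absurd e.symm h'⟩
    · rename_i h'; simp only [h']; exact ⟨fun e => absurd e (a h), fun e => absurd e h⟩
    · rfl
  · intro p hp q hq
    simp only [vmap]; split_ifs <;> rfl

lemma diag_swapv {R : Finset Pt} (hR : IsDiagram R) {x0 v : ℝ} :
    IsDiagram (R.image (swapv x0 v)) := by
  apply diag_image hR
  · intro p hp q hq
    simp only [swapv]; split_ifs <;> grind
  · intro p hp q hq
    simp only [swapv]; split_ifs <;> rfl

def EU (X Y : Unit → Finset Pt) : Prop := IsDiagram (X ()) → IsDiagram (Y ()) ∧ LegEquiv (X ()) (Y ())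

lemma EU.trans {X Y Z : Unit → Finset Pt} (h : EU X Y) (h' : EU Y Z) : EU X Z := fun hX =>
  ⟨(h' (h hX).1).1, (h hX).2.trans (h' (h hX).1).2⟩

lemma EU.refl (X : Unit → Finset Pt) : EU X X := fun h => ⟨h, .refl⟩

lemma EU_cl (X : Unit → Finset Pt) (x0 x1 : ℝ) (h : x0 < x1)
    (hX : ∀ i, ∀ q ∈ X i, q.1 ≠ x0 → x0 < q.1 ∧ q.1 < x1) : EU X (VM1 x0 x1 X) := by
  by_cases he : ∃ p ∈ X (), p.1 = x0
  · intro hR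
    have hR' : IsDiagram (VM1 x0 x1 X ()) := diag_vmap hR (fun q hq hn => (hX () q hq hn).2.ne)
    refine ⟨hR', .single (.inl ⟨hR, hR', _, .inl ⟨x0, x1, he, .inl ⟨?_, fun p hp hn => (hX () p hp hn).2⟩, rfl⟩, rfl⟩)⟩
    intro p hp
    by_cases hp0 : p.1 = x0
    · exact hp0.ge
    · exact (hX () p hp hp0).1.le
  · rw [VM1_id]; exact EU.refl _
    rintro ⟨⟩ q hq h; exact he ⟨q, hq, h⟩

lemma EU_cr (X : Unit → Finset Pt) (x0 x1 : ℝ) (h : x1 < x0)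
    (hX : ∀ i, ∀ q ∈ X i, q.1 ≠ x0 → x1 < q.1 ∧ q.1 < x0) : EU X (VM1 x0 x1 X) := by
  by_cases he : ∃ p ∈ X (), p.1 = x0
  · intro hR
    have hR' : IsDiagram (VM1 x0 x1 X ()) := diag_vmap hR (fun q hq hn => (hX () q hq hn).1.ne')
    refine ⟨hR', .single (.inl ⟨hR, hR', _, .inl ⟨x0, x1, he, .inr ⟨?_, fun p hp hn => (hX () p hp hn).1⟩, rfl⟩, rfl⟩)⟩
    intro p hp
    by_cases hp0 : p.1 = x0
    · exact hp0.le
    · exact (hX () p hp hp0).2.le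
  · rw [VM1_id]; exact EU.refl _
    rintro ⟨⟩ q hq h; exact he ⟨q, hq, h⟩

lemma EU_rep (n : ℕ) : ∀ (X : Unit → Finset Pt) (x0 v : ℝ), ((cols X).filter (· < x0)).card = n → x0 ≠ v →
    (∀ i, ∀ q ∈ X i, q.1 ∈ uIcc x0 v → q.1 = x0) → EU X (VM1 x0 v X) := by
  induction n with
  | zero =>
    intro X x0 v hn h0 hX
    rw [Finset.card_eq_zero, Finset.filter_eq_empty_iff] at hn
    obtain ⟨W, hW⟩ : ∃ W, ∀ c ∈ insert x0 (insert v (cols X)), c < W := by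
      obtain ⟨M, hM⟩ := (insert x0 (insert v (cols X))).finite_toSet.bddAbove
      exact ⟨M + 1, fun c hc => (hM hc).trans_lt (by linarith)⟩
    have hv := hW v (by simp)
    have hx := hW x0 (by simp)
    have hc : ∀ i, ∀ q ∈ X i, q.1 < W ∧ x0 ≤ q.1 := fun i q hq =>
      ⟨hW q.1 (by simp only [Finset.mem_insert, mem_cols]; exact .inr (.inr ⟨i, q, hq, rfl⟩)), not_lt.1 (hn (mem_cols.2 ⟨i, q, hq, rfl⟩))⟩
    have s1 := EU_cl X x0 W hx (fun i q hq hne => ⟨lt_of_le_of_ne (hc i q hq).2 (Ne.symm hne), (hc i q hq).1⟩)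
    have s2 := EU_cr (VM1 x0 W X) W v hv (by
      intro i q hq hne
      rw [VM1_mem] at hq
      rcases hq with h | h
      · refine ⟨?_, (hc i q h.1).1⟩
        by_contra hle
        apply h.2
        exact hX i q h.1 (mem_uIcc.2 (.inl ⟨(hc i q h.1).2, not_lt.1 hle⟩))
      · exact absurd h.1 hne)
    rw [VM1_comp (fun i q hq => (hc i q hq).1.ne)] at s2
    exact s1.trans s2
  | succ n ih =>
    intro X x0 v hn h0 hX
    have hne : ((cols X).filter (· < x0)).Nonempty := by rw [← Finset.card_pos]; omega
    set l := ((cols X).filter (· < x0)).min' hne with hl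
    have hlm := Finset.min'_mem _ hne
    rw [← hl, Finset.mem_filter] at hlm
    have hll : ∀ c ∈ cols X, l ≤ c := by
      intro c hc
      by_cases h : c < x0
      · exact Finset.min'_le _ _ (by simp [hc, h])
      · linarith
    obtain ⟨W, hW⟩ : ∃ W, ∀ c ∈ insert x0 (insert v (cols X)), c < W := by
      obtain ⟨M, hM⟩ := (insert x0 (insert v (cols X))).finite_toSet.bddAbove
      exact ⟨M + 1, fun c hc => (hM hc).trans_lt (by linarith)⟩
    have hv := hW v (by simp)
    have hx := hW x0 (by simp)
    have lW := hlm.2.trans hx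
    have hc : ∀ i, ∀ q ∈ X i, q.1 < W ∧ l ≤ q.1 := fun i q hq =>
      ⟨hW q.1 (by simp only [Finset.mem_insert, mem_cols]; exact .inr (.inr ⟨i, q, hq, rfl⟩)), hll _ (mem_cols.2 ⟨i, q, hq, rfl⟩)⟩
    have lv : l < v := by
      obtain ⟨i, q, hq, hq'⟩ := mem_cols.1 hlm.1
      by_contra h
      have := hX i q hq (mem_uIcc.2 (.inr ⟨by rw [hq']; linarith, by rw [hq']; exact hlm.2.le⟩))
      rw [hq'] at this; linarith [hlm.2]
    have s1 := EU_cl X l W lW (fun i q hq hne => ⟨lt_of_le_of_ne (hc i q hq).2 (Ne.symm hne), (hc i q hq).1⟩)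
    have hvX : ∀ i, ∀ q ∈ X i, q.1 ≠ v := fun i q hq he => h0 ((hX i q hq (he ▸ right_mem_uIcc)).symm.trans he)
    have s2 := ih (VM1 l W X) x0 v (by
      have : (cols (VM1 l W X)).filter (· < x0) = ((cols X).filter (· < x0)).erase l := by
        ext c
        simp only [Finset.mem_filter, Finset.mem_erase, mem_cols, VM1_mem]
        constructor
        · rintro ⟨⟨i, q, h | h, rfl⟩, h'⟩
          · exact ⟨h.2, ⟨i, q, h.1, rfl⟩, h'⟩
          · linarith [h.1]
        · rintro ⟨h1, ⟨i, q, h, rfl⟩, h'⟩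
          exact ⟨⟨i, q, .inl ⟨h, h1⟩, rfl⟩, h'⟩
      rw [this, Finset.card_erase_of_mem (by simp [hlm]), hn]; rfl) h0 (by
      intro i q hq hq'
      rw [VM1_mem] at hq
      rcases hq with h | h
      · exact hX i q h.1 hq'
      · rw [h.1, mem_uIcc] at hq'
        rcases hq' with h | h <;> linarith [h.1, h.2])
    have s3 := EU_cr (VM1 x0 v (VM1 l W X)) W l lW (by
      intro i q hq hne
      simp only [VM1_mem] at hq
      rcases hq with ⟨h | h, h'⟩ | ⟨h', h | h⟩
      · exact ⟨lt_of_le_of_ne (hc i q h.1).2 (Ne.symm h.2), (hc i q h.1).1⟩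
      · exact absurd h.1 hne
      · rw [h']; exact ⟨lv, hv⟩
      · rw [h']; exact ⟨lv, hv⟩)
    have heq : VM1 W l (VM1 x0 v (VM1 l W X)) = VM1 x0 v X := by
      ext i q
      obtain ⟨a, b⟩ := q
      simp only [VM1_mem]
      have c1 := hc i
      have c2 := hvX i
      have c3 := hlm.2
      constructor
      · rintro (⟨(⟨h | h, h'⟩ | ⟨h', h | h⟩), h4⟩ | ⟨h', ⟨h | h, h4⟩ | ⟨h4, h5⟩⟩)
        · exact .inl ⟨h.1, h'⟩
        · exact absurd h.1 h4
        · exact .inr ⟨h', h.1⟩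
        · exact absurd h.1 hx.ne
        · exact absurd rfl ((c1 _ h.1).1.ne)
        · subst h'; exact .inl ⟨h.2, c3.ne⟩
        · exact absurd h4 hv.ne'
      · rintro (⟨h, h'⟩ | ⟨h, h'⟩)
        · by_cases hal : a = l
          · subst hal; exact .inr ⟨rfl, .inl ⟨.inr ⟨trivial, h⟩, hx.ne'⟩⟩
          · exact .inl ⟨.inl ⟨.inl ⟨h, hal⟩, h'⟩, (c1 _ h).1.ne⟩
        · subst h; exact .inl ⟨.inr ⟨rfl, .inl ⟨h', c3.ne'⟩⟩, hv.ne⟩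
    rw [heq] at s3
    exact (s1.trans s2).trans s3

lemma EU_swap (X : Unit → Finset Pt) (x1 x2 : ℝ) (h : x1 ≠ x2) (e1 : ∃ p ∈ X (), p.1 = x1) (e2 : ∃ p ∈ X (), p.1 = x2)
    (hno : ∀ q ∈ X (), ¬ Bet x1 q.1 x2) (hN : NI (RW X x1) (RW X x2)) : EU X (VS x1 x2 X) := by
  intro hR
  have hR' : IsDiagram (VS x1 x2 X ()) := diag_swapv hR
  refine ⟨hR', .single (.inr (.inl ⟨hR, hR', _, .inl ⟨x1, x2, h, e1, e2, ?_, ?_, ?_, rfl⟩, rfl⟩))⟩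
  · intro p hp; rw [← Bet_iff]; exact hno p hp
  · intro p hp q hq h1 h2
    exact hN.1 _ ⟨(), by rw [← h1]; exact hp⟩ _ ⟨(), by rw [← h2]; exact hq⟩
  · intro p hp p' hp' q hq q' hq' h1 h1' h2 h2'
    rw [not_or]
    exact hN.2 _ ⟨(), by rw [← h1]; exact hp⟩ _ ⟨(), by rw [← h1']; exact hp'⟩ _ ⟨(), by rw [← h2]; exact hq⟩ _ ⟨(), by rw [← h2']; exact hq'⟩

lemma EU_single : SinglePass EU := by
  intro X x0 v x2 hb hX hN
  have n02 : x0 ≠ x2 := by rintro rfl; rcases hb with h | h <;> linarith [h.1]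
  have n2v : x2 ≠ v := by rintro rfl; rcases hb with h | h <;> linarith [h.1, h.2]
  have n0v : x0 ≠ v := by rintro rfl; rcases hb with h | h <;> linarith [h.1, h.2]
  by_cases e1 : ∃ p ∈ X (), p.1 = x0
  swap
  · rw [VM1_id]; exact EU.refl _
    rintro ⟨⟩ q hq h; exact e1 ⟨q, hq, h⟩
  by_cases e2 : ∃ p ∈ X (), p.1 = x2
  swap
  · refine EU_rep _ X x0 v rfl n0v ?_
    rintro ⟨⟩ q hq h
    exact (hX _ q hq h).resolve_right fun h => e2 ⟨q, hq, h⟩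
  have sub1 : ∀ c, c ∈ uIcc x2 v → c ∈ uIcc x0 v := fun c hc => uIcc_subset_uIcc hb.mem right_mem_uIcc hc
  have sub2 : ∀ c, c ∈ uIcc x0 x2 → c ∈ uIcc x0 v := fun c hc => uIcc_subset_uIcc left_mem_uIcc hb.mem hc
  have x0n : x0 ∉ uIcc x2 v := by
    rw [mem_uIcc]; rcases hb with h | h <;> rintro (h' | h') <;> linarith [h.1, h.2, h'.1, h'.2]
  have vn : v ∉ uIcc x0 x2 := by
    rw [mem_uIcc]; rcases hb with h | h <;> rintro (h' | h') <;> linarith [h.1, h.2, h'.1, h'.2]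
  have fv : ∀ i, ∀ q ∈ X i, q.1 ≠ v := fun i q hq he => by
    rcases hX i q hq (he ▸ right_mem_uIcc) with h | h
    · exact n0v (h.symm.trans he)
    · exact n2v (h.symm.trans he)
  have s1 := EU_swap X x0 x2 n02 e1 e2 (by
    intro q hq h
    rcases hX _ q hq (sub2 _ h.mem) with h' | h' <;> rw [h'] at h <;> rcases h with h | h <;> linarith [h.1, h.2]) hN
  have s2 := EU_rep _ (VS x0 x2 X) x2 v rfl n2v (by
    intro i q hq hq'
    rw [VS_mem n02] at hq
    rcases hq with h | h | h
    · rcases hX i q h.1 (sub1 _ hq') with h' | h'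
      · exact absurd h' h.2.1
      · exact h'
    · exact h.1
    · rw [h.1] at hq'; exact absurd hq' x0n)
  have s3 := EU_rep _ (VM1 x2 v (VS x0 x2 X)) x0 x2 rfl n02 (by
    intro i q hq hq'
    rw [VM1_mem, VS_mem n02, VS_mem n02] at hq
    rcases hq with ⟨h | h | h, h2⟩ | ⟨h, h2⟩
    · rcases hX i q h.1 (sub2 _ hq') with h' | h'
      · exact h'
      · exact absurd h' h2
    · exact absurd h.1 h2
    · exact h.1
    · rw [h] at hq'; exact absurd hq' vn)
  have heq : VM1 x0 x2 (VM1 x2 v (VS x0 x2 X)) = VM1 x0 v X := by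
    ext i q
    obtain ⟨a, b⟩ := q
    simp only [VM1_mem, VS_mem n02]
    have := fv i
    grind
  rw [heq] at s3
  exact (s1.trans s2).trans s3

theorem VGood_EU : VGood EU where
  tr := fun _ _ _ h h' => h.trans h'
  mv := MP EU (fun _ _ _ h h' => h.trans h') EU_single
  cl := EU_cl
  cr := EU_cr

lemma card_trF (R : Finset Pt) (f : Pt → Prop) :
    ((trF R).filter f).card = (R.filter (fun q => f (q.2, q.1))).card := by
  rw [trF, Finset.filter_image, Finset.card_image_of_injective]
  intro p q h; simpa [Prod.ext_iff, and_comm] using h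

lemma diag_tr {R : Finset Pt} (h : IsDiagram R) : IsDiagram (trF R) := by
  intro p hp
  rw [card_trF, card_trF]
  exact (h _ (mem_trF.1 hp)).symm

lemma all_trF {R : Finset Pt} {P : Pt → Prop} : (∀ p ∈ trF R, P p) ↔ ∀ p ∈ R, P (p.2, p.1) := by
  simp only [trF, Finset.forall_mem_image]
lemma ex_trF {R : Finset Pt} {P : Pt → Prop} : (∃ p ∈ trF R, P p) ↔ ∃ p ∈ R, P (p.2, p.1) := by
  simp only [trF, Finset.exists_mem_image]

lemma trF_img {R : Finset Pt} {f g : Pt → Pt} (h : ∀ p : Pt, g (p.2, p.1) = ((f p).2, (f p).1)) :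
    trF (R.image f) = (trF R).image g := by
  simp only [trF, Finset.image_image]
  congr 1; funext p; simp [h]

lemma stab_tr {t : StabType} {R R' : Finset Pt} (h : StabMove t R R') : StabMove t (trF R) (trF R') := by
  obtain ⟨⟨x, y⟩, h1, h2, x', y', ⟨a, b, c, d, e, f, g, k⟩, ht⟩ := h
  refine ⟨(y, x), diag_tr h1, diag_tr h2, y', x', ⟨mem_trF.2 a, c, b, all_trF.2 e, all_trF.2 d, all_trF.2 g, all_trF.2 f, ?_⟩, ?_⟩
  · rw [k]; ext ⟨u, v⟩; simp only [mem_trF, mem_stabSet, Prod.mk.injEq, ne_eq]; tauto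
  · rw [ht]; simp only [mul_comm]

lemma leg_tr {t : StabType} {R R' : Finset Pt} (h : LegMove t R R') : LegMove t (trF R) (trF R') := by
  rcases h with ⟨h1, h2, f, h, rfl⟩ | ⟨h1, h2, f, h, rfl⟩ | h | h
  · refine .inl ⟨diag_tr h1, diag_tr h2, ?_⟩
    rcases h with ⟨x0, x1, a, b, rfl⟩ | ⟨x0, x1, a, b, rfl⟩
    · exact ⟨_, .inr ⟨x0, x1, ex_trF.2 a, by simpa only [all_trF] using b, rfl⟩,
        trF_img fun p => by simp only [vmap, hmap]; split_ifs <;> rfl⟩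
    · exact ⟨_, .inl ⟨x0, x1, ex_trF.2 a, by simpa only [all_trF] using b, rfl⟩,
        trF_img fun p => by simp only [vmap, hmap]; split_ifs <;> rfl⟩
  · refine .inr (.inl ⟨diag_tr h1, diag_tr h2, ?_⟩)
    rcases h with ⟨x0, x1, a, b, c, d, e, g, rfl⟩ | ⟨x0, x1, a, b, c, d, e, g, rfl⟩
    · exact ⟨_, .inr ⟨x0, x1, a, ex_trF.2 b, ex_trF.2 c, by simpa only [all_trF] using d, by simpa only [all_trF] using e,
        by simpa only [NoInterleaveH, NoInterleaveV, all_trF] using g, rfl⟩,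
        trF_img fun p => by simp only [swapv, swaph]; split_ifs <;> rfl⟩
    · exact ⟨_, .inl ⟨x0, x1, a, ex_trF.2 b, ex_trF.2 c, by simpa only [all_trF] using d, by simpa only [all_trF] using e,
        by simpa only [NoInterleaveH, NoInterleaveV, all_trF] using g, rfl⟩,
        trF_img fun p => by simp only [swapv, swaph]; split_ifs <;> rfl⟩
  · exact .inr (.inr (.inl (stab_tr h)))
  · exact .inr (.inr (.inr (stab_tr h)))

lemma LegEquiv.tr {R R' : Finset Pt} (h : LegEquiv R R') : LegEquiv (trF R) (trF R') := by
  induction h with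
  | refl => exact .refl
  | tail _ h ih => exact ih.tail (leg_tr h)

lemma EU.tr {X Y : Unit → Finset Pt} (h : EU X Y) : EU (trZ X) (trZ Y) := by
  intro hX
  obtain ⟨a, b⟩ := h (by have := diag_tr hX; simpa [trZ, trF_trF] using this)
  exact ⟨diag_tr a, b.tr⟩

-- single-diagram versions
lemma row_rep {R R' : Finset Pt} {y0 y1 : ℝ} (hR : IsDiagram R) (h : y0 ≠ y1) (f : ∀ q ∈ R, q.2 ≠ y1)
    (b : ∀ q ∈ R, ¬ Bet y0 q.2 y1)
    (hR' : ∀ q, q ∈ R' ↔ (q ∈ R ∧ q.2 ≠ y0) ∨ (q.2 = y1 ∧ (q.1, y0) ∈ R)) :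
    IsDiagram R' ∧ LegEquiv R R' := by
  have := (VGood_EU.mv (fun _ => trF R) y0 y1 h (fun _ q hq => f _ (mem_trF.1 hq)) (by
    intro c hc
    have : RW (fun _ : Unit => trF R) c = ∅ := by
      ext x; simp only [RW, Set.mem_ofPred_eq, Set.mem_empty_iff_false, iff_false]
      rintro ⟨-, hx⟩; exact b _ (mem_trF.1 hx) hc
    rw [this]; exact NI_empty)).tr
  have e2 : trZ (VM1 y0 y1 fun _ : Unit => trF R) = fun _ => R' := by
    ext i q; simp only [trZ, mem_trF, VM1_mem, hR']
  rw [e2] at this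
  simp only [EU, trZ, trF_trF] at this
  exact this hR

def UI (I : Finset (Fin 4)) (Z : Fin 4 → Finset Pt) : Finset Pt := I.biUnion Z
lemma mem_UI {I : Finset (Fin 4)} {Z : Fin 4 → Finset Pt} {p : Pt} : p ∈ UI I Z ↔ ∃ i ∈ I, p ∈ Z i := by simp [UI]

lemma UI_VM1 (I : Finset (Fin 4)) (x0 v : ℝ) (X : Fin 4 → Finset Pt) :
    (fun _ : Unit => UI I (VM1 x0 v X)) = VM1 x0 v (fun _ => UI I X) := by
  ext i p
  simp only [mem_UI, VM1_mem]
  constructor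
  · rintro ⟨i, hi, h | h⟩
    · exact .inl ⟨⟨i, hi, h.1⟩, h.2⟩
    · exact .inr ⟨h.1, i, hi, h.2⟩
  · rintro (⟨⟨i, hi, h⟩, h'⟩ | ⟨h', i, hi, h⟩)
    · exact ⟨i, hi, .inl ⟨h, h'⟩⟩
    · exact ⟨i, hi, .inr ⟨h', h⟩⟩

lemma UI_tr (I : Finset (Fin 4)) (X : Fin 4 → Finset Pt) : UI I (trZ X) = trF (UI I X) := by
  ext p; simp [mem_UI, mem_trF, trZ]

def EI (I : Finset (Fin 4)) (X Y : Fin 4 → Finset Pt) : Prop := EU (fun _ => UI I X) (fun _ => UI I Y)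
def EI1 (I : Finset (Fin 4)) (X Y : Fin 4 → Finset Pt) : Prop :=
  IsDiagram (UI I X) → IsDiagram (UI I Y) → LegEquiv (UI I X) (UI I Y)

lemma VGood_EI (I : Finset (Fin 4)) : VGood (EI I) where
  tr := fun _ _ _ h h' => h.trans h'
  mv := by
    intro X x0 v h hv hn
    rw [EI, UI_VM1]
    refine VGood_EU.mv _ x0 v h (fun _ q hq => ?_) (fun c hc => (hn c hc).mono ?_ ?_)
    · obtain ⟨i, -, hq⟩ := mem_UI.1 hq; exact hv i q hq
    · rintro y ⟨_, hy⟩; obtain ⟨i, -, hq⟩ := mem_UI.1 hy; exact ⟨i, hq⟩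
    · rintro y ⟨_, hy⟩; obtain ⟨i, -, hq⟩ := mem_UI.1 hy; exact ⟨i, hq⟩
  cl := by
    intro X x0 v h hv
    rw [EI, UI_VM1]
    refine VGood_EU.cl _ x0 v h (fun _ q hq => ?_)
    obtain ⟨i, -, hq⟩ := mem_UI.1 hq; exact hv i q hq
  cr := by
    intro X x0 v h hv
    rw [EI, UI_VM1]
    refine VGood_EU.cr _ x0 v h (fun _ q hq => ?_)
    obtain ⟨i, -, hq⟩ := mem_UI.1 hq; exact hv i q hq

lemma EI.tr {I : Finset (Fin 4)} {X Y : Fin 4 → Finset Pt} (h : EI I X Y) : EI I (trZ X) (trZ Y) := by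
  have := EU.tr h
  simp only [EI, UI_tr]; exact this

lemma EI1.tr {I : Finset (Fin 4)} {X Y : Fin 4 → Finset Pt} (h : EI1 I X Y) : EI1 I (trZ X) (trZ Y) := by
  intro a b
  rw [UI_tr] at *
  rw [UI_tr] at *
  have a' := diag_tr a; have b' := diag_tr b
  rw [trF_trF] at a' b'
  exact (h a' b').tr

lemma EI_st {I : Finset (Fin 4)} {Z : Fin 4 → Finset Pt} {j0 : Fin 4} {x y x' y' : ℝ} (H : StCond Z j0 x y x' y')
    (h1 : IsDiagram (UI I Z)) (h2 : IsDiagram (UI I (SM Z j0 x y x' y'))) :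
    UI I (SM Z j0 x y x' y') = UI I Z ∨ StabMove .I (UI I Z) (UI I (SM Z j0 x y x' y')) := by
  by_cases hj : j0 ∈ I
  · right
    have s : ∀ q ∈ UI I Z, ∃ j, q ∈ Z j := fun q hq => by obtain ⟨i, -, h⟩ := mem_UI.1 hq; exact ⟨i, h⟩
    refine ⟨(x, y), h1, h2, x', y', ⟨mem_UI.2 ⟨_, hj, H.mem⟩, H.hx, H.hy, fun p hp => (s p hp).elim fun j h => H.fx j p h,
      fun p hp => (s p hp).elim fun j h => H.fy j p h, fun p hp => (s p hp).elim fun j h => Bet_iff.not.1 (H.bx j p h),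
      fun p hp => (s p hp).elim fun j h => Bet_iff.not.1 (H.by' j p h), ?_⟩, by simpa using H.ty⟩
    ext p
    simp only [mem_UI, mem_SM, mem_stabSet]
    constructor
    · rintro ⟨i, hi, ⟨h, h'⟩ | ⟨-, h⟩⟩
      · refine .inr (.inr (.inr ⟨?_, i, hi, h⟩))
        rintro rfl
        by_cases e : i = j0
        · exact h' ⟨e, rfl⟩
        · exact H.ux i e h
      · tauto
    · rintro (h | h | h | ⟨h, i, hi, h'⟩)
      · exact ⟨j0, hj, .inr ⟨rfl, .inl h⟩⟩
      · exact ⟨j0, hj, .inr ⟨rfl, .inr (.inl h)⟩⟩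
      · exact ⟨j0, hj, .inr ⟨rfl, .inr (.inr h)⟩⟩
      · exact ⟨i, hi, .inl ⟨h', fun h2 => h h2.2⟩⟩
  · left
    refine Finset.biUnion_congr rfl fun i hi => ?_
    simp only [SM]; rw [if_neg]; rintro rfl; exact hj hi

lemma nl_step {C R R' : Finset Pt} {xn xk xl y0 y1 : ℝ} (hR : IsDiagram R)
    (mR : ∀ p, p ∈ R ↔ p ∈ C ∨ p = (xn, y0) ∨ p = (xl, y0))
    (mR' : ∀ p, p ∈ R' ↔ p ∈ C ∨ p = (xn, y1) ∨ p = (xk, y1) ∨ p = (xl, y0) ∨ p = (xk, y0))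
    (hR' : IsDiagram R') (c1 : ∀ p ∈ C, p.1 ≠ xk) (c2 : ∀ p ∈ C, p.2 ≠ y0) (c3 : ∀ p ∈ C, p.2 ≠ y1)
    (c4 : ∀ p ∈ C, ¬ Bet y0 p.2 y1)
    (hs : 0 < (xk - xn) * (y1 - y0)) (hl : ¬ Bet xn xl xk) (hl1 : xl ≠ xn) (hl2 : xl ≠ xk) : LegEquiv R R' := by
  have hy : y0 ≠ y1 := by rintro rfl; simp at hs
  have hx : xn ≠ xk := by rintro rfl; simp at hs
  obtain ⟨x', hb, hx'⟩ : ∃ x', Bet xn x' xk ∧ ∀ p ∈ R, ¬ Bet xn p.1 x' ∧ p.1 ≠ x' := by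
    rcases lt_or_gt_of_ne hx with h | h
    · obtain ⟨v, h1, h2⟩ := exists_right (insert xk (R.image Prod.fst)) xn
      refine ⟨v, .inl ⟨h1, h2 _ (by simp) h⟩, fun p hp => ?_⟩
      have := h2 p.1 (Finset.mem_insert_of_mem (Finset.mem_image_of_mem _ hp))
      refine ⟨?_, ?_⟩
      · rintro (h | h) <;> linarith [this (by linarith [h.1]), h.1, h.2]
      · intro e; linarith [this (by linarith)]
    · obtain ⟨v, h1, h2⟩ := exists_right ((insert xk (R.image Prod.fst)).image (-·)) (-xn)
      refine ⟨-v, .inr ⟨?_, by linarith⟩, fun p hp => ?_⟩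
      · linarith [h2 (-xk) (by simp) (by linarith)]
      have := h2 (-p.1) (Finset.mem_image_of_mem _ (Finset.mem_insert_of_mem (Finset.mem_image_of_mem _ hp)))
      refine ⟨?_, ?_⟩
      · rintro (h | h) <;> linarith [this (by linarith [h.1]), h.1, h.2]
      · intro e; linarith [this (by linarith)]
  have x'n : x' ≠ xn := by rintro rfl; rcases hb with h | h <;> linarith [h.1, h.2]
  have x'k : x' ≠ xk := by rintro rfl; rcases hb with h | h <;> linarith [h.1, h.2]
  have x'l : xl ≠ x' := (hx' (xl, y0) ((mR _).2 (by simp))).2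
  have x'C : ∀ p ∈ C, p.1 ≠ x' := fun p hp => (hx' p ((mR _).2 (.inl hp))).2
  have eW : (fun _ : Unit => stabSet xn y0 x' y1 R) = VM1 xk x' (fun _ => R') := by
    ext i ⟨u, v⟩
    have a := c1 (u, v); have b := c1 (xk, v); have b2 := c2 (u, v)
    simp only [mem_stabSet, VM1_mem, mR, mR', Prod.mk.injEq, ne_eq] at *
    grind
  have dW : IsDiagram (stabSet xn y0 x' y1 R) := by
    have : IsDiagram (VM1 xk x' (fun _ : Unit => R') ()) := diag_vmap hR' (by
      intro q hq _
      rcases (mR' q).1 hq with h | rfl | rfl | rfl | rfl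
      · exact x'C q h
      · exact x'n.symm
      · exact x'k.symm
      · exact x'l
      · exact x'k.symm)
    rwa [← eW] at this
  have s1 : LegEquiv R (stabSet xn y0 x' y1 R) := by
    refine .single (.inr (.inr (.inl ⟨(xn, y0), hR, dW, x', y1, ⟨(mR _).2 (by simp), x'n.symm, hy, fun p hp => (hx' p hp).2, ?_, 
      fun p hp => Bet_iff.not.1 (hx' p hp).1, ?_, rfl⟩, ?_⟩)))
    · intro p hp
      rcases (mR p).1 hp with h | rfl | rfl
      · exact c3 p h
      · exact hy
      · exact hy
    · intro p hp
      rw [← Bet_iff]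
      rcases (mR p).1 hp with h | rfl | rfl
      · exact c4 p h
      · rintro (h | h) <;> linarith [h.1, h.2]
      · rintro (h | h) <;> linarith [h.1, h.2]
    · simp only [true_iff]
      rcases hb with h | h
      · have : 0 < y1 - y0 := pos_of_mul_pos_right hs (by linarith)
        nlinarith
      · have : y1 - y0 < 0 := by by_contra hc; nlinarith
        nlinarith
  have s2 := VGood_EU.mv (fun _ => stabSet xn y0 x' y1 R) x' xk x'k (by
      intro _ p hp
      rw [mem_stabSet, mR] at hp
      rcases hp with rfl | rfl | rfl | ⟨-, h | rfl | rfl⟩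
      · exact x'k
      · exact hx
      · exact x'k
      · exact c1 p h
      · exact hx
      · exact hl2) (by
      intro c hc
      have hcn : c ≠ xn := by rintro rfl; rcases hc with h | h <;> rcases hb with h' | h' <;> linarith [h.1, h.2, h'.1, h'.2]
      refine (NI_out (u := y0) (v := y1) ?_ ?_)
      · rintro y ⟨_, hy'⟩
        rw [mem_stabSet, mR] at hy'
        simp only [Prod.mk.injEq] at hy'
        rcases hy' with h | h | h | ⟨-, h | h | h⟩
        · rw [h.2]; exact left_mem_uIcc
        · exact absurd h.1 x'n
        · rw [h.2]; exact right_mem_uIcc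
        · exact absurd rfl (x'C _ h)
        · exact absurd h.1 x'n
        · exact absurd h.1.symm x'l
      · rintro y ⟨_, hy'⟩ hm
        rw [mem_stabSet, mR] at hy'
        simp only [Prod.mk.injEq] at hy'
        have cx : c ≠ x' := by rintro rfl; rcases hc with h | h <;> linarith [h.1, h.2]
        rcases hy' with h | h | h | ⟨-, h | h | h⟩
        · exact cx h.1
        · exact hcn h.1
        · exact cx h.1
        · have a2 := c2 _ h; have a3 := c3 _ h; have a4 := c4 _ h
          simp only at a2 a3 a4
          apply a4
          rcases mem_uIcc.1 hm with hm | hm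
          · exact .inl ⟨lt_of_le_of_ne hm.1 (Ne.symm a2), lt_of_le_of_ne hm.2 a3⟩
          · exact .inr ⟨lt_of_le_of_ne hm.1 (Ne.symm a3), lt_of_le_of_ne hm.2 a2⟩
        · exact hcn h.1
        · rw [h.1] at hc
          apply hl; rcases hc with h | h <;> rcases hb with h' | h' <;> first | (exfalso; linarith [h.1, h.2, h'.1, h'.2]) | exact .inl ⟨by linarith, by linarith⟩ | exact .inr ⟨by linarith, by linarith⟩)
  rw [eW, VM1_comp, VM1_self, ← eW] at s2
  have s3 := (s2 dW).2
  · exact s1.trans s3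
  · intro i q hq
    rcases (mR' q).1 hq with h | rfl | rfl | rfl | rfl
    · exact x'C q h
    · exact x'n.symm
    · exact x'k.symm
    · exact x'l
    · exact x'k.symm

lemma or_aux1 {a b c d e : Prop} : (a ∨ (b ∨ c) ∨ (d ∨ e)) ↔ (a ∨ b ∨ c ∨ d ∨ e) := by tauto
lemma or_aux2 {a b c d e : Prop} : (a ∨ (b ∨ c) ∨ (d ∨ e)) ↔ (a ∨ d ∨ e ∨ b ∨ c) := by tauto

lemma EI_es {I : Finset (Fin 4)} {B Z Z' : Fin 4 → Finset Pt} {jn jk jl : Fin 4} {xn xk xl y0 y1 q : ℝ}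
    (H : ESC B Z Z' jn jk jl xn xk xl y0 y1 q) : EI1 I Z Z' := by
  intro d1 d2
  obtain ⟨-, -, -, B1, B2, B3, B4, q0, q1, qb, od, hZ, hZ'⟩ := H
  have hy : y0 ≠ y1 := by rintro rfl; rcases od with h | h <;> linarith [h.1]
  have nk : xn ≠ xk ∧ xl ≠ xn ∧ xl ≠ xk := by
    refine ⟨?_, ?_, ?_⟩ <;> rintro rfl <;> rcases od with ⟨_, h | h | h⟩ | ⟨_, h | h | h⟩ <;> linarith [h.1, h.2]
  have e1 : ∀ p, p ∈ UI I Z ↔ p ∈ UI I B ∨ (jn ∈ I ∧ p = (xn, y0)) ∨ (jl ∈ I ∧ p = (xl, y0)) ∨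
      (jk ∈ I ∧ (p = (xk, y0) ∨ p = (xk, q))) := by
    intro p; simp only [mem_UI, hZ]; grind
  have e2 : ∀ p, p ∈ UI I Z' ↔ p ∈ UI I B ∨ (jn ∈ I ∧ (p = (xn, y1) ∨ p = (xk, y1))) ∨
      (jl ∈ I ∧ (p = (xl, y0) ∨ p = (xk, y0))) ∨ (jk ∈ I ∧ p = (xk, q)) := by
    intro p; simp only [mem_UI, hZ']; grind
  have b : ∀ p ∈ UI I B, p.1 ≠ xk ∧ p.2 ≠ y0 ∧ p.2 ≠ y1 ∧ ¬ Bet y0 p.2 y1 := by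
    intro p hp
    obtain ⟨i, -, h⟩ := mem_UI.1 hp
    exact ⟨B1 i p h, B2 i p h, B3 i p h, B4 i p h⟩
  have nb : ¬ Bet y0 y0 y1 := by rintro (h | h) <;> linarith [h.1, h.2]
  have one : ∀ x, (x, y0) ∈ UI I Z → (∀ p ∈ UI I Z, p.2 = y0 → p = (x, y0)) → False := by
    intro x hx h
    have := (d1 _ hx).2
    rw [show (UI I Z).filter (fun q => q.2 = (x, y0).2) = {(x, y0)} from ?_] at this
    · simp at this
    · ext p; simp only [Finset.mem_filter, Finset.mem_singleton]
      exact ⟨fun h' => h p h'.1 h'.2, fun h' => by rw [h']; exact ⟨hx, rfl⟩⟩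
  by_cases fn : jn ∈ I <;> by_cases fk : jk ∈ I <;> by_cases fl : jl ∈ I <;>
    simp only [fn, fk, fl, true_and, false_and, or_false, false_or] at e1 e2
  · have := three_le (F := (UI I Z).filter (fun q => q.2 = (xn, y0).2)) (p := (xn, y0)) (q := (xk, y0)) (r := (xl, y0))
      (by simp [e1]) (by simp [e1]) (by simp [e1]) (by simp [nk.1]) (by simp [nk.2.1.symm]) (by simp [nk.2.2.symm])
    rw [(d1 (xn, y0) ((e1 _).2 (by simp))).2] at this
    omega
  · refine (row_rep d1 hy ?_ ?_ ?_).2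
    · intro p hp
      rcases (e1 p).1 hp with h | rfl | rfl | rfl
      exacts [(b p h).2.2.1, hy, hy, q1]
    · intro p hp
      rcases (e1 p).1 hp with h | rfl | rfl | rfl
      exacts [(b p h).2.2.2, nb, nb, qb]
    · rintro ⟨u, v⟩
      have b1 := b (u, v); have b2 := b (u, y0)
      simp only [e1, e2, Prod.mk.injEq] at *
      grind
  · have A : ∀ {R xn' xl' y0' y1'}, IsDiagram R → (∀ p, p ∈ R ↔ p ∈ UI I B ∨ p = (xn', y0') ∨ p = (xl', y0')) →
        (∀ p, p ∈ UI I Z' ↔ p ∈ UI I B ∨ p = (xn', y1') ∨ p = (xk, y1') ∨ p = (xl', y0') ∨ p = (xk, y0')) →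
        (∀ p ∈ UI I B, p.2 ≠ y0') → (∀ p ∈ UI I B, p.2 ≠ y1') → (∀ p ∈ UI I B, ¬ Bet y0' p.2 y1') →
        0 < (xk - xn') * (y1' - y0') → ¬ Bet xn' xl' xk → xl' ≠ xn' → xl' ≠ xk → LegEquiv R (UI I Z') :=
      fun hR m m' c2 c3 c4 => nl_step hR m m' d2 (fun p hp => (b p hp).1) c2 c3 c4
    have e2' : ∀ p, p ∈ UI I Z' ↔ p ∈ UI I B ∨ p = (xn, y1) ∨ p = (xk, y1) ∨ p = (xl, y0) ∨ p = (xk, y0) := fun p =>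
      (e2 p).trans or_aux1
    by_cases cA : 0 < (xk - xn) * (y1 - y0) ∧ ¬ Bet xn xl xk
    · exact A d1 e1 e2' (fun p hp => (b p hp).2.1) (fun p hp => (b p hp).2.2.1) (fun p hp => (b p hp).2.2.2) cA.1 cA.2 nk.2.1 nk.2.2
    · have cB : 0 < (xk - xl) * (y0 - y1) ∧ ¬ Bet xl xn xk := by
        have nB : ∀ {x y z : ℝ}, (y < x ∧ y < z) ∨ (x < y ∧ z < y) → ¬ Bet x y z := by
          rintro x y z (h | h) (h' | h') <;> linarith [h.1, h.2, h'.1, h'.2]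
        rcases od with ⟨h0, h | h | h⟩ | ⟨h0, h | h | h⟩
        · exact absurd ⟨mul_pos (by linarith) (by linarith), nB (.inr ⟨by linarith, h.2⟩)⟩ cA
        · exact absurd ⟨mul_pos (by linarith) (by linarith), nB (.inl ⟨h.1, by linarith⟩)⟩ cA
        · exact ⟨mul_pos_of_neg_of_neg (by linarith) (by linarith), nB (.inr ⟨h.2, by linarith⟩)⟩
        · exact ⟨mul_pos (by linarith) (by linarith), nB (.inl ⟨h.1, by linarith⟩)⟩
        · exact absurd ⟨mul_pos_of_neg_of_neg (by linarith) (by linarith), nB (.inr ⟨h.2, by linarith⟩)⟩ cA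
        · exact absurd ⟨mul_pos_of_neg_of_neg (by linarith) (by linarith), nB (.inl ⟨by linarith, h.1⟩)⟩ cA
      have mR : ∀ p, p ∈ (UI I B ∪ {(xl, y1), (xn, y1)}) ↔ p ∈ UI I B ∨ p = (xl, y1) ∨ p = (xn, y1) := by
        intro p; simp only [Finset.mem_union, Finset.mem_insert, Finset.mem_singleton]
      obtain ⟨dR, s⟩ := row_rep (R' := UI I B ∪ {(xl, y1), (xn, y1)}) d1 hy (by
        intro p hp
        rcases (e1 p).1 hp with h | rfl | rfl
        exacts [(b p h).2.2.1, hy, hy]) (by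
        intro p hp
        rcases (e1 p).1 hp with h | rfl | rfl
        exacts [(b p h).2.2.2, nb, nb]) (by
        rintro ⟨u, v⟩
        have b1 := b (u, v); have b2 := b (u, y0)
        simp only [e1, mR, Prod.mk.injEq] at *
        grind)
      exact s.trans (A dR mR (fun p => (e2 p).trans or_aux2) (fun p hp => (b p hp).2.2.1) (fun p hp => (b p hp).2.1)
        (fun p hp h => (b p hp).2.2.2 h.symm) cB.1 cB.2 nk.2.1.symm nk.1)
  · exact (one xn ((e1 _).2 (by simp)) fun p hp h => ((e1 p).1 hp).resolve_left fun h' => (b p h').2.1 h).elim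
  · rw [show UI I Z = UI I Z' from ?_]
    · exact .refl
    · ext p; rw [e1, e2]; tauto
  · refine (one xk ((e1 _).2 (by simp)) fun p hp h => ?_).elim
    rcases (e1 p).1 hp with h' | h' | rfl
    exacts [absurd h (b p h').2.1, h', absurd h q0]
  · exact (one xl ((e1 _).2 (by simp)) fun p hp h => ((e1 p).1 hp).resolve_left fun h' => (b p h').2.1 h).elim
  · rw [show UI I Z = UI I Z' from ?_]
    · exact .refl
    · ext p; rw [e1, e2]

theorem TGood_EI (I : Finset (Fin 4)) : TGood (EI I) (EI1 I) where
  v := VGood_EI I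
  h := by
    have g := VGood_EI I
    exact ⟨fun X Y Z h h' => h.trans h', fun X x0 v a b c => (g.mv X x0 v a b c).tr,
      fun X x0 v a b => (g.cl X x0 v a b).tr, fun X x0 v a b => (g.cr X x0 v a b).tr⟩
  imp := fun _ _ h a _ => (h a).2
  rf := fun _ _ _ => .refl
  st := fun Z j x y x' y' H a b => by
    rcases EI_st H a b with h | h
    · rw [h]; exact .refl
    · exact .single (.inr (.inr (.inl h)))
  sti := fun Z j x y x' y' H a b => by
    rcases EI_st H b a with h | h
    · rw [h]; exact .refl
    · exact .single (.inr (.inr (.inr h)))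
  es := fun B Z Z' _ _ _ _ _ _ _ _ _ h => EI_es h
  est := fun B Z Z' _ _ _ _ _ _ _ _ _ h => (EI_es h).tr

lemma UI_line {T : Theta} (hT : ThetaOK T) {I : Finset (Fin 4)} (hI : I = {0, 1} ∨ I = {0, 2, 3}) {f : Pt → ℝ}
    (hf : f = Prod.fst ∨ f = Prod.snd) {p : Pt} (hp : p ∈ UI I (Zt T)) :
    ((UI I (Zt T)).filter (fun q => f q = f p)).card = 2 := by
  have hsum : ((UI I (Zt T)).filter (fun q => f q = f p)).card = ∑ j ∈ I, ((Zt T j).filter (fun q => f q = f p)).card := by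
    rw [UI, Finset.filter_biUnion, Finset.card_biUnion]
    intro i _ j _ hij
    exact Finset.disjoint_filter_filter (Zt_disj hT hij)
  set c : Fin 4 → ℕ := fun j => ((Zt T j).filter (fun q => f q = f p)).card with hc
  have c3 : c 3 = 2 ∨ c 3 = 0 := diag_card hT.2.2.2.1 hf _
  have cp : ∀ j, j ≠ 3 → c j ≤ 2 := fun j hj => path_card (Zt_path hT hj).1 hf _
  have ce : ∀ j, j ≠ 3 → (c j = 1 ↔ c 0 = 1) := by
    intro j hj
    have e := (Zt_path hT hj).2
    rcases hf with rfl | rfl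
    · have := congrArg ((true, p.1) ∈ ·) e
      simp only [mem_Ends_true, eq_iff_iff] at this; exact this
    · have := congrArg ((false, p.2) ∈ ·) e
      simp only [mem_Ends_false, eq_iff_iff] at this; exact this
  have cg : ∀ i j, i ≠ j → c i ≠ 0 → c j ≠ 0 → c 0 = 1 ∧ i ≠ 3 ∧ j ≠ 3 := by
    intro i j hij hi hj
    obtain ⟨u, hu⟩ := Finset.card_pos.1 (Nat.pos_of_ne_zero hi)
    obtain ⟨v, hv⟩ := Finset.card_pos.1 (Nat.pos_of_ne_zero hj)
    rw [Finset.mem_filter] at hu hv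
    have := Zt_gp hT hij hu.1 hv.1
    rcases hf with rfl | rfl
    · have := this.1 (hu.2.trans hv.2.symm)
      rw [mem_Ends_true, hu.2] at this; exact this
    · have := this.2 (hu.2.trans hv.2.symm)
      rw [mem_Ends_false, hu.2] at this; exact this
  have cn : ∃ j ∈ I, c j ≠ 0 := by
    obtain ⟨i, hi, h⟩ := mem_UI.1 hp
    exact ⟨i, hi, Finset.card_ne_zero_of_mem (Finset.mem_filter.2 ⟨h, rfl⟩)⟩
  have p0 := cp 0 (by decide); have p1 := cp 1 (by decide); have p2 := cp 2 (by decide)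
  have e1 := ce 1 (by decide); have e2 := ce 2 (by decide)
  have g01 := cg 0 1 (by decide); have g02 := cg 0 2 (by decide); have g03 := cg 0 3 (by decide); have g23 := cg 2 3 (by decide)
  have g13 := cg 1 3 (by decide)
  rw [hsum]
  rcases hI with rfl | rfl
  · simp only [Finset.mem_insert, Finset.mem_singleton, exists_eq_or_imp, exists_eq_left] at cn
    rw [Finset.sum_pair (by decide)]; change c 0 + c 1 = 2; omega
  · simp only [Finset.mem_insert, Finset.mem_singleton, exists_eq_or_imp, exists_eq_left] at cn
    rw [Finset.sum_insert (by decide), Finset.sum_pair (by decide)]; change c 0 + (c 2 + c 3) = 2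
    omega

lemma UI_diag {T : Theta} (hT : ThetaOK T) {I : Finset (Fin 4)} (hI : I = {0, 1} ∨ I = {0, 2, 3}) : IsDiagram (UI I (Zt T)) :=
  fun _ hp => ⟨UI_line hT hI (.inl rfl) hp, UI_line hT hI (.inr rfl) hp⟩

lemma UI01 (T : Theta) : UI {0, 1} (Zt T) = T.a ∪ T.b := by ext p; simp [mem_UI]
lemma UI023 (T : Theta) : UI {0, 2, 3} (Zt T) = T.a ∪ T.c ∪ T.d := by ext p; simp [mem_UI, or_assoc]

lemma move_diag {T T' : Theta} (h : ThMove T T') {I : Finset (Fin 4)} (hI : I = {0, 1} ∨ I = {0, 2, 3}) :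
    IsDiagram (UI I (Zt T)) ∧ IsDiagram (UI I (Zt T')) := by
  have k : ∀ S : Theta, ThetaOK S.tr → IsDiagram (UI I (Zt S)) := fun S h => by
    have := diag_tr (UI_diag h hI)
    rwa [Zt_tr, UI_tr, trF_trF] at this
  rcases h with h | h | h | h | h | h
  on_goal 4 => exact ⟨UI_diag h.2.1 hI, UI_diag h.1 hI⟩
  on_goal 5 => exact ⟨k _ h.1, k _ h.2.1⟩
  all_goals exact ⟨UI_diag h.1 hI, UI_diag h.2.1 hI⟩

lemma equiv_leg {T T' : Theta} (h : ThetaEquiv T T') {I : Finset (Fin 4)} (hI : I = {0, 1} ∨ I = {0, 2, 3}) :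
    LegEquiv (UI I (Zt T)) (UI I (Zt T')) := by
  induction h with
  | refl => exact .refl
  | tail _ h ih => exact ih.trans (TG_move (TGood_EI I) h (move_diag h hI).1 (move_diag h hI).2)

lemma equiv_copy {T T' : Theta} (h : ThetaEquiv T T') : CopyEq (Zt T) (Zt T') := by
  induction h with
  | refl => exact CopyEq.refl _
  | tail _ h ih => exact ih.trans (TG_move TGood_CopyEq h)

def sg (o : Pt → Bool) (p : Pt) : ℤ := if o p = true then 1 else -1
def KK (p q : Pt) : ℤ := if p.1 ≤ q.1 ∧ q.2 < p.2 then 1 else 0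
def QQ (R : Finset Pt) (s : Pt → ℤ) : ℤ := ∑ p ∈ R, ∑ q ∈ R, s p * s q * KK p q

lemma partner {R : Finset Pt} (hR : IsDiagram R) {f : Pt → ℝ} (hf : f = Prod.fst ∨ f = Prod.snd) :
    ∃ v : Pt → Pt, ∀ p ∈ R, v p ∈ R ∧ v p ≠ p ∧ f (v p) = f p ∧ v (v p) = p ∧ ∀ q ∈ R, f q = f p → q = p ∨ q = v p := by
  have : ∀ p, ∃ w, p ∈ R → w ∈ R ∧ w ≠ p ∧ f w = f p ∧ ∀ q ∈ R, f q = f p → q = p ∨ q = w := by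
    intro p
    by_cases hp : p ∈ R
    · have h2 : (R.filter (fun q => f q = f p)).card = 2 := by
        rcases hf with rfl | rfl
        · exact (hR p hp).1
        · exact (hR p hp).2
      have hm : p ∈ R.filter (fun q => f q = f p) := by simp [hp]
      obtain ⟨w, hw⟩ := Finset.card_eq_one.1 (by rw [Finset.card_erase_of_mem hm, h2] : ((R.filter (fun q => f q = f p)).erase p).card = 1)
      have e : ∀ q, (q ≠ p ∧ q ∈ R ∧ f q = f p) ↔ q = w := fun q => by
        simpa [Finset.mem_erase, Finset.mem_filter] using Finset.ext_iff.1 hw q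
      obtain ⟨a, b, c⟩ := (e w).2 rfl
      exact ⟨w, fun _ => ⟨b, a, c, fun q hq hq' => or_iff_not_imp_left.2 fun h => (e q).1 ⟨h, hq, hq'⟩⟩⟩
    · exact ⟨p, fun h => absurd h hp⟩
  choose v hv using this
  refine ⟨v, fun p hp => ?_⟩
  obtain ⟨a, b, c, d⟩ := hv p hp
  obtain ⟨a', b', c', d'⟩ := hv _ a
  exact ⟨a, b, c, ((d _ a' (c'.trans c)).resolve_right b'), d⟩

lemma sum_inv {R : Finset Pt} {v : Pt → Pt} (hv : ∀ p ∈ R, v p ∈ R ∧ v (v p) = p) (F : Pt → ℤ) :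
    ∑ p ∈ R, F (v p) = ∑ p ∈ R, F p :=
  Finset.sum_nbij' v v (fun p hp => (hv p hp).1) (fun p hp => (hv p hp).1) (fun p hp => (hv p hp).2) (fun p hp => (hv p hp).2)
    (fun p hp => rfl)

lemma orient_ne {R : Finset Pt} {o : Pt → Bool} (ho : IsOrientation R o) {f : Pt → ℝ} (hf : f = Prod.fst ∨ f = Prod.snd)
    {p q : Pt} (hp : p ∈ R) (hq : q ∈ R) (h : p ≠ q) (e : f p = f q) : o p ≠ o q := by
  rcases hf with rfl | rfl
  · exact ho p hp q hq h (.inl e)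
  · exact ho p hp q hq h (.inr e)

lemma sg_neg {o : Pt → Bool} {p q : Pt} (h : o p ≠ o q) : sg o p = - sg o q := by
  unfold sg; cases h1 : o p <;> cases h2 : o q <;> simp_all

lemma sg_sq (o : Pt → Bool) (p : Pt) : sg o p * sg o p = 1 := by
  unfold sg; split_ifs <;> rfl

lemma bal {R : Finset Pt} (hR : IsDiagram R) {o : Pt → Bool} (ho : IsOrientation R o) {f : Pt → ℝ}
    (hf : f = Prod.fst ∨ f = Prod.snd) (φ : ℝ → ℤ) : ∑ p ∈ R, sg o p * φ (f p) = 0 := by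
  obtain ⟨v, hv⟩ := partner hR hf
  have := sum_inv (fun p hp => ⟨(hv p hp).1, (hv p hp).2.2.2.1⟩) (fun p => sg o p * φ (f p))
  rw [Finset.sum_congr rfl (g := fun p => -(sg o p * φ (f p)))] at this
  · rw [Finset.sum_neg_distrib] at this; omega
  · intro p hp
    obtain ⟨a, b, c, -⟩ := hv p hp
    rw [c, sg_neg (orient_ne ho hf a hp b c)]; ring

lemma lemA {R : Finset Pt} {o : Pt → Bool} {v : Pt → Pt} (hv : ∀ p ∈ R, v p ∈ R ∧ v (v p) = p ∧ o (v p) ≠ o p) (F : Pt → ℤ) :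
    ∑ a ∈ R, (if o a = true then F a - F (v a) else 0) = ∑ p ∈ R, sg o p * F p := by
  have := sum_inv (fun p hp => ⟨(hv p hp).1, (hv p hp).2.1⟩) (fun p => if o p = true then 0 else F p)
  have e : ∑ p ∈ R, sg o p * F p = ∑ p ∈ R, (if o p = true then F p else 0) - ∑ p ∈ R, (if o p = true then 0 else F p) := by
    rw [← Finset.sum_sub_distrib]
    refine Finset.sum_congr rfl fun p _ => ?_
    unfold sg; split_ifs <;> ring
  rw [e, ← this, ← Finset.sum_sub_distrib]
  refine Finset.sum_congr rfl fun p hp => ?_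
  have := (hv p hp).2.2
  cases h : o p <;> simp_all

lemma XYid {a1 a2 b2 c1 d1 y : ℝ} (f1 : c1 = a1 ↔ y = b2) (f2 : d1 = a1 ↔ y = a2) (hcd : c1 ≠ d1) (hab : a2 ≠ b2) :
    ((if c1 ≤ a1 then (1 : ℤ) else 0) - (if d1 ≤ a1 then 1 else 0)) * ((if y < b2 then (1 : ℤ) else 0) - (if y < a2 then 1 else 0)) =
    -(if min c1 d1 < a1 ∧ a1 < max c1 d1 ∧ min a2 b2 < y ∧ y < max a2 b2 then
      -((if a2 < b2 then (1 : ℤ) else -1) * (if c1 < d1 then (1 : ℤ) else -1)) else 0)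
    - ((if c1 = a1 ∧ y < a2 ∧ c1 < d1 then 1 else 0) + (if d1 = a1 ∧ a2 < b2 ∧ a1 < c1 then 1 else 0)) := by
  simp only [min_lt_iff, lt_max_iff]
  by_cases e1 : c1 = a1
  · have := f1.1 e1; subst e1 this
    have h2 : ¬ d1 = c1 := fun h => hcd h.symm
    rcases lt_or_gt_of_ne hcd with h | h <;> rcases lt_or_gt_of_ne hab with h' | h' <;>
      simp [h, h', h.not_gt, h'.not_gt, h.le, h.not_ge, h2]
  by_cases e2 : d1 = a1
  · have := f2.1 e2; subst e2 this
    rcases lt_or_gt_of_ne hcd with h | h <;> rcases lt_or_gt_of_ne hab with h' | h' <;>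
      simp [h, h', h.not_gt, h'.not_gt, h.le, h.not_ge, e1]
  have e3 := e1; have e4 := e2
  rw [f1] at e3; rw [f2] at e4
  rcases lt_or_gt_of_ne e1 with h1 | h1 <;> rcases lt_or_gt_of_ne e2 with h2 | h2 <;>
    rcases lt_or_gt_of_ne e3 with h3 | h3 <;> rcases lt_or_gt_of_ne e4 with h4 | h4 <;>
    simp [h1, h2, h3, h4, h1.le, h2.le, h1.not_gt, h2.not_gt, h3.not_gt, h4.not_gt, h1.not_ge, h2.not_ge, e1, e2] <;>
    first
    | (rw [if_pos (by linarith), if_pos (by linarith)] <;> norm_num)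
    | (rw [if_pos (by linarith), if_neg (by linarith)] <;> norm_num)
    | (rw [if_neg (by linarith), if_pos (by linarith)] <;> norm_num)
    | (rw [if_neg (by linarith), if_neg (by linarith)] <;> norm_num)

lemma writhe_eq {R : Finset Pt} {o : Pt → Bool} {v h : Pt → Pt}
    (hv : ∀ p ∈ R, v p ∈ R ∧ v p ≠ p ∧ (v p).1 = p.1 ∧ v (v p) = p ∧ ∀ q ∈ R, q.1 = p.1 → q = p ∨ q = v p)
    (hh : ∀ p ∈ R, h p ∈ R ∧ h p ≠ p ∧ (h p).2 = p.2 ∧ h (h p) = p ∧ ∀ q ∈ R, q.2 = p.2 → q = p ∨ q = h p)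
    (ov : ∀ p ∈ R, o (v p) = !o p) (oh : ∀ p ∈ R, o (h p) = !o p) :
    writhe R o = ∑ a ∈ R, ∑ c ∈ R, if o a = true then (if o c = true then 0 else
      (if min c.1 (h c).1 < a.1 ∧ a.1 < max c.1 (h c).1 ∧ min a.2 (v a).2 < c.2 ∧ c.2 < max a.2 (v a).2 then
      -((if a.2 < (v a).2 then (1 : ℤ) else -1) * (if c.1 < (h c).1 then (1 : ℤ) else -1)) else 0)) else 0 := by
  unfold writhe
  refine Finset.sum_congr rfl fun a ha => ?_
  rw [Finset.sum_eq_single_of_mem (v a) (hv a ha).1]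
  · refine Finset.sum_congr rfl fun c hc => ?_
    rw [Finset.sum_eq_single_of_mem (h c) (hh c hc).1]
    · rw [ov a ha, oh c hc]
      cases h1 : o a <;> cases h2 : o c <;> simp [(hv a ha).2.2.1, (hh c hc).2.2.1]
    · intro d hd hne
      rw [if_neg]
      rintro ⟨-, -, -, e, h1, h2, -⟩
      rcases (hh c hc).2.2.2.2 d hd e.symm with rfl | rfl
      · simp_all
      · exact hne rfl
  · intro b hb hne
    refine Finset.sum_eq_zero fun c hc => Finset.sum_eq_zero fun d hd => ?_
    rw [if_neg]
    rintro ⟨e, h1, h2, -⟩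
    rcases (hv a ha).2.2.2.2 b hb e.symm with rfl | rfl
    · simp_all
    · exact hne rfl

set_option maxHeartbeats 1000000 in
lemma tb_eq {R : Finset Pt} (hR : IsDiagram R) {o : Pt → Bool} (ho : IsOrientation R o) : tb R o = QQ R (sg o) := by
  obtain ⟨v, hv⟩ := partner hR (.inl rfl)
  obtain ⟨h, hh⟩ := partner hR (.inr rfl)
  have ov : ∀ p ∈ R, o (v p) = !o p := fun p hp => by
    have := orient_ne ho (.inl rfl) (hv p hp).1 hp (hv p hp).2.1 (hv p hp).2.2.1
    cases h1 : o p <;> cases h2 : o (v p) <;> simp_all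
  have oh : ∀ p ∈ R, o (h p) = !o p := fun p hp => by
    have := orient_ne ho (.inr rfl) (hh p hp).1 hp (hh p hp).2.1 (hh p hp).2.2.1
    cases h1 : o p <;> cases h2 : o (h p) <;> simp_all
  have siv := fun F => sum_inv (fun p hp => ⟨(hv p hp).1, (hv p hp).2.2.2.1⟩ : ∀ p ∈ R, v p ∈ R ∧ v (v p) = p) F
  have sih := fun F => sum_inv (fun p hp => ⟨(hh p hp).1, (hh p hp).2.2.2.1⟩ : ∀ p ∈ R, h p ∈ R ∧ h (h p) = p) F
  have nv : ∀ p ∈ R, (v p).2 ≠ p.2 := fun p hp e => (hv p hp).2.1 (Prod.ext (hv p hp).2.2.1 e)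
  have nh : ∀ p ∈ R, (h p).1 ≠ p.1 := fun p hp e => (hh p hp).2.1 (Prod.ext e (hh p hp).2.2.1)
  set Φ : Pt → Pt → ℤ := fun p q => if q.1 ≤ p.1 ∧ q.2 < p.2 then 1 else 0 with hΦ
  set U : Pt → ℤ := fun p => if p.2 < (v p).2 then 1 else 0 with hU
  set W : Pt → ℤ := fun p => if p.1 < (h p).1 then 1 else 0 with hW
  have sU : ∑ p ∈ R, U p = ∑ p ∈ R, (1 - U p) := by
    rw [← siv U]
    refine Finset.sum_congr rfl fun p hp => ?_
    simp only [hU, (hv p hp).2.2.2.1]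
    rcases lt_or_gt_of_ne (nv p hp) with h | h <;> simp [h, h.not_gt]
  have sW : ∑ p ∈ R, W p = ∑ p ∈ R, (1 - W p) := by
    rw [← sih W]
    refine Finset.sum_congr rfl fun p hp => ?_
    simp only [hW, (hh p hp).2.2.2.1]
    rcases lt_or_gt_of_ne (nh p hp) with h | h <;> simp [h, h.not_gt]
  have hc : (cusps R : ℤ) = ∑ p ∈ R, (U p + W p - 2 * (U p * W p)) := by
    unfold cusps
    rw [Finset.card_filter]; push_cast
    refine Finset.sum_congr rfl fun p hp => ?_
    obtain ⟨a1, a2, a3, a4, a5⟩ := hv p hp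
    obtain ⟨b1, b2, b3, b4, b5⟩ := hh p hp
    have : (∃ q ∈ R, ∃ r ∈ R, q ≠ p ∧ q.1 = p.1 ∧ r ≠ p ∧ r.2 = p.2 ∧
     ((p.2 < q.2 ∧ r.1 < p.1) ∨ (q.2 < p.2 ∧ p.1 < r.1))) ↔
       ((p.2 < (v p).2 ∧ (h p).1 < p.1) ∨ ((v p).2 < p.2 ∧ p.1 < (h p).1)) := by
      constructor
      · rintro ⟨q, hq, r, hr, n1, e1, n2, e2, H⟩
        obtain rfl := (a5 q hq e1).resolve_left n1
        obtain rfl := (b5 r hr e2).resolve_left n2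
        exact H
      · exact fun H => ⟨_, a1, _, b1, a2, a3, b2, b3, H⟩
    simp only [this, hU, hW]
    rcases lt_or_gt_of_ne (nv p hp) with h | h <;> rcases lt_or_gt_of_ne (nh p hp) with h' | h' <;>
      simp [h, h.not_gt, h', h'.not_gt]
  have hw := writhe_eq hv hh ov oh
  -- the double sum
  set XY : Pt → Pt → ℤ := fun a c => Φ (v a) c - Φ a c - Φ (v a) (h c) + Φ a (h c) with hXY
  set UR : ℤ := ∑ p ∈ R, U p * W p with hUR
  have h1 : ∑ a ∈ R, ∑ c ∈ R, (if o a = true then (if o c = true then 0 else XY a c) else 0) = - writhe R o - UR := by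
    have eU : UR = ∑ a ∈ R, ∑ c ∈ R, if o a = true then (if o c = true then 0 else
       ((if c.1 = a.1 ∧ c.2 < a.2 ∧ c.1 < (h c).1 then (1 : ℤ) else 0) +
        (if (h c).1 = a.1 ∧ a.2 < (v a).2 ∧ a.1 < c.1 then 1 else 0))) else 0 := by
      have e1 : UR = ∑ p ∈ R, (if o p = true then 0 else U p * W p) + ∑ p ∈ R, (if o p = true then U p * W p else 0) := by
        rw [hUR, ← Finset.sum_add_distrib]
        exact Finset.sum_congr rfl fun p _ => by split_ifs <;> ring
      have e2 : ∑ p ∈ R, (if o p = true then 0 else U p * W p) = ∑ a ∈ R, ∑ c ∈ R, if o a = true then (if o c = true then 0 else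
       ((if c.1 = a.1 ∧ c.2 < a.2 ∧ c.1 < (h c).1 then (1 : ℤ) else 0))) else 0 := by
        rw [Finset.sum_comm]
        refine Finset.sum_congr rfl fun c hc => ?_
        rw [Finset.sum_eq_single_of_mem (v c) (hv c hc).1]
        · rw [ov c hc, (hv c hc).2.2.1]
          by_cases h1 : c.2 < (v c).2 <;> by_cases h2 : c.1 < (h c).1 <;> cases o c <;> simp [hU, hW, h1, h2]
        · intro a ha hne
          by_cases e : c.1 = a.1
          · obtain rfl := ((hv c hc).2.2.2.2 a ha e.symm).resolve_right hne
            cases o a <;> simp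
          · simp [e]
      have e3 : ∑ p ∈ R, (if o p = true then U p * W p else 0) = ∑ a ∈ R, ∑ c ∈ R, if o a = true then (if o c = true then 0 else
       ((if (h c).1 = a.1 ∧ a.2 < (v a).2 ∧ a.1 < c.1 then (1 : ℤ) else 0))) else 0 := by
        refine Finset.sum_congr rfl fun a ha => ?_
        rw [Finset.sum_eq_single_of_mem (h a) (hh a ha).1]
        · rw [oh a ha, (hh a ha).2.2.2.1]
          by_cases h1 : a.2 < (v a).2 <;> by_cases h2 : a.1 < (h a).1 <;> cases o a <;> simp [hU, hW, h1, h2]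
        · intro c hc hne
          by_cases e : (h c).1 = a.1
          · rcases (hv a ha).2.2.2.2 _ (hh c hc).1 e with e' | e'
            · exact absurd (by rw [← e', (hh c hc).2.2.2.1]) hne
            · have := oh c hc
              rw [e', ov a ha] at this
              have : o a = o c := by simpa using this
              rw [this]; cases o c <;> simp
          · simp [e]
      rw [e1, e2, e3, ← Finset.sum_add_distrib]
      refine Finset.sum_congr rfl fun a _ => ?_
      rw [← Finset.sum_add_distrib]
      refine Finset.sum_congr rfl fun c _ => ?_
      split_ifs <;> simp
    rw [eU, hw, ← Finset.sum_neg_distrib, ← Finset.sum_sub_distrib]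
    refine Finset.sum_congr rfl fun a ha => ?_
    rw [← Finset.sum_neg_distrib, ← Finset.sum_sub_distrib]
    refine Finset.sum_congr rfl fun c hc => ?_
    by_cases ha' : o a = true
    swap
    · simp [ha']
    by_cases hc' : o c = true
    · simp [hc']
    rw [if_pos ha', if_neg hc', if_pos ha', if_neg hc', if_pos ha', if_neg hc']
    have f1 : c.1 = a.1 ↔ c.2 = (v a).2 := by
      constructor
      · intro e
        rcases (hv a ha).2.2.2.2 c hc e with rfl | rfl
        · exact absurd ha' hc'
        · rfl
      · intro e
        rcases (hh _ (hv a ha).1).2.2.2.2 c hc e with rfl | e'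
        · exact (hv a ha).2.2.1
        · exact absurd (by rw [e', oh _ (hv a ha).1, ov a ha, ha']; rfl) hc'
    have f2 : (h c).1 = a.1 ↔ c.2 = a.2 := by
      have ob := oh c hc
      constructor
      · intro e
        rcases (hv a ha).2.2.2.2 _ (hh c hc).1 e with e' | e'
        · rw [← e', (hh c hc).2.2.1]
        · rw [e', ov a ha, ha'] at ob
          simp [hc'] at ob
      · intro e
        rcases (hh c hc).2.2.2.2 a ha e.symm with rfl | e'
        · exact absurd ha' hc'
        · rw [e']
    rw [← XYid f1 f2 (nh c hc).symm (nv a ha).symm, hXY]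
    simp only [hΦ, (hv a ha).2.2.1, (hh c hc).2.2.1, ite_and]
    split_ifs <;> ring
  have h2 : ∑ a ∈ R, ∑ c ∈ R, (if o a = true then (if o c = true then 0 else XY a c) else 0) =
      ∑ p ∈ R, ∑ q ∈ R, sg o p * sg o q * Φ p q := by
    rw [Finset.sum_comm, Finset.sum_comm (f := fun p q => sg o p * sg o q * Φ p q)]
    have lv := fun F => lemA (fun p hp => ⟨(hv p hp).1, (hv p hp).2.2.2.1, by rw [ov p hp]; simp⟩ : ∀ p ∈ R, v p ∈ R ∧ v (v p) = p ∧ o (v p) ≠ o p) F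
    have lh := fun F => lemA (fun p hp => ⟨(hh p hp).1, (hh p hp).2.2.2.1, by rw [oh p hp]; simp⟩ : ∀ p ∈ R, h p ∈ R ∧ h (h p) = p ∧ o (h p) ≠ o p) F
    set G : Pt → ℤ := fun c => ∑ p ∈ R, sg o p * Φ p c with hG
    have e1 : ∀ c ∈ R, ∑ a ∈ R, (if o a = true then (if o c = true then 0 else XY a c) else 0) = if o c = true then 0 else G (h c) - G c := by
      intro c hc
      split_ifs with hc'
      · simp
      · rw [hG]; simp only
        rw [← Finset.sum_sub_distrib]
        refine Eq.trans ?_ ((lv fun p => Φ p (h c) - Φ p c).trans (Finset.sum_congr rfl fun p _ => by ring))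
        refine Finset.sum_congr rfl fun a _ => ?_
        split_ifs
        · simp only [hXY]; ring
        · rfl
    rw [Finset.sum_congr rfl e1, ← sih, Finset.sum_congr rfl (g := fun c => if o c = true then G c - G (h c) else 0), lh]
    · refine Finset.sum_congr rfl fun c _ => ?_
      rw [hG]; simp only
      rw [Finset.mul_sum]
      exact Finset.sum_congr rfl fun p _ => by ring
    · intro c hc
      rw [oh c hc, (hh c hc).2.2.2.1]
      cases o c <;> simp
  have h3 : QQ R (sg o) = - ∑ p ∈ R, U p - ∑ p ∈ R, ∑ q ∈ R, sg o p * sg o q * Φ p q := by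
    have e1 : ∑ p ∈ R, U p = - ∑ p ∈ R, ∑ q ∈ R, sg o p * sg o q * (if q.1 = p.1 ∧ q.2 < p.2 then 1 else 0) := by
      rw [← siv, ← Finset.sum_neg_distrib]
      refine Finset.sum_congr rfl fun p hp => ?_
      rw [Finset.sum_eq_single_of_mem (v p) (hv p hp).1]
      · have := sg_neg (by rw [ov p hp]; simp : o (v p) ≠ o p)
        have h' := sg_sq o p
        simp only [hU, this, (hv p hp).2.2.1, (hv p hp).2.2.2.1, true_and]
        split_ifs
        · linarith
        · simp
      · intro q hq hne
        rw [if_neg, mul_zero]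
        rintro ⟨e, h'⟩
        rcases (hv p hp).2.2.2.2 q hq e with rfl | rfl
        · exact lt_irrefl _ h'
        · exact hne rfl
    have e2 : ∑ p ∈ R, ∑ q ∈ R, sg o p * sg o q * (if q.2 < p.2 then 1 else 0) = 0 := by
      rw [Finset.sum_congr rfl (g := fun p : Pt => sg o p * (fun t => ∑ q ∈ R, sg o q * (if q.2 < t then 1 else 0)) p.2)]
      · exact bal hR ho (f := Prod.snd) (.inr rfl) (fun t => ∑ q ∈ R, sg o q * (if q.2 < t then 1 else 0))
      · intro p _
        rw [Finset.mul_sum]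
        exact Finset.sum_congr rfl fun q _ => by ring
    rw [e1, neg_neg, QQ]
    have : ∀ p q : Pt, KK p q = (if q.2 < p.2 then 1 else 0) - Φ p q + (if q.1 = p.1 ∧ q.2 < p.2 then 1 else 0) := by
      intro p q
      simp only [KK, hΦ]
      rcases lt_trichotomy p.1 q.1 with h | h | h <;> by_cases h' : q.2 < p.2
      · simp [h', h.le, h.not_ge, h.ne']
      · simp [h']
      · simp [h', h]
      · simp [h']
      · simp [h', h.le, h.not_ge, h.ne]
      · simp [h']
    simp only [this, mul_add, mul_sub, Finset.sum_add_distrib, Finset.sum_sub_distrib, e2]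
    ring
  rw [h2] at h1
  have h4 : (cusps R : ℤ) = 2 * (∑ p ∈ R, U p - UR) := by
    rw [hc, Finset.sum_sub_distrib, Finset.sum_add_distrib, ← Finset.mul_sum]
    have : ∑ p ∈ R, U p = ∑ p ∈ R, W p := by
      simp only [Finset.sum_sub_distrib] at sU sW; omega
    rw [← this, hUR]; ring
  have h5 : (cusps R : ℚ) = 2 * (∑ p ∈ R, U p - UR : ℤ) := by exact_mod_cast h4
  rw [tb, h5, h3, h1]
  push_cast; ring

def OTr (R R' : Finset Pt) : Prop := ∀ o, IsOrientation R o → ∃ o', IsOrientation R' o' ∧ QQ R' (sg o') = QQ R (sg o)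

lemma OTr.trans {A B C : Finset Pt} (h : OTr A B) (h' : OTr B C) : OTr A C := fun o ho => by
  obtain ⟨o1, h1, e1⟩ := h o ho
  obtain ⟨o2, h2, e2⟩ := h' o1 h1
  exact ⟨o2, h2, e2.trans e1⟩

section
variable {R : Finset Pt} (hR : IsDiagram R) {o : Pt → Bool} (ho : IsOrientation R o) {f : Pt → ℝ} (hf : f = Prod.fst ∨ f = Prod.snd)

lemma bal2 (hR : IsDiagram R) (ho : IsOrientation R o) (hf : f = Prod.fst ∨ f = Prod.snd) (φ : Pt → ℝ → ℤ) :
    ∑ p ∈ R, ∑ q ∈ R, sg o p * sg o q * φ q (f p) = 0 := by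
  rw [← bal hR ho hf (fun t => ∑ q ∈ R, sg o q * φ q t)]
  refine Finset.sum_congr rfl fun p _ => ?_
  rw [Finset.mul_sum]
  exact Finset.sum_congr rfl fun q _ => by ring

lemma bal3 (hR : IsDiagram R) (ho : IsOrientation R o) (hf : f = Prod.fst ∨ f = Prod.snd) (φ : Pt → ℝ → ℤ) :
    ∑ p ∈ R, ∑ q ∈ R, sg o p * sg o q * φ p (f q) = 0 := by
  rw [Finset.sum_comm, ← bal2 hR ho hf φ]
  exact Finset.sum_congr rfl fun p _ => Finset.sum_congr rfl fun q _ => by ring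
end

lemma OTr_tr {R : Finset Pt} (hR : IsDiagram R) : OTr R (trF R) := by
  intro o ho
  refine ⟨fun p => o (p.2, p.1), fun p hp q hq h h' => ?_, ?_⟩
  · rw [mem_trF] at hp hq
    exact ho _ hp _ hq (fun e => h (by simp only [Prod.mk.injEq] at e; exact Prod.ext e.2 e.1)) h'.symm
  · have e : ∀ F : Pt → ℤ, ∑ p ∈ trF R, F p = ∑ p ∈ R, F (p.2, p.1) := fun F =>
      Finset.sum_nbij' (fun p => (p.2, p.1)) (fun p => (p.2, p.1)) (fun p hp => mem_trF.1 hp)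
        (fun p hp => mem_trF.2 hp) (fun _ _ => rfl) (fun _ _ => rfl) (fun _ _ => rfl)
    have e1 := bal2 hR ho (.inl rfl) (fun q t => if q.1 < t then 1 else 0)
    have e2 := bal2 hR ho (.inr rfl) (fun q t => if t ≤ q.2 then 1 else 0)
    have e3 := bal2 hR ho (.inr rfl) (fun q t => 1)
    unfold QQ
    simp only [e]
    have : ∀ p q : Pt, KK p q = 1 - (if q.1 < p.1 then 1 else 0) - (if p.2 ≤ q.2 then 1 else 0) + KK (p.2, p.1) (q.2, q.1) := by
      intro p q
      unfold KK
      by_cases h : q.1 < p.1 <;> by_cases h' : p.2 ≤ q.2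
      · simp [h, h', h.not_ge, h'.not_gt]
      · simp [h, h', h.not_ge]
      · simp [h, h', h'.not_gt]
      · simp [h, h', not_lt.1 h, not_le.1 h']
    have s : ∀ p : Pt, sg (fun p => o (p.2, p.1)) (p.2, p.1) = sg o p := fun p => rfl
    simp only [s]
    rw [Finset.sum_congr rfl (g := fun p => ∑ q ∈ R, (sg o p * sg o q * 1 - sg o p * sg o q * (if q.1 < p.1 then 1 else 0) - sg o p * sg o q * (if p.2 ≤ q.2 then 1 else 0) + sg o p * sg o q * KK (p.2, p.1) (q.2, q.1)))
      (fun p _ => Finset.sum_congr rfl fun q _ => by rw [this p q]; ring) (s₁ := R) (f := fun p => ∑ q ∈ R, sg o p * sg o q * KK p q)]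
    simp only [Finset.sum_add_distrib, Finset.sum_sub_distrib]
    rw [e1, e2, e3]; ring

lemma OTr_of_tr {R R' : Finset Pt} (hR : IsDiagram R) (hR' : IsDiagram R') (h : OTr (trF R) (trF R')) : OTr R R' := by
  have := (OTr_tr hR).trans (h.trans (OTr_tr (diag_tr hR')))
  rwa [trF_trF] at this

lemma OTr_img {R : Finset Pt} {f : Pt → Pt} {g : ℝ → ℝ} (hf : ∀ p, f p = (g p.1, p.2))
    (hg : ∀ p ∈ R, ∀ q ∈ R, g p.1 = g q.1 → p.1 = q.1)
    (hQ : ∀ o, IsOrientation R o → ∑ p ∈ R, ∑ q ∈ R, sg o p * sg o q * (KK (f p) (f q) - KK p q) = 0) : OTr R (R.image f) := by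
  intro o ho
  have inj : ∀ p ∈ R, ∀ q ∈ R, f p = f q → p = q := fun p hp q hq e => by
    rw [hf, hf, Prod.mk.injEq] at e
    exact Prod.ext (hg p hp q hq e.1) e.2
  have key : ∀ p ∈ R, decide (∃ p' ∈ R, f p' = f p ∧ o p' = true) = o p := by
    intro p hp
    cases h : o p
    · simp only [decide_eq_false_iff_not]
      rintro ⟨q, hq, e, h'⟩
      rw [inj q hq p hp e, h] at h'; cases h'
    · simp only [decide_eq_true_eq]
      exact ⟨p, hp, rfl, h⟩
  refine ⟨fun r => decide (∃ p ∈ R, f p = r ∧ o p = true), ?_, ?_⟩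
  · intro a ha b hb hne h
    obtain ⟨p, hp, rfl⟩ := Finset.mem_image.1 ha
    obtain ⟨q, hq, rfl⟩ := Finset.mem_image.1 hb
    simp only
    rw [key p hp, key q hq]
    refine ho p hp q hq (fun e => hne (by rw [e])) (h.imp (fun e => hg p hp q hq (by simpa only [hf] using e)) fun e => by simpa only [hf] using e)
  · have s : ∀ p ∈ R, sg (fun r => decide (∃ p ∈ R, f p = r ∧ o p = true)) (f p) = sg o p := fun p hp => by
      unfold sg; simp only [key p hp]
    have e := hQ o ho
    unfold QQ
    rw [Finset.sum_image inj, ← sub_eq_zero, ← Finset.sum_sub_distrib, ← e]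
    refine Finset.sum_congr rfl fun p hp => ?_
    rw [Finset.sum_image inj, ← Finset.sum_sub_distrib]
    refine Finset.sum_congr rfl fun q hq => ?_
    rw [s p hp, s q hq]; ring

lemma vmap_eq (x0 x1 : ℝ) (p : Pt) : vmap x0 x1 p = ((fun t => if t = x0 then x1 else t) p.1, p.2) := by
  unfold vmap; simp only; split_ifs <;> rfl

lemma swapv_eq (x1 x2 : ℝ) (p : Pt) : swapv x1 x2 p = ((fun t => if t = x1 then x2 else if t = x2 then x1 else t) p.1, p.2) := by
  unfold swapv; simp only; split_ifs <;> rfl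

lemma OTr_cyc {R : Finset Pt} (hR : IsDiagram R) {x0 x1 : ℝ} (h : ((∀ p ∈ R, x0 ≤ p.1) ∧ ∀ p ∈ R, p.1 ≠ x0 → p.1 < x1) ∨
      ((∀ p ∈ R, p.1 ≤ x0) ∧ ∀ p ∈ R, p.1 ≠ x0 → x1 < p.1)) : OTr R (R.image (vmap x0 x1)) := by
  refine OTr_img (g := fun t => if t = x0 then x1 else t) (vmap_eq x0 x1) ?_ ?_
  · intro p hp q hq e
    by_cases h1 : p.1 = x0 <;> by_cases h2 : q.1 = x0 <;> simp only [h1, h2, if_true, if_false] at e ⊢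
    · rcases h with ⟨-, h⟩ | ⟨-, h⟩ <;> linarith [h q hq h2]
    · rcases h with ⟨-, h⟩ | ⟨-, h⟩ <;> linarith [h p hp h1]
    · exact e
  · intro o ho
    have e1 := bal2 hR ho (.inr rfl) (fun q t => (if q.2 < t then 1 else 0) * (if q.1 = x0 then 1 else 0))
    have e2 := bal3 hR ho (.inr rfl) (fun p t => (if t < p.2 then 1 else 0) * (if p.1 = x0 then 1 else 0))
    have : ∃ ε : ℤ, ∀ p ∈ R, ∀ q ∈ R, KK (vmap x0 x1 p) (vmap x0 x1 q) - KK p q = ε *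
        ((if q.2 < p.2 then 1 else 0) * (if q.1 = x0 then 1 else 0) - (if q.2 < p.2 then 1 else 0) * (if p.1 = x0 then 1 else 0)) := by
      rcases h with ⟨h, h'⟩ | ⟨h, h'⟩
      · refine ⟨1, fun p hp q hq => ?_⟩
        simp only [vmap_eq, KK, ite_and]
        by_cases h1 : p.1 = x0 <;> by_cases h2 : q.1 = x0 <;> by_cases h3 : q.2 < p.2 <;> simp [h1, h2, h3]
        · simp [h q hq, h' q hq h2]
        · simp [lt_of_le_of_ne (h p hp) (Ne.symm h1), (h' p hp h1).le]
      · refine ⟨-1, fun p hp q hq => ?_⟩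
        simp only [vmap_eq, KK, ite_and]
        by_cases h1 : p.1 = x0 <;> by_cases h2 : q.1 = x0 <;> by_cases h3 : q.2 < p.2 <;> simp [h1, h2, h3]
        · simp [(h' q hq h2).le, lt_of_le_of_ne (h q hq) h2]
        · simp [h p hp, h' p hp h1]
    obtain ⟨ε, hε⟩ := this
    rw [Finset.sum_congr rfl (fun p hp => Finset.sum_congr rfl fun q hq => by rw [hε p hp q hq])]
    calc _ = ε * (∑ p ∈ R, ∑ q ∈ R, sg o p * sg o q * ((if q.2 < p.2 then 1 else 0) * (if q.1 = x0 then 1 else 0))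
        - ∑ p ∈ R, ∑ q ∈ R, sg o p * sg o q * ((if q.2 < p.2 then 1 else 0) * (if p.1 = x0 then 1 else 0))) := by
          rw [← Finset.sum_sub_distrib, Finset.mul_sum]
          refine Finset.sum_congr rfl fun p _ => ?_
          rw [← Finset.sum_sub_distrib, Finset.mul_sum]
          exact Finset.sum_congr rfl fun q _ => by ring
      _ = 0 := by
        rw [e1, e2]; ring

lemma col_sum {R : Finset Pt} {v : Pt → Pt} {a : Pt} (ha : a ∈ R)
    (hv : v a ∈ R ∧ v a ≠ a ∧ (v a).1 = a.1 ∧ v (v a) = a ∧ ∀ q ∈ R, q.1 = a.1 → q = a ∨ q = v a) (F : Pt → ℤ) :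
    ∑ p ∈ R, (if p.1 = a.1 then F p else 0) = F a + F (v a) := by
  rw [← Finset.sum_filter, ← Finset.sum_pair hv.2.1.symm]
  refine Finset.sum_congr ?_ fun _ _ => rfl
  ext q
  simp only [Finset.mem_filter, Finset.mem_insert, Finset.mem_singleton]
  constructor
  · exact fun h => hv.2.2.2.2 q h.1 h.2
  · rintro (rfl | rfl)
    · exact ⟨ha, rfl⟩
    · exact ⟨hv.1, hv.2.2.1⟩

lemma commE {R : Finset Pt} (hR : IsDiagram R) {o : Pt → Bool} (ho : IsOrientation R o) {x1 x2 : ℝ} (h1 : ∃ p ∈ R, p.1 = x1)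
    (h2 : ∃ p ∈ R, p.1 = x2) (hd : ∀ p ∈ R, ∀ q ∈ R, p.1 = x1 → q.1 = x2 → p.2 ≠ q.2) (hn : NoInterleaveV R x1 x2) :
    ∑ p ∈ R, ∑ q ∈ R, sg o p * sg o q * (if p.1 = x1 ∧ q.1 = x2 ∧ q.2 < p.2 then 1 else 0) = 0 := by
  obtain ⟨v, hv⟩ := partner hR (.inl rfl)
  obtain ⟨a, ha, rfl⟩ := h1
  obtain ⟨c, hc, rfl⟩ := h2
  have e : ∀ p, ∑ q ∈ R, sg o p * sg o q * (if p.1 = a.1 ∧ q.1 = c.1 ∧ q.2 < p.2 then 1 else 0) =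
      if p.1 = a.1 then (sg o p * sg o c * (if c.2 < p.2 then 1 else 0) + sg o p * sg o (v c) * (if (v c).2 < p.2 then 1 else 0)) else 0 := by
    intro p
    rw [← col_sum hc (hv c hc) (fun q => sg o p * sg o q * (if q.2 < p.2 then 1 else 0))]
    split_ifs with h
    · refine Finset.sum_congr rfl fun q _ => ?_
      by_cases h' : q.1 = c.1 <;> simp [h, h']
    · simp [h]
  simp only [e]
  rw [col_sum ha (hv a ha)]
  obtain ⟨a1, a2, a3, -⟩ := hv a ha
  obtain ⟨c1, c2, c3, -⟩ := hv c hc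
  rw [sg_neg (orient_ne ho (.inl rfl) a1 ha a2 a3), sg_neg (orient_ne ho (.inl rfl) c1 hc c2 c3)]
  have d1 := hd a ha c hc rfl rfl
  have d2 := hd a ha _ c1 rfl c3
  have d3 := hd _ a1 c hc a3 rfl
  have d4 := hd _ a1 _ c1 a3 c3
  have n1 := hn a ha _ a1 c hc _ c1 rfl a3 rfl c3
  have n2 := hn _ a1 a ha c hc _ c1 a3 rfl rfl c3
  have n3 := hn a ha _ a1 _ c1 c hc rfl a3 c3 rfl
  have n4 := hn _ a1 a ha _ c1 c hc a3 rfl c3 rfl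
  clear hn e hd
  rcases lt_or_gt_of_ne d1 with k1 | k1 <;> rcases lt_or_gt_of_ne d2 with k2 | k2 <;>
    rcases lt_or_gt_of_ne d3 with k3 | k3 <;> rcases lt_or_gt_of_ne d4 with k4 | k4 <;>
    simp [k1, k2, k3, k4, k1.not_gt, k2.not_gt, k3.not_gt, k4.not_gt] <;> simp_all

lemma OTr_comm1 {R : Finset Pt} (hR : IsDiagram R) {x1 x2 : ℝ} (hx : x1 < x2) (h1 : ∃ p ∈ R, p.1 = x1)
    (h2 : ∃ p ∈ R, p.1 = x2) (hb : ∀ p ∈ R, ¬ (x1 < p.1 ∧ p.1 < x2))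
    (hd : ∀ p ∈ R, ∀ q ∈ R, p.1 = x1 → q.1 = x2 → p.2 ≠ q.2) (hn : NoInterleaveV R x1 x2) : OTr R (R.image (swapv x1 x2)) := by
  refine OTr_img (g := fun t => if t = x1 then x2 else if t = x2 then x1 else t) (swapv_eq x1 x2) ?_ ?_
  · intro p hp q hq e
    have := hx.ne'
    split_ifs at e <;> simp_all
  · intro o ho
    have e1 := commE hR ho h1 h2 hd hn
    have e2 := commE hR ho h2 h1 (fun p hp q hq h h' => (hd q hq p hp h' h).symm)
      (fun p hp p' hp' q hq q' hq' i1 i2 i3 i4 H => hn q hq q' hq' p hp p' hp' i3 i4 i1 i2 H.symm)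
    have hε : ∀ p ∈ R, ∀ q ∈ R, KK (swapv x1 x2 p) (swapv x1 x2 q) - KK p q = -1 *
        ((if p.1 = x1 ∧ q.1 = x2 ∧ q.2 < p.2 then 1 else 0) - (if p.1 = x2 ∧ q.1 = x1 ∧ q.2 < p.2 then 1 else 0)) := by
      intro p hp q hq
      simp only [swapv_eq, KK]
      by_cases k : q.2 < p.2
      swap
      · simp [k]
      simp only [k, and_true]
      have bp := hb p hp
      have bq := hb q hq
      rw [not_and, not_lt] at bp bq
      have hx' := hx.ne'
      have s1 : ∀ t : ℝ, t ≠ x1 → t ≠ x2 → (x1 < t → x2 ≤ t) → (x1 ≤ t ↔ x2 ≤ t) ∧ (t ≤ x1 ↔ t ≤ x2) := by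
        intro t n1 n2 h
        rcases lt_or_gt_of_ne n1 with h1 | h1
        · have := h1.trans hx
          exact ⟨⟨fun h => absurd h h1.not_ge, fun h => absurd h this.not_ge⟩, ⟨fun _ => this.le, fun _ => h1.le⟩⟩
        · have := lt_of_le_of_ne (h h1) n2.symm
          exact ⟨⟨fun _ => this.le, fun _ => h1.le⟩, ⟨fun h => absurd h h1.not_ge, fun h => absurd h this.not_ge⟩⟩
      by_cases p1 : p.1 = x1
      · by_cases q1 : q.1 = x1
        · simp [p1, q1, hx.ne]
        · by_cases q2 : q.1 = x2
          · simp [p1, q2, hx.le, hx.not_ge, hx', hx.ne]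
          · simp [p1, q1, q2, hx.ne, (s1 _ q1 q2 bq).1]
      · by_cases p2 : p.1 = x2
        · by_cases q1 : q.1 = x1
          · simp [p2, q1, hx.le, hx.not_ge, hx', hx.ne]
          · by_cases q2 : q.1 = x2
            · simp [p2, q2, hx']
            · simp [p2, q1, q2, hx', (s1 _ q1 q2 bq).1]
        · by_cases q1 : q.1 = x1
          · simp [p1, p2, q1, (s1 _ p1 p2 bp).2]
          · by_cases q2 : q.1 = x2
            · simp [p1, p2, q2, hx', (s1 _ p1 p2 bp).2]
            · simp [p1, p2, q1, q2]
    rw [Finset.sum_congr rfl (fun p hp => Finset.sum_congr rfl fun q hq => by rw [hε p hp q hq])]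
    refine Eq.trans ?_ (by rw [e1, e2]; ring : -1 * ((∑ p ∈ R, ∑ q ∈ R, sg o p * sg o q * if p.1 = x1 ∧ q.1 = x2 ∧ q.2 < p.2 then 1 else 0) -
      ∑ p ∈ R, ∑ q ∈ R, sg o p * sg o q * if p.1 = x2 ∧ q.1 = x1 ∧ q.2 < p.2 then 1 else 0) = 0)
    rw [← Finset.sum_sub_distrib, Finset.mul_sum]
    refine Finset.sum_congr rfl fun p _ => ?_
    rw [← Finset.sum_sub_distrib, Finset.mul_sum]
    exact Finset.sum_congr rfl fun q _ => by ring

lemma OTr_comm {R : Finset Pt} (hR : IsDiagram R) {x1 x2 : ℝ} (hx : x1 ≠ x2) (h1 : ∃ p ∈ R, p.1 = x1)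
    (h2 : ∃ p ∈ R, p.1 = x2) (hb : ∀ p ∈ R, ¬ (min x1 x2 < p.1 ∧ p.1 < max x1 x2))
    (hd : ∀ p ∈ R, ∀ q ∈ R, p.1 = x1 → q.1 = x2 → p.2 ≠ q.2) (hn : NoInterleaveV R x1 x2) : OTr R (R.image (swapv x1 x2)) := by
  rcases lt_or_gt_of_ne hx with h | h
  · rw [min_eq_left h.le, max_eq_right h.le] at hb
    exact OTr_comm1 hR h h1 h2 hb hd hn
  · rw [min_eq_right h.le, max_eq_left h.le] at hb
    have : swapv x1 x2 = swapv x2 x1 := by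
      funext p; rw [swapv_eq, swapv_eq]
      by_cases h1 : p.1 = x1 <;> by_cases h2 : p.1 = x2 <;> simp [h1, h2, hx]
    rw [this]
    exact OTr_comm1 hR h h2 h1 hb (fun p hp q hq h h' => (hd q hq p hp h' h).symm)
      (fun p hp p' hp' q hq q' hq' i1 i2 i3 i4 H => hn q hq q' hq' p hp p' hp' i3 i4 i1 i2 H.symm)

section
variable {R R' : Finset Pt} {x y x' y' : ℝ}

lemma stab_sum (h : StabData x y x' y' R R') {s s' : Pt → ℤ} (hA : s' (x', y) = s (x, y)) (hB : s' (x, y') = s (x, y))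
    (hC : s' (x', y') = - s (x, y)) (hr : ∀ p ∈ R, p ≠ (x, y) → s' p = s p) (φ : Pt → ℤ) :
    ∑ p ∈ R', s' p * φ p = ∑ p ∈ R, s p * φ p + s (x, y) * (φ (x', y) + φ (x, y') - φ (x', y') - φ (x, y)) := by
  obtain ⟨h1, h2, h3, h4, h5, -, -, rfl⟩ := h
  unfold stabSet
  rw [Finset.sum_insert, Finset.sum_insert, Finset.sum_insert, ← Finset.add_sum_erase R _ h1, hA, hB, hC,
    Finset.sum_congr rfl (g := fun p => s p * φ p)]
  · ring
  · intro p hp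
    rw [hr p (Finset.mem_of_mem_erase hp) (Finset.ne_of_mem_erase hp)]
  · exact fun h => h4 _ (Finset.mem_of_mem_erase h) rfl
  · simp only [Finset.mem_insert, Prod.mk.injEq, not_or]
    exact ⟨fun h => h2 h.1, fun h => h5 _ (Finset.mem_of_mem_erase h) rfl⟩
  · simp only [Finset.mem_insert, Prod.mk.injEq, not_or]
    exact ⟨fun h => h2 h.1.symm, fun h => h3 h.2, fun h => h4 _ (Finset.mem_of_mem_erase h) rfl⟩

lemma KK_mk (a b c d : ℝ) : KK (a, b) (c, d) = (if a ≤ c then 1 else 0) * (if d < b then 1 else 0) := by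
  unfold KK; simp only; split_ifs <;> simp_all

lemma le_diff {t x x' : ℝ} (h2 : x ≠ x') (h4 : t ≠ x') (h6 : ¬ (min x x' < t ∧ t < max x x')) :
    (if t ≤ x' then (1 : ℤ) else 0) - (if t ≤ x then 1 else 0) = if t = x ∧ x' < x then -1 else 0 := by
  rcases lt_or_gt_of_ne h2 with h | h
  · rw [min_eq_left h.le, max_eq_right h.le] at h6
    by_cases k : t ≤ x
    · simp [k, k.trans h.le, h.not_gt]
    · have := not_le.1 (fun k' : t ≤ x' => h6 ⟨not_le.1 k, lt_of_le_of_ne k' h4⟩)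
      simp [k, this.not_ge, h.not_gt]
  · rw [min_eq_right h.le, max_eq_left h.le] at h6
    rcases lt_trichotomy t x with k | k | k
    · have := not_lt.1 (fun k' : x' < t => h6 ⟨k', k⟩)
      simp [k.le, k.ne, this]
    · simp [k, h, h.not_ge]
    · simp [k.not_ge, k.ne', (h.trans k).not_ge]

lemma stab_QQ (h : StabData x y x' y' R R') (hI : 0 < (x - x') * (y - y')) {s s' : Pt → ℤ} (hA : s' (x', y) = s (x, y)) (hB : s' (x, y') = s (x, y))
    (hC : s' (x', y') = - s (x, y)) (hr : ∀ p ∈ R, p ≠ (x, y) → s' p = s p) (hs : s (x, y) * s (x, y) = 1) :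
    QQ R' s' = QQ R s := by
  have hS := stab_sum h hA hB hC hr
  have e0 : ∀ (X : Finset Pt) (r : Pt → ℤ), QQ X r = ∑ p ∈ X, r p * ∑ q ∈ X, r q * KK p q := by
    intro X r
    unfold QQ
    refine Finset.sum_congr rfl fun p _ => ?_
    rw [Finset.mul_sum]
    exact Finset.sum_congr rfl fun q _ => by ring
  rw [e0, e0, hS]
  simp only [hS]
  obtain ⟨h1, h2, h3, h4, h5, h6, h7, -⟩ := h
  -- first difference
  have one : ∀ (φ : Pt → ℤ) (c : ℤ), (∀ p ∈ R, φ p = if p = (x, y) then c else 0) → ∑ p ∈ R, s p * φ p = s (x, y) * c := by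
    intro φ c hφ
    rw [Finset.sum_eq_single_of_mem _ h1, hφ _ h1, if_pos rfl]
    intro p hp hne
    rw [hφ p hp, if_neg hne, mul_zero]
  have eI : (x' < x ↔ y' < y) := by
    constructor <;> intro k <;> nlinarith
  have lt_d : ∀ p ∈ R, (if y < p.2 then (1 : ℤ) else 0) - (if y' < p.2 then 1 else 0) = if p.2 = y ∧ y' < y then -1 else 0 := by
    intro p hp
    rw [← le_diff h3 (h5 p hp) (h7 p hp)]
    by_cases k : p.2 ≤ y <;> by_cases k' : p.2 ≤ y' <;> simp [k, k', not_lt.2, not_le.1, lt_of_not_ge]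
  have D1 := one (fun p => KK p (x', y) + KK p (x, y') - KK p (x', y') - KK p (x, y)) (if x' < x then 1 else 0) (by
    rintro ⟨p1, p2⟩ hp
    have a1 := le_diff h2 (h4 _ hp) (h6 _ hp)
    have a2 := lt_d _ hp
    simp only [KK_mk] at a1 a2 ⊢
    calc _ = ((if p1 ≤ x' then (1 : ℤ) else 0) - (if p1 ≤ x then 1 else 0)) * ((if y < p2 then (1 : ℤ) else 0) - (if y' < p2 then 1 else 0)) := by ring
      _ = _ := by
        rw [a1, a2]
        simp only [Prod.mk.injEq, ← eI]
        by_cases k1 : p1 = x <;> by_cases k2 : p2 = y <;> by_cases k3 : x' < x <;> simp [k1, k2, k3])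
  have D2 := one (fun q => KK (x', y) q + KK (x, y') q - KK (x', y') q - KK (x, y) q) (if x < x' then 1 else 0) (by
    rintro ⟨p1, p2⟩ hp
    have a1 := le_diff (t := -p1) (x := -x) (x' := -x') (fun k => h2 (neg_injective k)) (fun k => h4 _ hp (neg_injective k)) (by
      have := h6 _ hp
      rw [min_neg_neg, max_neg_neg]
      exact fun k => this ⟨by linarith [k.2], by linarith [k.1]⟩)
    have a2 := le_diff (t := -p2) (x := -y) (x' := -y') (fun k => h3 (neg_injective k)) (fun k => h5 _ hp (neg_injective k)) (by
      have := h7 _ hp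
      rw [min_neg_neg, max_neg_neg]
      exact fun k => this ⟨by linarith [k.2], by linarith [k.1]⟩)
    have eJ : y < y' ↔ x < x' := by constructor <;> intro k <;> nlinarith
    simp only [neg_le_neg_iff, neg_lt_neg_iff, neg_inj, eJ] at a1 a2
    have b : ∀ t : ℝ, (if p2 < t then (1 : ℤ) else 0) = 1 - (if t ≤ p2 then 1 else 0) := by
      intro t; by_cases k : p2 < t
      · simp [k, k.not_ge]
      · simp [k, not_lt.1 k]
    simp only [KK_mk, b]
    calc _ = ((if x' ≤ p1 then (1 : ℤ) else 0) - (if x ≤ p1 then 1 else 0)) * ((if y' ≤ p2 then (1 : ℤ) else 0) - (if y ≤ p2 then 1 else 0)) := by ring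
      _ = _ := by
        rw [a1, a2]
        simp only [Prod.mk.injEq]
        by_cases k1 : p1 = x <;> by_cases k2 : p2 = y <;> by_cases k3 : x < x' <;> simp [k1, k2, k3])
  have D3 : (if x' < x then (1 : ℤ) else 0) + (if x < x' then 1 else 0) = 1 := by
    rcases lt_or_gt_of_ne h2 with k | k <;> simp [k, k.not_gt]
  have D4 : (fun p => KK p (x', y) + KK p (x, y') - KK p (x', y') - KK p (x, y)) (x', y) + (fun p => KK p (x', y) + KK p (x, y') - KK p (x', y') - KK p (x, y)) (x, y')
    - (fun p => KK p (x', y) + KK p (x, y') - KK p (x', y') - KK p (x, y)) (x', y') - (fun p => KK p (x', y) + KK p (x, y') - KK p (x', y') - KK p (x, y)) (x, y) = -1 := by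
    simp only [KK_mk]
    rcases lt_or_gt_of_ne h2 with k | k
    · have k' : y < y' := by nlinarith
      simp [k.le, k'.not_gt, k', k.not_ge]
    · have k' : y' < y := eI.1 k
      simp [k.le, k'.not_gt, k', k.not_ge]
  simp only [mul_add, mul_sub, Finset.sum_add_distrib, Finset.sum_sub_distrib] at D1 D2 D4 ⊢
  have m : ∀ c : Pt, ∑ p ∈ R, s p * (s (x, y) * KK p c) = s (x, y) * ∑ p ∈ R, s p * KK p c := fun c => by
    rw [Finset.mul_sum]; exact Finset.sum_congr rfl fun p _ => by ring
  simp only [m]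
  linear_combination s (x, y) * D1 + s (x, y) * D2 + s (x, y) * s (x, y) * D3 + s (x, y) * s (x, y) * D4

lemma OTr_stab (h : StabData x y x' y' R R') (hI : 0 < (x - x') * (y - y')) : OTr R R' ∧ OTr R' R := by
  have h' := h
  obtain ⟨h1, h2, h3, h4, h5, -, -, rfl⟩ := h'
  have mA : ((x', y) : Pt) ∈ stabSet x y x' y' R := mem_stabSet.2 (.inl rfl)
  have mB : ((x, y') : Pt) ∈ stabSet x y x' y' R := mem_stabSet.2 (.inr (.inl rfl))
  have mC : ((x', y') : Pt) ∈ stabSet x y x' y' R := mem_stabSet.2 (.inr (.inr (.inl rfl)))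
  have mR : ∀ p ∈ R, p ≠ (x, y) → p ∈ stabSet x y x' y' R := fun p hp hne => mem_stabSet.2 (.inr (.inr (.inr ⟨hne, hp⟩)))
  have nA : ∀ p ∈ R, p ≠ (x', y) := fun p hp e => h4 p hp (by rw [e])
  have nB : ∀ p ∈ R, p ≠ (x, y') := fun p hp e => h5 p hp (by rw [e])
  have nC : ∀ p ∈ R, p ≠ (x', y') := fun p hp e => h4 p hp (by rw [e])
  constructor
  · intro o ho
    set o' : Pt → Bool := fun q => if q = (x', y') then !o (x, y) else if q = (x', y) ∨ q = (x, y') then o (x, y) else o q with ho'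
    have oA : o' (x', y) = o (x, y) := by simp [ho', h3]
    have oB : o' (x, y') = o (x, y) := by simp [ho', h2]
    have oC : o' (x', y') = !o (x, y) := by simp [ho']
    have oR : ∀ p ∈ R, o' p = o p := fun p hp => by simp [ho', nA p hp, nB p hp, nC p hp]
    have key : ∀ p ∈ R, p ≠ (x, y) → (p.1 = x ∨ p.2 = y) → o p ≠ o (x, y) := fun p hp hne e => ho p hp _ h1 hne e
    refine ⟨o', fun p hp q hq hne e => ?_, stab_QQ h hI ?_ ?_ ?_ ?_ (sg_sq _ _)⟩
    · rw [mem_stabSet] at hp hq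
      rcases hp with rfl | rfl | rfl | ⟨hp', hp⟩ <;> rcases hq with rfl | rfl | rfl | ⟨hq', hq⟩
      · exact absurd rfl hne
      · exact absurd e (by simp [h2.symm, h3])
      · rw [oA, oC]; simp
      · rw [oA, oR q hq]
        exact (key q hq hq' (.inr (e.resolve_left fun k => h4 q hq k.symm).symm)).symm
      · exact absurd e (by simp [h2, h3.symm])
      · exact absurd rfl hne
      · rw [oB, oC]; simp
      · rw [oB, oR q hq]
        exact (key q hq hq' (.inl (e.resolve_right fun k => h5 q hq k.symm).symm)).symm
      · rw [oA, oC]; simp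
      · rw [oB, oC]; simp
      · exact absurd rfl hne
      · exact absurd e (not_or.2 ⟨fun k => h4 q hq k.symm, fun k => h5 q hq k.symm⟩)
      · rw [oA, oR p hp]
        exact key p hp hp' (.inr (e.resolve_left fun k => h4 p hp k))
      · rw [oB, oR p hp]
        exact key p hp hp' (.inl (e.resolve_right fun k => h5 p hp k))
      · exact absurd e (not_or.2 ⟨fun k => h4 p hp k, fun k => h5 p hp k⟩)
      · rw [oR p hp, oR q hq]; exact ho p hp q hq hne e
    · simp [sg, oA]
    · simp [sg, oB]
    · unfold sg; rw [oC]; cases o (x, y) <;> simp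
    · intro p hp _; simp [sg, oR p hp]
  · intro o' ho'
    have i1 := ho' _ mA _ mC (by simp [h3]) (.inl rfl)
    have i2 := ho' _ mB _ mC (by simp [h2]) (.inr rfl)
    have iB : o' (x, y') = o' (x', y) := by
      cases k1 : o' (x, y') <;> cases k2 : o' (x', y) <;> cases k3 : o' (x', y') <;> simp_all
    have key : ∀ p ∈ R, p ≠ (x, y) → (p.1 = x ∨ p.2 = y) → o' p ≠ o' (x', y) := by
      intro p hp hne e
      rcases e with e | e
      · rw [← iB]; exact ho' _ (mR p hp hne) _ mB (nB p hp) (.inl e)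
      · exact ho' _ (mR p hp hne) _ mA (nA p hp) (.inr e)
    set o : Pt → Bool := fun q => if q = (x, y) then o' (x', y) else o' q with ho
    have oV : o (x, y) = o' (x', y) := by simp [ho]
    have oR : ∀ p, p ≠ (x, y) → o p = o' p := fun p hp => by simp [ho, hp]
    refine ⟨o, fun p hp q hq hne e => ?_, (stab_QQ h hI ?_ ?_ ?_ ?_ (sg_sq _ _)).symm⟩
    · by_cases k : p = (x, y)
      · subst k
        rw [oV, oR q hne.symm]
        exact (key q hq hne.symm (e.imp Eq.symm Eq.symm)).symm
      · by_cases k' : q = (x, y)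
        · subst k'
          rw [oV, oR p hne]
          exact key p hp hne e
        · rw [oR p k, oR q k']
          exact ho' _ (mR p hp k) _ (mR q hq k') hne e
    · simp [sg, oV]
    · simp [sg, oV, iB]
    · rw [sg_neg i1.symm]; simp [sg, oV]
    · intro p _ hp; simp [sg, oR p hp]
end

lemma OTr_leg {R R' : Finset Pt} (h : LegMove StabType.I R R') : OTr R R' := by
  rcases h with ⟨h1, h2, f, h, rfl⟩ | ⟨h1, h2, f, h, rfl⟩ | ⟨v, -, -, x', y', h, hI⟩ | ⟨v, -, -, x', y', h, hI⟩
  · rcases h with ⟨x0, x1, a, b, rfl⟩ | ⟨x0, x1, a, b, rfl⟩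
    · exact OTr_cyc h1 b
    · refine OTr_of_tr h1 h2 ?_
      rw [trF_img (g := vmap x0 x1) fun p => by simp only [vmap, hmap]; split_ifs <;> rfl]
      exact OTr_cyc (diag_tr h1) (by simpa only [all_trF] using b)
  · rcases h with ⟨x0, x1, a, b, c, d, e, g, rfl⟩ | ⟨x0, x1, a, b, c, d, e, g, rfl⟩
    · exact OTr_comm h1 a b c d e g
    · refine OTr_of_tr h1 h2 ?_
      rw [trF_img (g := swapv x0 x1) fun p => by simp only [swapv, swaph]; split_ifs <;> rfl]
      exact OTr_comm (diag_tr h1) a (ex_trF.2 b) (ex_trF.2 c) (by simpa only [all_trF] using d) (by simpa only [all_trF] using e)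
        (by simpa only [NoInterleaveH, NoInterleaveV, all_trF] using g)
  · exact (OTr_stab h (hI.1 rfl)).1
  · exact (OTr_stab h (hI.1 rfl)).2

lemma OTr_equiv {R R' : Finset Pt} (h : LegEquiv R R') : OTr R R' := by
  induction h with
  | refl => exact fun o ho => ⟨o, ho, rfl⟩
  | tail _ h ih => exact ih.trans (OTr_leg h)

lemma IsOrientation.mono {R P : Finset Pt} {o : Pt → Bool} (h : IsOrientation R o) (hP : P ⊆ R) : IsOrientation P o :=
  fun p hp q hq => h p (hP hp) q (hP hq)

lemma bool_aux : ∀ {a b c d : Bool}, a ≠ b → c ≠ d → a = c → b = d := by decide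

lemma or_core {K P : Finset Pt} (hK : IsKnotDiagram K) (hP : P ⊆ K) (hne : (K \ P).Nonempty) {o o' : Pt → Bool}
    (ho : IsOrientation P o) (ho' : IsOrientation P o')
    (h : ∀ p ∈ P, ∀ t ∈ K \ P, (p.1 = t.1 ∨ p.2 = t.2) → o p = o' p) : ∀ p ∈ P, o p = o' p := by
  have cl : ∀ p ∈ P, o p ≠ o' p → ∀ q ∈ K, (p.1 = q.1 ∨ p.2 = q.2) → q ∈ P ∧ o q ≠ o' q := by
    intro p hp hpo q hq e
    have hqP : q ∈ P := by
      by_contra hn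
      exact hpo (h p hp q (Finset.mem_sdiff.2 ⟨hq, hn⟩) e)
    refine ⟨hqP, ?_⟩
    by_cases hpq : p = q
    · exact hpq ▸ hpo
    have h1 := ho p hp q hqP hpq e
    have h2 := ho' p hp q hqP hpq e
    exact fun k => hpo (bool_aux h1.symm h2.symm k)
  by_contra hcon
  push Not at hcon
  obtain ⟨p0, hp0, hp0'⟩ := hcon
  have hS : IsDiagram (P.filter fun p => o p ≠ o' p) := by
    intro p hp
    obtain ⟨hp, hpo⟩ := Finset.mem_filter.1 hp
    have := hK.1 p (hP hp)
    constructor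
    · rw [← this.1]; congr 1; ext q
      simp only [Finset.mem_filter]
      exact ⟨fun k => ⟨hP k.1.1, k.2⟩, fun k => ⟨cl p hp hpo q k.1 (.inl k.2.symm), k.2⟩⟩
    · rw [← this.2]; congr 1; ext q
      simp only [Finset.mem_filter]
      exact ⟨fun k => ⟨hP k.1.1, k.2⟩, fun k => ⟨cl p hp hpo q k.1 (.inr k.2.symm), k.2⟩⟩
  have := hK.2.2 _ ((Finset.filter_subset _ _).trans hP) hS ⟨p0, Finset.mem_filter.2 ⟨hp0, hp0'⟩⟩
  obtain ⟨t, ht⟩ := hne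
  obtain ⟨ht, ht'⟩ := Finset.mem_sdiff.1 ht
  rw [← this] at ht
  exact ht' (Finset.mem_filter.1 ht).1

lemma psum {K P : Finset Pt} (hP : P ⊆ K) {f : Pt → ℝ} (hf : f = Prod.fst ∨ f = Prod.snd) {v : Pt → Pt}
    (hv : ∀ p ∈ K, v p ∈ K ∧ v p ≠ p ∧ f (v p) = f p ∧ v (v p) = p ∧ ∀ q ∈ K, f q = f p → q = p ∨ q = v p) {o : Pt → Bool}
    (ho : IsOrientation P o) : ∑ p ∈ P, sg o p = ∑ q ∈ K \ P, (if v q ∈ P then sg o (v q) else 0) := by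
  have si := fun F => sum_inv (fun p hp => ⟨(hv p hp).1, (hv p hp).2.2.2.1⟩ : ∀ p ∈ K, v p ∈ K ∧ v (v p) = p) F
  have h1 := si (fun p => if p ∈ P then sg o p else 0)
  have h2 := si (fun p => if p ∈ P ∧ v p ∈ P then sg o p else 0)
  rw [Finset.sum_congr rfl (g := fun p => -(if p ∈ P ∧ v p ∈ P then sg o p else 0)), Finset.sum_neg_distrib] at h2
  · rw [← Finset.sum_sdiff hP, ← Finset.sum_sdiff hP (f := fun p => if p ∈ P then sg o p else 0)] at h1
    rw [← Finset.sum_sdiff hP] at h2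
    rw [Finset.sum_congr rfl (g := fun p => -(if p ∈ P ∧ v p ∈ P then sg o p else 0)) (s₁ := P), Finset.sum_neg_distrib] at h1
    · rw [Finset.sum_eq_zero (s := K \ P)] at h2
      · rw [Finset.sum_eq_zero (s := K \ P) (f := fun p => if p ∈ P then sg o p else 0)] at h1
        · have : ∑ p ∈ P, sg o p = ∑ p ∈ P, (if p ∈ P then sg o p else 0) :=
            Finset.sum_congr rfl fun p hp => by rw [if_pos hp]
          rw [this]; omega
        · intro p hp; simp [(Finset.mem_sdiff.1 hp).2]
      · intro p hp; simp [(Finset.mem_sdiff.1 hp).2]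
    · intro p hp
      by_cases k : v p ∈ P
      · simp [k, hp, sg_neg (orient_ne ho hf k hp (hv p (hP hp)).2.1 (hv p (hP hp)).2.2.1)]
      · simp [k]
  · intro p hp
    rw [(hv p hp).2.2.2.1]
    by_cases k : v p ∈ P <;> by_cases k' : p ∈ P <;> simp [k, k']
    exact sg_neg (orient_ne ho hf k k' (hv p hp).2.1 (hv p hp).2.2.1)

lemma sg_inj {o o' : Pt → Bool} {p : Pt} (h : sg o p = sg o' p) : o p = o' p := by
  unfold sg at h; cases k : o p <;> cases k' : o' p <;> simp_all

lemma sg_congr {o o' : Pt → Bool} {p : Pt} (h : o p = o' p) : sg o p = sg o' p := by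
  unfold sg; rw [h]

lemma path_or2 {P : Finset Pt} {q r : Pt} (hqr : q ≠ r) (hq : q ∉ P) (hr : r ∉ P) (hK : IsKnotDiagram (insert q (insert r P)))
    {f g : Pt → ℝ} (hfg : (f = Prod.fst ∧ g = Prod.snd) ∨ (f = Prod.snd ∧ g = Prod.fst)) (e : f q = f r) :
    ∃ u ∈ P, (∃ f : Pt → ℝ, (f = Prod.fst ∨ f = Prod.snd) ∧ ∀ t ∈ P, f t = f u → t = u) ∧
      ∀ o o', IsOrientation P o → IsOrientation P o' → o u = o' u → ∀ p ∈ P, o p = o' p := by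
  have hf : f = Prod.fst ∨ f = Prod.snd := hfg.imp And.left And.left
  have hg : g = Prod.fst ∨ g = Prod.snd := (hfg.imp And.right And.right).symm
  have hext : ∀ a b : Pt, f a = f b → g a = g b → a = b := by
    intro a b h1 h2
    rcases hfg with ⟨rfl, rfl⟩ | ⟨rfl, rfl⟩
    · exact Prod.ext h1 h2
    · exact Prod.ext h2 h1
  obtain ⟨v, hv⟩ := partner hK.1 hf
  obtain ⟨h, hh⟩ := partner hK.1 hg
  set K := insert q (insert r P) with hKd
  have hPK : P ⊆ K := fun p hp => by simp [hKd, hp]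
  have mq : q ∈ K := by simp [hKd]
  have mr : r ∈ K := by simp [hKd]
  have hD : K \ P = {q, r} := by
    ext t; simp only [hKd, Finset.mem_sdiff, Finset.mem_insert, Finset.mem_singleton]
    constructor
    · tauto
    · rintro (rfl | rfl) <;> tauto
  have vq : v q = r := (((hv q mq).2.2.2.2 r mr e.symm).resolve_left hqr.symm).symm
  have vr : v r = q := by rw [← vq, (hv q mq).2.2.2.1]
  have inP : ∀ t ∈ K, t ≠ q → t ≠ r → t ∈ P := fun t ht h1 h2 => by
    simp only [hKd, Finset.mem_insert] at ht; tauto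
  have hqP : h q ∈ P := inP _ (hh q mq).1 (hh q mq).2.1 fun k => hqr (hext _ _ e (by rw [← k, (hh q mq).2.2.1]))
  have hrP : h r ∈ P := inP _ (hh r mr).1 (fun k => hqr (hext _ _ e (by rw [← k, (hh r mr).2.2.1]))) (hh r mr).2.1
  have rel : ∀ o, IsOrientation P o → sg o (h q) + sg o (h r) = 0 := by
    intro o ho
    have h1 := psum hPK hf hv ho
    have h2 := psum hPK hg hh ho
    rw [hD, Finset.sum_pair hqr] at h1 h2
    rw [vq, vr, if_neg hq, if_neg hr] at h1
    rw [if_pos hqP, if_pos hrP] at h2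
    omega
  refine ⟨h q, hqP, ⟨g, hg, fun t ht k => ?_⟩, fun o o' ho ho' hu => or_core hK hPK (hD ▸ ⟨q, by simp⟩) ho ho' ?_⟩
  · refine ((hh q mq).2.2.2.2 t (hPK ht) (k.trans (hh q mq).2.2.1)).resolve_left ?_
    rintro rfl; exact hq ht
  · have hw : o (h r) = o' (h r) := sg_inj (by
      have := rel o ho; have := rel o' ho'; have := sg_congr hu; omega)
    intro p hp t ht k
    have k' : f p = f t ∨ g p = g t := by
      rcases hfg with ⟨rfl, rfl⟩ | ⟨rfl, rfl⟩
      · exact k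
      · exact k.symm
    have n1 : p ≠ q := fun k => hq (k ▸ hp)
    have n2 : p ≠ r := fun k => hr (k ▸ hp)
    rw [hD] at ht
    rcases Finset.mem_insert.1 ht with rfl | ht
    · rcases k' with k' | k'
      · have := (hv _ mq).2.2.2.2 p (hPK hp) k'
        rw [vq] at this; exact (this.elim n1 n2).elim
      · rw [((hh _ mq).2.2.2.2 p (hPK hp) k').resolve_left n1]; exact hu
    · obtain rfl := Finset.mem_singleton.1 ht
      rcases k' with k' | k'
      · have := (hv _ mr).2.2.2.2 p (hPK hp) k'
        rw [vr] at this; exact (this.elim n2 n1).elim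
      · rw [((hh _ mr).2.2.2.2 p (hPK hp) k').resolve_left n2]; exact hw

lemma path_or {P : Finset Pt} (h : IsPath P) :
    ∃ u ∈ P, (∃ f : Pt → ℝ, (f = Prod.fst ∨ f = Prod.snd) ∧ ∀ t ∈ P, f t = f u → t = u) ∧
      ∀ o o', IsOrientation P o → IsOrientation P o' → o u = o' u → ∀ p ∈ P, o p = o' p := by
  rcases h with ⟨p, rfl⟩ | ⟨q, hq, hK⟩ | ⟨q, r, hqr, hq, hr, e, hK⟩
  · exact ⟨p, by simp, ⟨Prod.fst, .inl rfl, by simp⟩, by simp⟩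
  · obtain ⟨v, hv⟩ := partner hK.1 (.inl rfl)
    obtain ⟨h, hh⟩ := partner hK.1 (.inr rfl)
    set K := insert q P with hKd
    have hPK : P ⊆ K := fun p hp => by simp [hKd, hp]
    have mq : q ∈ K := by simp [hKd]
    have hD : K \ P = {q} := by
      ext t; simp only [hKd, Finset.mem_sdiff, Finset.mem_insert, Finset.mem_singleton]
      constructor
      · tauto
      · rintro rfl; tauto
    have inP : ∀ t ∈ K, t ≠ q → t ∈ P := fun t ht h1 => by
      simp only [hKd, Finset.mem_insert] at ht; tauto
    have vP := inP _ (hv q mq).1 (hv q mq).2.1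
    have hP := inP _ (hh q mq).1 (hh q mq).2.1
    have rel : ∀ o, IsOrientation P o → sg o (v q) = sg o (h q) := by
      intro o ho
      have h1 := psum hPK (.inl rfl) hv ho
      have h2 := psum hPK (.inr rfl) hh ho
      rw [hD, Finset.sum_singleton] at h1 h2
      rw [if_pos vP] at h1
      rw [if_pos hP] at h2
      omega
    refine ⟨v q, vP, ⟨Prod.fst, .inl rfl, fun t ht k => ?_⟩, fun o o' ho ho' hu => or_core hK hPK (hD ▸ ⟨q, by simp⟩) ho ho' ?_⟩
    · refine ((hv q mq).2.2.2.2 t (hPK ht) (k.trans (hv q mq).2.2.1)).resolve_left ?_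
      rintro rfl; exact hq ht
    · have hw : o (h q) = o' (h q) := sg_inj (by rw [← rel o ho, ← rel o' ho', sg_congr hu])
      intro p hp t ht k
      have n1 : p ≠ q := fun k => hq (k ▸ hp)
      rw [hD] at ht
      obtain rfl := Finset.mem_singleton.1 ht
      rcases k with k | k
      · rw [((hv _ mq).2.2.2.2 p (hPK hp) k).resolve_left n1]; exact hu
      · rw [((hh _ mq).2.2.2.2 p (hPK hp) k).resolve_left n1]; exact hw
  · rcases e with e | e
    · exact path_or2 hqr hq hr hK (.inl ⟨rfl, rfl⟩) e
    · exact path_or2 hqr hq hr hK (.inr ⟨rfl, rfl⟩) e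

lemma ori_not {R : Finset Pt} {o : Pt → Bool} (h : IsOrientation R o) : IsOrientation R (fun p => !o p) :=
  fun p hp q hq hne e => by have := h p hp q hq hne e; simpa using this

lemma QQ_not {R : Finset Pt} {o : Pt → Bool} : QQ R (sg fun p => !o p) = QQ R (sg o) := by
  have : ∀ p, sg (fun p => !o p) p = - sg o p := fun p => by unfold sg; cases h : o p <;> simp [h]
  unfold QQ; simp only [this]
  exact Finset.sum_congr rfl fun p _ => Finset.sum_congr rfl fun q _ => by ring

lemma indep {a b : Finset Pt} (ha : IsPath a) (hb : IsPath b) (hD : IsDiagram (a ∪ b)) {o o' : Pt → Bool}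
    (ho : IsOrientation (a ∪ b) o) (ho' : IsOrientation (a ∪ b) o') : QQ (a ∪ b) (sg o) = QQ (a ∪ b) (sg o') := by
  obtain ⟨u, hu, -, hA⟩ := path_or ha
  obtain ⟨w, hw, ⟨f, hf, hfw⟩, hB⟩ := path_or hb
  obtain ⟨v, hv⟩ := partner hD hf
  have hwR : w ∈ a ∪ b := Finset.mem_union_right _ hw
  obtain ⟨v1, v2, v3, -⟩ := hv w hwR
  have hva : v w ∈ a := (Finset.mem_union.1 v1).resolve_right fun k => v2 (hfw _ k v3)
  have key : ∀ o', IsOrientation (a ∪ b) o' → o u = o' u → QQ (a ∪ b) (sg o) = QQ (a ∪ b) (sg o') := by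
    intro o' ho' h
    have h1 := hA o o' (ho.mono Finset.subset_union_left) (ho'.mono Finset.subset_union_left) h
    have h2 := hB o o' (ho.mono Finset.subset_union_right) (ho'.mono Finset.subset_union_right) (by
      have i1 := orient_ne ho hf v1 hwR v2 v3
      have i2 := orient_ne ho' hf v1 hwR v2 v3
      exact bool_aux i1 i2 (h1 _ hva))
    have h3 : ∀ p ∈ a ∪ b, sg o p = sg o' p := fun p hp => sg_congr ((Finset.mem_union.1 hp).elim (h1 p) (h2 p))
    exact Finset.sum_congr rfl fun p hp => Finset.sum_congr rfl fun q hq => by rw [h3 p hp, h3 q hq]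
  by_cases h : o u = o' u
  · exact key o' ho' h
  · rw [key _ (ori_not ho') (bool_aux (Ne.symm h) (by simp : o' u ≠ !o' u) rfl), QQ_not]

lemma fin_tb {T T' : Theta} (hT : ThetaOK T) (hT' : ThetaOK T') (h : ThetaEquiv T T') {o : Pt → Bool}
    (ho : IsOrientation (T.a ∪ T.b) o) :
    (∃ o', IsOrientation (T'.a ∪ T'.b) o' ∧ tb (T'.a ∪ T'.b) o' = tb (T.a ∪ T.b) o) ∧
    ∀ o', IsOrientation (T'.a ∪ T'.b) o' → tb (T.a ∪ T.b) o = tb (T'.a ∪ T'.b) o' := by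
  have d1 := UI_diag hT (I := {0, 1}) (.inl rfl)
  have d2 := UI_diag hT' (I := {0, 1}) (.inl rfl)
  have h1 := equiv_leg h (I := {0, 1}) (.inl rfl)
  rw [UI01] at d1 d2
  rw [UI01, UI01] at h1
  obtain ⟨o1, ho1, e⟩ := OTr_equiv h1 o ho
  refine ⟨⟨o1, ho1, by rw [tb_eq d1 ho, tb_eq d2 ho1, e]⟩, fun o' ho' => ?_⟩
  rw [tb_eq d1 ho, tb_eq d2 ho', ← e, indep hT'.1 hT'.2.1 d2 ho1 ho']

end

/-- **Proposition.**  If the rectangular Θ-diagrams `(α, β, γ, δ)` and `(α', β', γ', δ')` are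
Legendrian equivalent, then (i) `tb (α ∪ β) = tb (α' ∪ β')`; in particular, if `(α, β)` is a
bypass of weight `b` for `β ∪ γ ∪ δ`, then `(α', β')` is a bypass of weight `b` for
`β' ∪ γ' ∪ δ'`; and (ii) the rectangular diagrams `α ∪ γ ∪ δ` and `α' ∪ γ' ∪ δ'` are
Legendrian equivalent. -/
theorem theta_equiv_invariants (T T' : Theta)
    (hT : ThetaOK T) (hT' : ThetaOK T') (h : ThetaEquiv T T') :
    ((∀ o o' : Pt → Bool, IsOrientation (T.a ∪ T.b) o → IsOrientation (T'.a ∪ T'.b) o' →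
        tb (T.a ∪ T.b) o = tb (T'.a ∪ T'.b) o') ∧
      ∀ b : ℕ, IsBypass (T.b ∪ T.c ∪ T.d) T.a T.b → BypassWeight T.a T.b b →
        IsBypass (T'.b ∪ T'.c ∪ T'.d) T'.a T'.b ∧ BypassWeight T'.a T'.b b) ∧
    LegEquiv (T.a ∪ T.c ∪ T.d) (T'.a ∪ T'.c ∪ T'.d) := by
  refine ⟨⟨fun o o' ho ho' => (fin_tb hT hT' h ho).2 o' ho', fun b hb ⟨o, ho, e⟩ => ⟨bypass_transfer hT hT' (equiv_copy h) hb, ?_⟩⟩, ?_⟩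
  · obtain ⟨o', ho', e'⟩ := (fin_tb hT hT' h ho).1
    exact ⟨o', ho', e'.trans e⟩
  · have := equiv_leg h (I := {0, 2, 3}) (.inr rfl)
    rwa [UI023, UI023] at this
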